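/- arXiv:2208.07782 — 3 statements merged into one kernel-verified Lean document; each statement's English description precedes it below -/
import Mathlib

section
/- If G is a finite nilpotent group, then every complex irreducible character χ of G satisfies χ(1)² divides |G : ker χ|. -/
open CategoryTheory Module

/-- The kernel of (the representation affording) an irreducible character. -/
noncomputable def repKer {G : Type} [Group G] (V : FDRep ℂ G) : Subgroup G :=
  MonoidHom.ker V.ρ.toHomUnits

namespace NilpDeg

/-- The subgroup of elements acting as scalars. -/
def scal {G V : Type} [Group G] [AddCommGroup V] [Module ℂ V] (ρ : Representation ℂ G V) :
    Subgroup G where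
  carrier := {g | ∃ a : ℂ, ρ g = a • 1}
  one_mem' := ⟨1, by simp⟩
  mul_mem' := by
    rintro g h ⟨a, ha⟩ ⟨b, hb⟩
    exact ⟨a * b, by rw [map_mul, ha, hb, smul_mul_smul_comm, one_mul]⟩
  inv_mem' := by
    rintro g ⟨a, ha⟩
    refine ⟨a⁻¹, ?_⟩
    have h1 : ρ g * ρ g⁻¹ = 1 := by rw [← map_mul]; simp
    rw [ha, smul_mul_assoc, one_mul] at h1
    by_cases h : a = 0
    · subst h
      have : (1 : V →ₗ[ℂ] V) = 0 := by rw [← h1, zero_smul]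
      rw [← mul_one (ρ g⁻¹), this]; simp
    · rw [← h1, smul_smul, inv_mul_cancel₀ h, one_smul]

instance {G V : Type} [Group G] [AddCommGroup V] [Module ℂ V] (ρ : Representation ℂ G V) :
    (scal ρ).Normal where
  conj_mem := by
    rintro g ⟨a, ha⟩ h
    refine ⟨a, ?_⟩
    rw [map_mul, map_mul, ha, mul_smul_comm, mul_one, smul_mul_assoc, ← map_mul]
    simp

/-- Restriction of a representation to a subgroup and a stable subspace. -/
def res {G V : Type} [Group G] [AddCommGroup V] [Module ℂ V] (ρ : Representation ℂ G V)
    (C : Subgroup G) (W : Submodule ℂ V) (h : ∀ c ∈ C, ∀ w ∈ W, ρ c w ∈ W) :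
    Representation ℂ C W where
  toFun c := (ρ (c : G)).restrict (h c c.2)
  map_one' := by ext; simp
  map_mul' a b := by ext; simp

theorem exists_noncentral {G : Type} [Group G] [Group.IsNilpotent G] (Z : Subgroup G) [Z.Normal]
    (hZ : Z ≠ ⊤) : ∃ x, x ∉ Z ∧ ∀ g, g * x * g⁻¹ * x⁻¹ ∈ Z := by
  have : Nontrivial (G ⧸ Z) := QuotientGroup.nontrivial_iff.mpr hZ
  have h := Group.IsNilpotent.center_ne_bot (G := G ⧸ Z)
  obtain ⟨y, hy, hy1⟩ := (Subgroup.bot_or_exists_ne_one _).resolve_left h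
  obtain ⟨x, rfl⟩ := QuotientGroup.mk_surjective y
  refine ⟨x, fun h => hy1 ((QuotientGroup.eq_one_iff x).mpr h), fun g => ?_⟩
  rw [← QuotientGroup.eq_one_iff]
  have := Subgroup.mem_center_iff.mp hy (g : G ⧸ Z)
  rw [QuotientGroup.mk_mul, QuotientGroup.mk_mul, QuotientGroup.mk_mul, QuotientGroup.mk_inv,
    QuotientGroup.mk_inv]
  rw [this]; simp

/-- The sum map from `n` translated copies of a subspace. -/
noncomputable def Phi {G V ι : Type} [Group G] [AddCommGroup V] [Module ℂ V] [Fintype ι]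
    (ρ : Representation ℂ G V) (s : ι → G) (U : Submodule ℂ V) : (ι → U) →ₗ[ℂ] V :=
  ∑ i, (ρ (s i)) ∘ₗ U.subtype ∘ₗ LinearMap.proj i

theorem main (n : ℕ) : ∀ (G V : Type) [Group G] [Finite G] [Group.IsNilpotent G]
    [AddCommGroup V] [Module ℂ V] [FiniteDimensional ℂ V] [Nontrivial V]
    (ρ : Representation ℂ G V)
    (_ : ∀ U : Submodule ℂ V, (∀ g, ∀ u ∈ U, ρ g u ∈ U) → U ≠ ⊥ → U = ⊤)
    (_ : finrank ℂ V = n), n ^ 2 ∣ (scal ρ).index := by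
  classical
  induction n using Nat.strong_induction_on with
  | _ n ih =>
  intro G V _ _ _ _ _ _ _ ρ hirr hn
  by_cases hZ : scal ρ = ⊤
  · -- all scalars: dimension one
    obtain ⟨v, hv⟩ := exists_ne (0 : V)
    have hs : Submodule.span ℂ {v} = ⊤ := by
      apply hirr
      · intro g u hu
        obtain ⟨a, ha⟩ : g ∈ scal ρ := hZ ▸ Subgroup.mem_top g
        rw [ha]
        exact Submodule.smul_mem _ a hu
      · simpa using hv
    have : n = 1 := by
      rw [← hn, ← finrank_top, ← hs, finrank_span_singleton hv]
    simp [this]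
  obtain ⟨x, hxZ, hx⟩ := exists_noncentral (scal ρ) hZ
  have hinv : ∀ g v, ρ g⁻¹ (ρ g v) = v := fun g v => by
    rw [← Module.End.mul_apply, ← map_mul]; simp
  have hinv' : ∀ g v, ρ g (ρ g⁻¹ v) = v := fun g v => by
    rw [← Module.End.mul_apply, ← map_mul]; simp
  have hne : ∀ g, ρ g ≠ 0 := fun g h => by
    obtain ⟨v, hv⟩ := exists_ne (0 : V)
    apply hv; rw [← hinv g v, h]; simp
  have hex : ∀ g, ∃ a : ℂ, ρ g * ρ x = a • (ρ x * ρ g) := by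
    intro g
    obtain ⟨a, ha⟩ := hx g
    refine ⟨a, ?_⟩
    have : g * x = (g * x * g⁻¹ * x⁻¹) * (x * g) := by group
    rw [← map_mul, this, map_mul, ha, map_mul, smul_mul_assoc, one_mul]
  choose l hl using hex
  have huniq : ∀ g (a b : ℂ), a • (ρ x * ρ g) = b • (ρ x * ρ g) → a = b := by
    intro g a b h
    rw [← map_mul] at h
    exact smul_left_injective ℂ (hne _) h
  let L0 : G →* ℂ :=
    { toFun := l
      map_one' := huniq 1 _ _ (by rw [← hl]; simp)
      map_mul' := fun g h => huniq (g * h) _ _ (by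
        rw [← hl, map_mul, mul_assoc, hl h, mul_smul_comm, ← mul_assoc, hl g, smul_mul_assoc,
          smul_smul, mul_assoc, mul_comm (l h)]) }
  let L : G →* ℂˣ := L0.toHomUnits
  have hL : ∀ g, ((L g : ℂˣ) : ℂ) = l g := fun g => rfl
  set C := L.ker with hC
  have hCmem : ∀ g, g ∈ C ↔ l g = 1 := fun g => by
    rw [hC, MonoidHom.mem_ker, Units.ext_iff, hL]; rfl
  -- eigenspace
  obtain ⟨μ, hμ⟩ := Module.End.exists_eigenvalue (ρ x)
  set W := Module.End.eigenspace (ρ x) μ with hW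
  have hWbot : W ≠ ⊥ := hμ
  have hμ0 : μ ≠ 0 := by
    rintro rfl
    obtain ⟨v, hv⟩ := hμ.exists_hasEigenvector
    apply hv.2
    have := hv.apply_eq_smul
    rw [← hinv x v, this]; simp
  have hshift : ∀ g, ∀ w ∈ W, ρ g w ∈ Module.End.eigenspace (ρ x) ((l g)⁻¹ * μ) := by
    intro g w hw
    rw [Module.End.mem_eigenspace_iff] at hw ⊢
    have h1 := LinearMap.congr_fun (hl g) w
    simp only [Module.End.mul_apply, LinearMap.smul_apply, hw, map_smul] at h1
    rw [mul_smul, h1, smul_smul, inv_mul_cancel₀, one_smul]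
    rw [← hL]; exact Units.ne_zero _
  have hWC : ∀ c ∈ C, ∀ w ∈ W, ρ c w ∈ W := by
    intro c hc w hw
    have := hshift c w hw
    rwa [(hCmem c).mp hc, inv_one, one_mul] at this
  -- sections
  let ι := L.range
  have : Fintype ι := @Fintype.ofFinite _ (inferInstanceAs (Finite (Set.range L)))
  have hs : ∀ i : ι, ∃ g, L g = i := fun i => i.2
  choose s hs using hs
  have hPhi : ∀ (U : Submodule ℂ V) f, Phi ρ s U f = ∑ i, ρ (s i) (f i) := by
    intro U f; simp [Phi]
  have hcard : C.index = Fintype.card ι := by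
    rw [hC, Subgroup.index_ker, Nat.card_eq_fintype_card]
  have hfr : ∀ U : Submodule ℂ V, finrank ℂ (ι → U) = C.index * finrank ℂ U := by
    intro U
    rw [finrank_pi_fintype, hcard]; simp
  have hsurj : ∀ U : Submodule ℂ V, (∀ c ∈ C, ∀ w ∈ U, ρ c w ∈ U) → U ≠ ⊥ →
      n ≤ C.index * finrank ℂ U := by
    intro U hUC hU
    have htop : (⨆ g, U.map (ρ g)) = ⊤ := by
      apply hirr
      · intro g u hu
        have : (⨆ g, U.map (ρ g)) ≤ (⨆ g, U.map (ρ g)).comap (ρ g) := by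
          apply iSup_le
          intro h
          rintro _ ⟨w, hw, rfl⟩
          have : ρ g (ρ h w) = ρ (g * h) w := by simp
          rw [Submodule.mem_comap, this]
          exact Submodule.mem_iSup_of_mem (g * h) ⟨w, hw, rfl⟩
        exact this hu
      · intro h
        apply hU
        rw [eq_bot_iff, ← h]
        exact fun u hu => Submodule.mem_iSup_of_mem (1 : G) ⟨u, hu, by simp⟩
    have hr : (⊤ : Submodule ℂ V) ≤ LinearMap.range (Phi ρ s U) := by
      rw [← htop]
      apply iSup_le
      rintro g _ ⟨w, hw, rfl⟩
      have hc : (s ⟨L g, g, rfl⟩)⁻¹ * g ∈ C := by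
        rw [hC, MonoidHom.mem_ker, map_mul, map_inv, hs]; simp
      refine ⟨Pi.single ⟨L g, g, rfl⟩ ⟨ρ ((s ⟨L g, g, rfl⟩)⁻¹ * g) w, hUC _ hc w hw⟩, ?_⟩
      rw [hPhi, Finset.sum_eq_single ⟨L g, g, rfl⟩]
      · simp [hinv']
      · intro b _ hb
        simp [Pi.single_eq_of_ne hb]
      · simp
    have := LinearMap.finrank_le_finrank_of_surjective (f := Phi ρ s U)
      (LinearMap.range_eq_top.mp (top_le_iff.mp hr))
    rwa [hfr, hn] at this
  have hinj : C.index * finrank ℂ W ≤ n := by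
    rw [← hfr, ← hn]
    apply LinearMap.finrank_le_finrank_of_injective (f := Phi ρ s W)
    rw [← LinearMap.ker_eq_bot, LinearMap.ker_eq_bot']
    intro f hf
    rw [hPhi] at hf
    have hind := (Module.End.eigenspaces_iSupIndep (ρ x)).comp
      (f := fun i : ι => ((i : ℂˣ) : ℂ)⁻¹ * μ) (by
        intro i j hij
        have := mul_right_cancel₀ hμ0 hij
        exact Subtype.ext (Units.ext (inv_injective this)))
    rw [iSupIndep_iff_finsetSum_eq_zero_imp_eq_zero] at hind
    have := hind Finset.univ (fun i => ρ (s i) (f i)) (by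
      intro i _
      have := hshift (s i) (f i) (f i).2
      rwa [← hL, hs] at this) hf
    funext i
    have h0 := this i (Finset.mem_univ i)
    apply Subtype.ext
    rw [← hinv (s i) (f i), h0]; simp
  have hdim : C.index * finrank ℂ W = n := le_antisymm hinj (hsurj W hWC hWbot)
  have hlt : finrank ℂ W < n := by
    rw [← hn]
    apply Submodule.finrank_lt
    intro h
    apply hxZ
    refine ⟨μ, LinearMap.ext fun v => ?_⟩
    have : v ∈ W := h ▸ Submodule.mem_top
    simpa using Module.End.mem_eigenspace_iff.mp this
  have : Nontrivial W := Submodule.nontrivial_iff_ne_bot.mpr hWbot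
  have hCpos : 0 < C.index := Nat.pos_of_ne_zero Subgroup.index_ne_zero_of_finite
  have hrec := ih _ hlt C W (res ρ C W hWC) (by
    intro U hU hU0
    have h1 := hsurj (U.map W.subtype) (by
      rintro c hc _ ⟨u, hu, rfl⟩
      exact ⟨_, hU ⟨c, hc⟩ u hu, rfl⟩) (by
      intro h; apply hU0
      rw [eq_bot_iff]
      intro u hu
      have h3 : (u : V) ∈ U.map W.subtype := ⟨u, hu, rfl⟩
      rw [h, Submodule.mem_bot] at h3
      exact Subtype.ext h3)
    rw [← hdim] at h1
    have h2 := Nat.le_of_mul_le_mul_left h1 hCpos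
    rw [Submodule.finrank_map_subtype_eq] at h2
    exact Submodule.eq_top_of_finrank_eq (le_antisymm (Submodule.finrank_le U) h2)) rfl
  set ZW := scal (res ρ C W hWC) with hZW
  have hZC : scal ρ ≤ C := by
    rintro g ⟨a, ha⟩
    rw [hCmem]
    apply huniq g
    rw [← hl, ha]; simp
  have hZZW : (scal ρ).subgroupOf C ≤ ZW := by
    rintro ⟨g, hg⟩ ⟨a, ha⟩
    refine ⟨a, LinearMap.ext fun w => Subtype.ext ?_⟩
    exact LinearMap.congr_fun ha w.1
  have hxC : x ∈ C := by
    rw [hCmem]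
    apply huniq x
    rw [← hl]; simp
  have hxZW : (⟨x, hxC⟩ : C) ∈ ZW := by
    refine ⟨μ, LinearMap.ext fun w => Subtype.ext ?_⟩
    exact Module.End.mem_eigenspace_iff.mp w.2
  have hk : C.index ∣ ((scal ρ).subgroupOf C).relIndex ZW := by
    set k := ((scal ρ).subgroupOf C).relIndex ZW with hk
    have hxk : x ^ k ∈ scal ρ := by
      have := Subgroup.pow_index_mem (((scal ρ).subgroupOf C).subgroupOf ZW)
        (⟨⟨x, hxC⟩, hxZW⟩ : ZW)
      exact this
    obtain ⟨a, ha⟩ := hxk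
    have hpow : ∀ g, ∀ m : ℕ, ρ g * ρ x ^ m = (l g) ^ m • (ρ x ^ m * ρ g) := by
      intro g m
      induction m with
      | zero => simp
      | succ m ihm =>
        rw [pow_succ, ← mul_assoc, ihm, smul_mul_assoc, mul_assoc, hl, mul_smul_comm, smul_smul,
          pow_succ, mul_assoc]
    have hlk : ∀ g, l g ^ k = 1 := by
      intro g
      have h1 := hpow g k
      have h2 : ρ x ^ k * ρ g = ρ g * ρ x ^ k := by
        rw [← map_pow, ha]; simp
      rw [← h2, ← map_pow, ← map_mul] at h1
      apply smul_left_injective ℂ (hne (x ^ k * g))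
      simpa using h1.symm
    rw [hC, Subgroup.index_ker, ← IsCyclic.exponent_eq_card]
    apply Monoid.exponent_dvd_of_forall_pow_eq_one
    rintro ⟨_, g, rfl⟩
    apply Subtype.ext
    apply Units.ext
    simpa [hL] using hlk g
  have e1 := Subgroup.relIndex_mul_index hZC
  have e2 := Subgroup.relIndex_mul_index hZZW
  have e3 : (scal ρ).relIndex C = ((scal ρ).subgroupOf C).index := rfl
  rw [← e1, e3, ← e2, ← hdim]
  have := mul_dvd_mul (mul_dvd_mul hk hrec) (dvd_refl C.index)
  refine dvd_trans (dvd_of_eq ?_) this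
  ring

theorem irr_of_simple {G : Type} [Group G] (V : FDRep ℂ G) [Simple V] (U : Submodule ℂ V)
    (hU : ∀ g, ∀ u ∈ U, V.ρ g u ∈ U) (h0 : U ≠ ⊥) : U = ⊤ := by
  let σ : Representation ℂ G U :=
    { toFun := fun g => (V.ρ g).restrict (hU g)
      map_one' := by ext; simp
      map_mul' := fun a b => by ext; simp }
  let f : FDRep.of σ ⟶ V :=
    { hom := FGModuleCat.ofHom U.subtype
      comm := fun g => rfl }
  have hf : ∀ u : U, f.hom.hom.hom u = u.1 := fun u => rfl
  have hmono : Mono f := by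
    apply ConcreteCategory.mono_of_injective
    exact U.injective_subtype
  have hne : f ≠ 0 := by
    intro h
    apply h0
    rw [eq_bot_iff]
    intro u hu
    have := hf ⟨u, hu⟩
    rw [h] at this
    exact this.symm
  have hiso : IsIso f := isIso_of_mono_of_nonzero hne
  have hs := (FDRep.isoToLinearEquiv (asIso f)).surjective
  rw [eq_top_iff]
  intro v _
  obtain ⟨u, rfl⟩ := hs v
  exact u.2

theorem nontriv_of_simple {G : Type} [Group G] (V : FDRep ℂ G) [Simple V] : Nontrivial V := by
  by_contra h
  rw [not_nontrivial_iff_subsingleton] at h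
  apply id_nonzero V
  ext v
  exact Subsingleton.elim (α := V) _ _

end NilpDeg

/-- If `G` is a finite nilpotent group, then every complex irreducible character `χ` of `G`
satisfies `χ(1)² ∣ |G : ker χ|`. -/
theorem nilpotent_char_degree_sq_dvd_index_ker
    {G : Type} [Group G] [Finite G] [Group.IsNilpotent G]
    (V : FDRep ℂ G) [Simple V] :
    (finrank ℂ V) ^ 2 ∣ (repKer V).index := by
  have := NilpDeg.nontriv_of_simple V
  refine dvd_trans (NilpDeg.main _ G V V.ρ (NilpDeg.irr_of_simple V) rfl) ?_
  apply Subgroup.index_dvd_of_le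
  intro g hg
  refine ⟨1, ?_⟩
  rw [repKer, MonoidHom.mem_ker, Units.ext_iff] at hg
  rw [one_smul]
  exact hg
end

section
/- Let a nontrivial finite nilpotent group H act faithfully and irreducibly on an elementary abelian p-group V, and let G = V ⋊ H. Assume that for each v ∈ V, either C_H(v) = 1 or |H| divides |C_H(v)|². Then G is a Frobenius group with Frobenius complement H and Frobenius kernel V. -/
section frobHelpers

theorem fh_card_rel {G : Type*} [Group G] {A M : Subgroup G} (h : A ≤ M) :
    Nat.card A * A.relIndex M = Nat.card M := by
  rw [← Subgroup.relIndex_bot_left, ← Subgroup.relIndex_bot_left,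
    Subgroup.relIndex_mul_relIndex _ _ _ bot_le h]

theorem fh_card_mul_le {G : Type*} [Group G] [Finite G] (A B M : Subgroup G)
    (hA : A ≤ M) (hB : B ≤ M) :
    Nat.card A * Nat.card B ≤ Nat.card (A ⊓ B : Subgroup G) * Nat.card M := by
  have h := Subgroup.relIndex_inf_le (H := A) (K := B) (L := M)
  have e1 := fh_card_rel (inf_le_left.trans hA : A ⊓ B ≤ M)
  have e2 := fh_card_rel hA
  have e3 := fh_card_rel hB
  have p0 : 0 < Nat.card (A ⊓ B : Subgroup G) := Nat.card_pos
  have p1 : 0 < Nat.card M := Nat.card_pos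
  refine Nat.le_of_mul_le_mul_right ?_ p1
  calc Nat.card A * Nat.card B * Nat.card M
      = Nat.card A * Nat.card B * (Nat.card (A ⊓ B : Subgroup G) * (A ⊓ B).relIndex M) := by rw [e1]
    _ ≤ Nat.card A * Nat.card B * (Nat.card (A ⊓ B : Subgroup G) * (A.relIndex M * B.relIndex M)) := by
        gcongr
    _ = Nat.card (A ⊓ B : Subgroup G) * (Nat.card A * A.relIndex M) * (Nat.card B * B.relIndex M) := by ring
    _ = _ := by rw [e2, e3]

theorem fh_rel {G : Type*} [Group G] [Group.IsNilpotent G] (A B : Subgroup G) [hB : B.Normal]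
    (h : ¬ B ≤ A) : ∃ b ∈ B, b ∉ A ∧ ∀ g : G, g * b * g⁻¹ * b⁻¹ ∈ A ⊓ B := by
  classical
  have hex : ∃ k, ¬ (B ⊓ Subgroup.upperCentralSeries G k ≤ A) := by
    obtain ⟨n, hn⟩ := Group.IsNilpotent.nilpotent G
    refine ⟨n, ?_⟩
    rw [hn]; simpa using h
  have h1 := Nat.find_spec hex
  have h2 : Nat.find hex ≠ 0 := by
    intro h0
    rw [h0] at h1
    apply h1
    simp
  obtain ⟨k, hk⟩ := Nat.exists_eq_succ_of_ne_zero h2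
  have h3 : B ⊓ Subgroup.upperCentralSeries G k ≤ A := by
    by_contra hc
    have := Nat.find_min' hex hc
    omega
  rw [hk] at h1
  obtain ⟨b, hb, hbA⟩ := SetLike.not_le_iff_exists.1 h1
  refine ⟨b, hb.1, hbA, fun g => ?_⟩
  have hbB : g * b * g⁻¹ * b⁻¹ ∈ B := B.mul_mem (hB.conj_mem b hb.1 g) (B.inv_mem hb.1)
  refine ⟨h3 ⟨hbB, ?_⟩, hbB⟩
  have := Subgroup.mem_upperCentralSeries_succ_iff.1 hb.2 g
  have h5 := inv_mem this
  convert h5 using 1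
  simp [mul_assoc, commutatorElement_def]

theorem fh_card_map {G G' : Type*} [Group G] [Group G'] [Finite G] (A : Subgroup G) (f : G →* G') :
    Nat.card A = Nat.card (A ⊓ f.ker : Subgroup G) * Nat.card (A.map f) := by
  have h := (f.comp A.subtype).ker.card_mul_index
  rw [Subgroup.index_ker, MonoidHom.range_comp, Subgroup.range_subtype, ← MonoidHom.comap_ker] at h
  change Nat.card (f.ker.subgroupOf A) * _ = _ at h
  rw [← h]
  congr 1
  rw [inf_comm, ← Subgroup.inf_subgroupOf_right]
  exact (Nat.card_congr (Subgroup.subgroupOfEquivOfLe (inf_le_right)).toEquiv)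

theorem fh_cyclic {A : Type*} [CommGroup A] [Finite A] (q : ℕ) [Fact q.Prime] (hA : IsPGroup q A)
    (h : Nat.card (powMonoidHom q : A →* A).ker ≤ q) : IsCyclic A := by
  have key : ∀ k, Nat.card (powMonoidHom (q ^ k) : A →* A).ker ≤ q ^ k := by
    intro k
    induction k with
    | zero => 
      have : (powMonoidHom (q ^ 0) : A →* A).ker = ⊥ := by
        ext x; simp [MonoidHom.mem_ker]
      rw [this]; simp
    | succ k ih =>
      rw [fh_card_map _ (powMonoidHom q : A →* A), pow_succ']
      refine Nat.mul_le_mul ((Subgroup.card_le_of_le inf_le_right).trans h) ?_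
      refine (Subgroup.card_le_of_le ?_).trans ih
      rintro _ ⟨x, hx, rfl⟩
      simp only [SetLike.mem_coe, MonoidHom.mem_ker, powMonoidHom_apply] at hx ⊢
      rw [← pow_mul, hx]
  obtain ⟨x, hx⟩ := Monoid.exists_orderOf_eq_exponent (Monoid.ExponentExists.of_finite (G := A))
  obtain ⟨k, hk⟩ := IsPGroup.iff_orderOf.1 hA x
  apply isCyclic_of_card_le_orderOf x
  rw [hk]
  refine le_trans ?_ (key k)
  have : (powMonoidHom (q ^ k) : A →* A).ker = ⊤ := by
    ext y
    simp only [MonoidHom.mem_ker, powMonoidHom_apply, Subgroup.mem_top, iff_true]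
    rw [← hk, hx, Monoid.pow_exponent_eq_one]
  rw [this]; simp

/-- dichotomy -/
theorem fh_dich {G : Type*} [Group G] [Finite G] (q : ℕ) [hq : Fact q.Prime] (hG : IsPGroup q G)
    (z : G) (hz : z ∈ Subgroup.center G) (hz1 : z ≠ 1) (hzq : z ^ q = 1) :
    (∃ a : G, a ^ q = 1 ∧ a ∉ Subgroup.zpowers z ∧ ∀ g : G, g * a * g⁻¹ * a⁻¹ ∈ Subgroup.zpowers z) ∨
    (∀ C : Subgroup G, z ∉ C → Nat.card C ^ 2 < Nat.card G) := by
  classical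
  by_cases hi : ∃ a : G, a ^ q = 1 ∧ a ∉ Subgroup.zpowers z ∧
      ∀ g : G, g * a * g⁻¹ * a⁻¹ ∈ Subgroup.zpowers z
  · exact Or.inl hi
  right
  have : Group.IsNilpotent G := hG.isNilpotent
  let S : Set (Subgroup G) := {N | N.Normal ∧ ∀ x ∈ N, ∀ y ∈ N, x * y = y * x}
  have hS : S.Finite := Set.toFinite _
  obtain ⟨N, hN⟩ := hS.exists_maximal ⟨⊥, by
    refine ⟨inferInstance, ?_⟩
    intro x hx y hy
    rw [Subgroup.mem_bot] at hx hy
    rw [hx, hy]⟩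
  have hNn : N.Normal := hN.prop.1
  have hNc := hN.prop.2
  have hCN : Subgroup.centralizer (N : Set G) ≤ N := by
    by_contra hc
    obtain ⟨b, hb, hbN, hbc⟩ := fh_rel N (Subgroup.centralizer (N : Set G)) hc
    apply hbN
    have hmem : Subgroup.closure ((N : Set G) ∪ {b}) ∈ S := by
      constructor
      · rw [Subgroup.closure_union, Subgroup.closure_eq]
        constructor
        intro n hn g
        rw [← Subgroup.zpowers_eq_closure] at hn ⊢
        rw [Subgroup.mem_sup_of_normal_left] at hn
        obtain ⟨y, hy, w, hw, rfl⟩ := hn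
        have e : g * (y * w) * g⁻¹ = (g * y * g⁻¹) * (g * w * g⁻¹) := by group
        rw [e]
        refine Subgroup.mul_mem _ (Subgroup.mem_sup_left (hNn.conj_mem y hy g)) ?_
        obtain ⟨k, rfl⟩ := Subgroup.mem_zpowers_iff.1 hw
        rw [← conj_zpow]
        refine Subgroup.zpow_mem _ ?_ k
        have e2 : g * b * g⁻¹ = (g * b * g⁻¹ * b⁻¹) * b := by group
        rw [e2]
        exact Subgroup.mul_mem _ (Subgroup.mem_sup_left (hbc g).1)
          (Subgroup.mem_sup_right (Subgroup.mem_zpowers b))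
      · have hcomm : IsMulCommutative (Subgroup.closure ((N : Set G) ∪ {b})) := by
          apply Subgroup.isMulCommutative_closure
          have hb' : ∀ x ∈ N, x * b = b * x := fun x hx => Subgroup.mem_centralizer_iff.1 hb x hx
          rintro x (hx | hx) y (hy | hy)
          · exact hNc x hx y hy
          · rw [Set.mem_singleton_iff] at hy; subst hy; exact hb' x hx
          · rw [Set.mem_singleton_iff] at hx; subst hx; exact (hb' y hy).symm
          · rw [Set.mem_singleton_iff] at hx hy; rw [hx, hy]
        intro x hx y hy
        exact congrArg Subtype.val (hcomm.is_comm.comm ⟨x, hx⟩ ⟨y, hy⟩)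
    have hle : N ≤ Subgroup.closure ((N : Set G) ∪ {b}) :=
      fun x hx => Subgroup.subset_closure (Or.inl hx)
    exact hN.le_of_ge hmem hle (Subgroup.subset_closure (Or.inr rfl))
  have hzN : z ∈ N := hCN (Subgroup.mem_centralizer_iff.2 fun x _ => (Subgroup.mem_center_iff.1 hz x))
  let Om : Subgroup G :=
    { carrier := {x | x ∈ N ∧ x ^ q = 1}
      one_mem' := ⟨N.one_mem, one_pow q⟩
      mul_mem' := by
        rintro x y ⟨hx, hx'⟩ ⟨hy, hy'⟩
        refine ⟨N.mul_mem hx hy, ?_⟩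
        have : Commute x y := hNc x hx y hy
        rw [this.mul_pow, hx', hy', one_mul]
      inv_mem' := by
        rintro x ⟨hx, hx'⟩
        exact ⟨N.inv_mem hx, by rw [inv_pow, hx', inv_one]⟩ }
  have hOmn : Om.Normal := by
    constructor
    rintro x ⟨hx, hx'⟩ g
    exact ⟨hNn.conj_mem x hx g, by rw [conj_pow, hx']; simp⟩
  have hOm : Om ≤ Subgroup.zpowers z := by
    by_contra hc
    obtain ⟨a, ha, haz, hac⟩ := fh_rel _ _ hc
    exact hi ⟨a, ha.2, haz, fun g => (hac g).1⟩
  have hzo : orderOf z = q := orderOf_eq_prime hzq hz1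
  have hcyc : IsCyclic N := by
    let _ : CommGroup N := { (inferInstance : Group N) with
      mul_comm := fun x y => Subtype.ext (hNc x x.2 y y.2) }
    apply fh_cyclic q (hG.to_subgroup N)
    refine le_of_le_of_eq ?_ ((Nat.card_zpowers z).trans hzo)
    refine Nat.card_le_card_of_injective
      (fun x => ⟨x.1.1, hOm ⟨x.1.2, ?_⟩⟩) ?_
    · have := x.2
      rw [MonoidHom.mem_ker, powMonoidHom_apply] at this
      exact congrArg Subtype.val this
    · intro x y hxy
      apply Subtype.ext; apply Subtype.ext
      have h3 := congrArg (fun t : Subgroup.zpowers z => (t : G)) hxy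
      exact h3
  intro C hzC
  have hdis : C ⊓ N = ⊥ := by
    by_contra hne
    have hp : IsPGroup q (C ⊓ N : Subgroup G) := hG.to_subgroup _
    have : Nontrivial (C ⊓ N : Subgroup G) := (Subgroup.nontrivial_iff_ne_bot _).2 hne
    have hdvd : q ∣ Nat.card (C ⊓ N : Subgroup G) := by
      obtain ⟨n, hn, h⟩ := hp.nontrivial_iff_card.1 this
      rw [h]; exact dvd_pow_self q (by omega)
    obtain ⟨y, hy⟩ := exists_prime_orderOf_dvd_card' q hdvd
    have hy1 : (y : G) ∈ Subgroup.zpowers z := hOm ⟨y.2.2, by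
      have := pow_orderOf_eq_one y
      rw [hy] at this
      exact congrArg Subtype.val this⟩
    have hle : Subgroup.zpowers (y : G) ≤ Subgroup.zpowers z := by
      rwa [Subgroup.zpowers_le]
    have heq := Subgroup.eq_of_le_of_card_ge hle (by
      rw [Nat.card_zpowers, Nat.card_zpowers, hzo, Subgroup.orderOf_coe, hy])
    apply hzC
    have h1 : z ∈ Subgroup.zpowers (y : G) := heq ▸ Subgroup.mem_zpowers z
    have h2 : Subgroup.zpowers (y : G) ≤ C := by
      rw [Subgroup.zpowers_le]; exact y.2.1
    exact h2 h1
  have h1 := fh_card_mul_le C N ⊤ le_top le_top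
  rw [hdis] at h1
  simp only [Subgroup.card_bot, one_mul, Subgroup.card_top] at h1
  have h2 : Nat.card C ≤ Nat.card (MulAut N) := by
    let f : C →* MulAut N := (MulAut.conjNormal (H := N)).comp C.subtype
    refine Nat.card_le_card_of_injective f ?_
    rw [injective_iff_map_eq_one]
    intro c hc
    have hcc : (c : G) ∈ N := by
      apply hCN
      rw [Subgroup.mem_centralizer_iff]
      intro x hx
      have := congrArg (fun e : MulAut N => ((e ⟨x, hx⟩ : N) : G)) hc
      simp only [f, MonoidHom.comp_apply, MulAut.conjNormal_apply, Subgroup.coe_subtype, MulAut.one_apply] at this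
      rw [mul_inv_eq_iff_eq_mul] at this
      exact this.symm
    have : (c : G) ∈ C ⊓ N := ⟨c.2, hcc⟩
    rw [hdis, Subgroup.mem_bot] at this
    exact Subtype.ext this
  rw [IsCyclic.card_mulAut] at h2
  have h3 : Nat.totient (Nat.card N) < Nat.card N := by
    apply Nat.totient_lt
    rw [Finite.one_lt_card_iff_nontrivial]
    exact ⟨⟨z, hzN⟩, 1, fun h => hz1 (congrArg Subtype.val h)⟩
  have hpos : 0 < Nat.card C := Nat.card_pos
  nlinarith

/-- norm -/
def fhN {G V : Type*} [Group G] [AddCommGroup V] [DistribMulAction G V] (q : ℕ) (x : G) (v : V) : V :=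
  ∑ i ∈ Finset.range q, x ^ i • v

section act
variable {G V : Type*} [Group G] [AddCommGroup V] [DistribMulAction G V] (q : ℕ) 

theorem fh_coprime [Finite V] (hV : (Nat.card V).Coprime q) (v : V) (h : q • v = 0) : v = 0 := by
  have h1 : addOrderOf v ∣ q := addOrderOf_dvd_of_nsmul_eq_zero h
  have h2 : addOrderOf v ∣ Nat.card V := addOrderOf_dvd_natCard v
  have := Nat.dvd_gcd h2 h1
  rw [hV, Nat.dvd_one, AddMonoid.addOrderOf_eq_one_iff] at this
  exact this

theorem fhN_add (x : G) (u v : V) : fhN q x (u + v) = fhN q x u + fhN q x v := by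
  simp [fhN, Finset.sum_add_distrib]

theorem fhN_zero (x : G) : fhN q x (0 : V) = 0 := by
  simp [fhN]

theorem fhN_neg (x : G) (u : V) : fhN q x (-u) = - fhN q x u := by
  simp [fhN]

theorem fhN_fix (x : G) (hx : x ^ q = 1) (v : V) : x • fhN q x v = fhN q x v := by
  have h1 := Finset.sum_range_succ (fun i => x ^ i • v) q
  have h2 := Finset.sum_range_succ' (fun i => x ^ i • v) q
  rw [h1, hx, pow_zero] at h2
  have h3 := add_right_cancel h2
  rw [fhN, h3, ← h3, Finset.smul_sum, h3]
  refine Finset.sum_congr rfl fun i _ => ?_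
  rw [smul_smul, ← pow_succ']

theorem fh_pow_fix (x : G) (v : V) (h : x • v = v) (i : ℕ) : x ^ i • v = v := by
  have : x ^ i ∈ MulAction.stabilizer G v :=
    Subgroup.pow_mem _ (MulAction.mem_stabilizer_iff.2 h) i
  exact this

theorem fhN_of_fix (x : G) (v : V) (h : x • v = v) : fhN q x v = q • v := by
  simp [fhN, fh_pow_fix x v h]

theorem fhN_conj (g x : G) (v : V) : g • fhN q x v = fhN q (g * x * g⁻¹) (g • v) := by
  simp only [fhN, Finset.smul_sum]
  refine Finset.sum_congr rfl fun i _ => ?_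
  rw [conj_pow, smul_smul, smul_smul]
  congr 1
  group

theorem fhN_fpf (x : G) (hx : x ^ q = 1) (hf : ∀ v : V, x • v = v → v = 0) (v : V) :
    fhN q x v = 0 := hf _ (fhN_fix q x hx v)

theorem fh_fpf_zpow [hq : Fact q.Prime] (z y : G) (hz : z ^ q = 1) (hf : ∀ v : V, z • v = v → v = 0)
    (hy : y ∈ Subgroup.zpowers z) (hy1 : y ≠ 1) : ∀ v : V, y • v = v → v = 0 := by
  intro v hv
  apply hf
  have hz1 : z ≠ 1 := by
    rintro rfl
    rw [Subgroup.zpowers_one_eq_bot, Subgroup.mem_bot] at hy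
    exact hy1 hy
  have hzo : orderOf z = q := orderOf_eq_prime hz hz1
  have hfz : Finite (Subgroup.zpowers z) := by
    apply Nat.finite_of_card_ne_zero
    rw [Nat.card_zpowers, hzo]; exact hq.out.ne_zero
  have hyq : y ^ q = 1 := by
    obtain ⟨k, rfl⟩ := Subgroup.mem_zpowers_iff.1 hy
    rw [← zpow_natCast, ← zpow_mul, mul_comm, zpow_mul, zpow_natCast, hz, one_zpow]
  have heq := Subgroup.eq_of_le_of_card_ge (H := Subgroup.zpowers y) (K := Subgroup.zpowers z) (by rwa [Subgroup.zpowers_le]) (by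
      rw [Nat.card_zpowers, Nat.card_zpowers, hzo, orderOf_eq_prime hyq hy1])
  have h1 : z ∈ Subgroup.zpowers y := heq ▸ Subgroup.mem_zpowers z
  have h2 : Subgroup.zpowers y ≤ MulAction.stabilizer G v := by
    rw [Subgroup.zpowers_le]; exact hv
  exact h2 h1

theorem fh_pow_ne_one [hq : Fact q.Prime] (z : G) (hz : z ^ q = 1) (hz1 : z ≠ 1) (j : ℕ)
    (hj : ¬ q ∣ j) : z ^ j ≠ 1 := by
  intro h
  apply hj
  rw [← orderOf_eq_prime hz hz1]
  exact orderOf_dvd_of_pow_eq_one h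

theorem fhN_sum [hq : Fact q.Prime] (a z : G) (hc : Commute a z) (hz : z ^ q = 1) (hz1 : z ≠ 1)
    (hf : ∀ v : V, z • v = v → v = 0) (v : V) :
    ∑ i ∈ Finset.range q, fhN q (a * z ^ i) v = q • v := by
  have h1 : ∑ i ∈ Finset.range q, fhN q (a * z ^ i) v
      = ∑ j ∈ Finset.range q, a ^ j • fhN q (z ^ j) v := by
    simp only [fhN, Finset.smul_sum]
    rw [Finset.sum_comm]
    refine Finset.sum_congr rfl fun j _ => Finset.sum_congr rfl fun i _ => ?_
    rw [(hc.pow_right i).mul_pow, smul_smul, ← pow_mul, ← pow_mul, mul_comm i j]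
  rw [h1, Finset.sum_eq_single_of_mem 0 (by simp [hq.out.pos])]
  · simp [fhN]
  · intro j hj hj0
    rw [fhN_fpf, smul_zero]
    · rw [← pow_mul, mul_comm, pow_mul, hz, one_pow]
    · refine fh_fpf_zpow q z _ hz hf (Subgroup.pow_mem _ (Subgroup.mem_zpowers z) _)
        (fh_pow_ne_one q z hz hz1 j ?_)
      intro hd
      have := Nat.le_of_dvd (by omega) hd
      simp at hj
      omega

theorem fhN_cross (x y : G) (hc : Commute x y) (hy : y ^ q = 1)
    (hf : ∀ v : V, y • v = v → v = 0) (u : V) (hu : x • u = u) : fhN q (x * y) u = 0 := by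
  rw [← fhN_fpf q y hy hf u, fhN, fhN]
  refine Finset.sum_congr rfl fun i _ => ?_
  rw [hc.eq, hc.symm.mul_pow, mul_smul, fh_pow_fix x u hu]

theorem fhN_ker_fix [hq : Fact q.Prime] [Finite V] (hV : (Nat.card V).Coprime q)
    (a y g : G) (hay : Commute a y) (hgy : Commute g y) (hy : y ^ q = 1) (hy1 : y ≠ 1)
    (hf : ∀ v : V, y • v = v → v = 0) (hga : g * a * g⁻¹ * a⁻¹ = y) (u : V) (hu : fhN q a u = 0)
    (hgu : g • u = u) : u = 0 := by
  apply fh_coprime q hV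
  rw [← fhN_sum q a y hay hy hy1 hf]
  refine Finset.sum_eq_zero fun i _ => ?_
  have h1 : ∀ i : ℕ, g ^ i * a * (g ^ i)⁻¹ = a * y ^ i := by
    intro i
    induction i with
    | zero => simp
    | succ i ih =>
      have e : g ^ (i + 1) * a * (g ^ (i + 1))⁻¹ = g * (g ^ i * a * (g ^ i)⁻¹) * g⁻¹ := by
        rw [pow_succ']; group
      rw [e, ih]
      have e2 : g * (a * y ^ i) * g⁻¹ = (g * a * g⁻¹ * a⁻¹) * a * (g * y ^ i * g⁻¹) := by group
      rw [e2, hga, (hgy.pow_right i).eq, mul_inv_cancel_right, ← hay.eq, mul_assoc, ← pow_succ']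
  have h2 := fhN_conj q (g ^ i) a u
  rw [h1, fh_pow_fix g u hgu, hu, smul_zero] at h2
  exact h2.symm

theorem fh_decomp [Finite V] (hV : (Nat.card V).Coprime q) (x : G) (hx : x ^ q = 1) (v : V) :
    ∃ u w : V, fhN q x u = 0 ∧ x • w = w ∧ v = u + w := by
  have hinj : Function.Injective (fun v : V => q • v) := by
    intro a b hab
    have : q • (a - b) = 0 := by
      rw [nsmul_sub]; exact sub_eq_zero.2 hab
    exact sub_eq_zero.1 (fh_coprime q hV _ this)
  obtain ⟨w, hw⟩ := (Finite.injective_iff_surjective.1 hinj) (fhN q x v)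
  have hw' : q • w = fhN q x v := hw
  have hxw : x • w = w := by
    apply hinj
    change q • x • w = q • w
    rw [smul_comm, hw', fhN_fix q x hx]
  refine ⟨v - w, w, ?_, hxw, by abel⟩
  rw [sub_eq_add_neg, fhN_add, fhN_neg, fhN_of_fix q x w hxw, hw', add_neg_cancel]

/-- kernel of norm -/
def fhU (x : G) : AddSubgroup V where
  carrier := {v | fhN q x v = 0}
  zero_mem' := fhN_zero q x
  add_mem' := by
    intro a b ha hb
    simp only [Set.mem_ofPred_eq] at *
    rw [fhN_add, ha, hb, add_zero]
  neg_mem' := by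
    intro a ha
    simp only [Set.mem_ofPred_eq] at *
    rw [fhN_neg, ha, neg_zero]

/-- fixed points -/
def fhW (x : G) : AddSubgroup V where
  carrier := {v | x • v = v}
  zero_mem' := smul_zero x
  add_mem' := by
    intro a b ha hb
    simp only [Set.mem_ofPred_eq] at *
    rw [smul_add, ha, hb]
  neg_mem' := by
    intro a ha
    simp only [Set.mem_ofPred_eq] at *
    rw [smul_neg, ha]

end act

/-- induction hypothesis -/
def FhIH.{u, v} (q n : ℕ) : Prop :=
  ∀ (G : Type u) (V : Type v) [Group G] [Finite G] [AddCommGroup V] [Finite V]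
    [DistribMulAction G V] [FaithfulSMul G V], IsPGroup q G → (Nat.card V).Coprime q →
    Nontrivial G → Nat.card V + Nat.card G < n →
    ∃ v : V, q * Nat.card (MulAction.stabilizer G v) ^ 2 ≤ Nat.card G

theorem fh_relAux.{u, v} (q n : ℕ) (IH : FhIH.{u, v} q n)
    {G Q : Type u} {V W' : Type v} [Group G] [Finite G] [AddCommGroup V] [Finite V]
    [DistribMulAction G V] [Group Q] [AddCommGroup W'] [DistribMulAction Q W']
    (hG : IsPGroup q G) (hV : (Nat.card V).Coprime q)
    (W : AddSubgroup V) (hn : Nat.card W + Nat.card G < n)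
    (hK : fixingSubgroup G (W : Set V) ≠ ⊤)
    (π : G →* Q) (hπ : Function.Surjective π) (i : W' ≃ W)
    (hfa : ∀ x y : Q, (∀ w : W', x • w = y • w) → x = y)
    (hc : ∀ g w, (i (π g • w) : V) = g • (i w : V)) :
    ∃ w ∈ W, q * Nat.card (MulAction.stabilizer G w) ^ 2 ≤
        Nat.card G * Nat.card (fixingSubgroup G (W : Set V)) := by
  have hfQ : Finite Q := Finite.of_surjective π hπ
  have hfW : Finite W' := Finite.of_equiv W i.symm
  have hFS : FaithfulSMul Q W' := ⟨fun {x y} h => hfa x y h⟩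
  have hφ : π.ker = fixingSubgroup G (W : Set V) := by
    ext g
    rw [MonoidHom.mem_ker, mem_fixingSubgroup_iff]
    constructor
    · intro h w hw
      have := hc g (i.symm ⟨w, hw⟩)
      rw [h, one_smul, Equiv.apply_symm_apply] at this
      exact this.symm
    · intro h
      apply hfa
      intro w
      apply i.injective
      apply Subtype.ext
      rw [hc, one_smul]
      exact h _ (i w).2
  have hcardq : Nat.card π.ker * Nat.card Q = Nat.card G := by
    rw [← π.ker.card_mul_index, Subgroup.index_ker, MonoidHom.range_eq_top.2 hπ, Subgroup.card_top]
  have hnt : Nontrivial Q := by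
    by_contra hnn
    rw [not_nontrivial_iff_subsingleton] at hnn
    apply hK
    rw [← hφ]
    ext g
    simp only [MonoidHom.mem_ker, Subgroup.mem_top, iff_true]
    exact Subsingleton.elim _ _
  have hcW : Nat.card W' = Nat.card W := Nat.card_congr i
  obtain ⟨w, hw⟩ := IH Q W' (hG.of_surjective π hπ)
    (by rw [hcW]; exact Nat.Coprime.coprime_dvd_left (AddSubgroup.card_addSubgroup_dvd_card W) hV) hnt (by
      have : Nat.card Q ≤ Nat.card G := Nat.card_le_card_of_surjective _ hπ
      omega)
  have hst : Nat.card (MulAction.stabilizer G (i w : V)) =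
      Nat.card π.ker * Nat.card (MulAction.stabilizer Q w) := by
    rw [fh_card_map _ π]
    have e1 : MulAction.stabilizer G (i w : V) ⊓ π.ker = π.ker := by
      rw [inf_eq_right, hφ]
      intro g hg
      exact (mem_fixingSubgroup_iff G).1 hg (i w) (i w).2
    have e2 : (MulAction.stabilizer G (i w : V)).map π = MulAction.stabilizer Q w := by
      ext x
      obtain ⟨g, rfl⟩ := hπ x
      constructor
      · rintro ⟨g', hg, he⟩
        rw [← he]
        apply i.injective
        apply Subtype.ext
        change (i (π g' • w) : V) = _
        rw [hc]
        exact hg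
      · intro hx
        have hx' : π g • w = w := hx
        refine ⟨g, ?_, rfl⟩
        change g • (i w : V) = i w
        rw [← hc, hx']
    rw [e1, e2]
  refine ⟨i w, (i w).2, ?_⟩
  rw [hst, ← hφ, ← hcardq]
  calc _ = (q * Nat.card (MulAction.stabilizer Q w) ^ 2) * (Nat.card π.ker * Nat.card π.ker) := by ring
    _ ≤ Nat.card Q * (Nat.card π.ker * Nat.card π.ker) := by gcongr
    _ = _ := by ring

theorem fh_quotExists.{u, v} {G : Type u} {W : Type v} [Group G] [AddCommGroup W]
    [DistribMulAction G W] : ∃ (Q : Type u) (_ : Group Q) (_ : DistribMulAction Q W) (π : G →* Q),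
      Function.Surjective π ∧ (∀ x y : Q, (∀ w : W, x • w = y • w) → x = y) ∧
      ∀ (g : G) (w : W), π g • w = g • w := by
  obtain ⟨φ, hφ⟩ : ∃ φ : G →* AddMonoid.End W, ∀ g w, φ g w = g • w :=
    ⟨DistribMulAction.toAddMonoidEnd G W, fun g w => rfl⟩
  obtain ⟨Q, iQ, π, ψ, hπ, hψ, hc⟩ : ∃ (Q : Type u) (_ : Group Q) (π : G →* Q)
      (ψ : Q →* AddMonoid.End W), Function.Surjective π ∧ Function.Injective ψ ∧
      ∀ g, ψ (π g) = φ g := by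
    refine ⟨G ⧸ φ.toHomUnits.ker, inferInstance, QuotientGroup.mk' φ.toHomUnits.ker,
      (Units.coeHom _).comp (QuotientGroup.kerLift φ.toHomUnits),
      QuotientGroup.mk'_surjective _, ?_, ?_⟩
    · exact Units.val_injective.comp (QuotientGroup.kerLift_injective φ.toHomUnits)
    · intro g
      rfl
  let act : DistribMulAction Q W :=
    { smul := fun x w => ψ x w
      one_smul := fun w => by change ψ 1 w = w; rw [map_one]; rfl
      mul_smul := fun x y w => by change ψ (x * y) w = ψ x (ψ y w); rw [map_mul]; rfl
      smul_zero := fun x => map_zero (ψ x)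
      smul_add := fun x v w => map_add (ψ x) v w }
  refine ⟨Q, iQ, act, π, hπ, ?_, ?_⟩
  · intro x y h
    apply hψ
    ext w
    exact h w
  · intro g w
    change ψ (π g) w = g • w
    rw [hc, hφ]

/-- restricted action -/
@[reducible] def fhAct {G V : Type*} [Group G] [AddCommGroup V]
    [DistribMulAction G V] (W : AddSubgroup V) (hW : ∀ g : G, ∀ w ∈ W, g • w ∈ W) :
    DistribMulAction G W :=
    { smul := fun g w => ⟨g • w.1, hW g w.1 w.2⟩
      one_smul := fun w => Subtype.ext (one_smul G w.1)
      mul_smul := fun g h w => Subtype.ext (mul_smul g h w.1)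
      smul_zero := fun g => Subtype.ext (smul_zero g)
      smul_add := fun g v w => Subtype.ext (smul_add g v.1 w.1) }

theorem fh_relIH.{u, v} (q n : ℕ) (IH : FhIH.{u, v} q n)
    {G : Type u} {V : Type v} [Group G] [Finite G] [AddCommGroup V] [Finite V]
    [DistribMulAction G V] (hG : IsPGroup q G) (hV : (Nat.card V).Coprime q)
    (W : AddSubgroup V) (hW : ∀ g : G, ∀ w ∈ W, g • w ∈ W) (hn : Nat.card W + Nat.card G < n)
    (hK : fixingSubgroup G (W : Set V) ≠ ⊤) :
    ∃ w ∈ W, q * Nat.card (MulAction.stabilizer G w) ^ 2 ≤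
        Nat.card G * Nat.card (fixingSubgroup G (W : Set V)) := by
  obtain ⟨Q, iQ, iA, π, hπ, hfa, hc⟩ := @fh_quotExists G W _ _ (fhAct W hW)
  refine fh_relAux q n IH hG hV W hn hK π hπ (Equiv.refl W) hfa ?_
  intro g w
  exact congrArg Subtype.val (hc g w)

theorem fh_two.{u, v} (q n : ℕ) (IH : FhIH.{u, v} q n)
    {G : Type u} {V : Type v} [Group G] [Finite G] [AddCommGroup V] [Finite V]
    [DistribMulAction G V] [FaithfulSMul G V] (hG : IsPGroup q G) (hV : (Nat.card V).Coprime q)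
    (U W : AddSubgroup V) (hU : ∀ g : G, ∀ w ∈ U, g • w ∈ U) (hW : ∀ g : G, ∀ w ∈ W, g • w ∈ W)
    (hUW : ∀ x ∈ U, x ∈ W → x = 0) (hsp : ∀ v : V, ∃ u ∈ U, ∃ w ∈ W, v = u + w)
    (hnt : fixingSubgroup G (U : Set V) ≠ ⊤)
    (hn : Nat.card U + Nat.card G < n) (hn' : Nat.card W + Nat.card G < n) :
    (∃ u ∈ U, q * Nat.card (MulAction.stabilizer G u) ^ 2 ≤ Nat.card G) ∨
    (∃ v : V, q * (q * Nat.card (MulAction.stabilizer G v) ^ 2) ≤ Nat.card G) := by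
  obtain ⟨u, hu, h1⟩ := fh_relIH q n IH hG hV U hU hn hnt
  set K := fixingSubgroup G (U : Set V) with hKdef
  by_cases hK : K = ⊥
  · left
    refine ⟨u, hu, ?_⟩
    rw [hK] at h1
    simpa using h1
  right
  have hKW : fixingSubgroup K (W : Set V) = ⊥ := by
    rw [eq_bot_iff]
    intro k hk
    rw [Subgroup.mem_bot]
    apply Subtype.ext
    apply FaithfulSMul.eq_of_smul_eq_smul (α := V)
    intro v
    obtain ⟨u, hu, w, hw, rfl⟩ := hsp v
    have e1 : (k : G) • u = u := (mem_fixingSubgroup_iff G).1 k.2 u hu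
    have e2 : (k : G) • w = w := (mem_fixingSubgroup_iff K).1 hk w hw
    rw [smul_add, e1, e2, Subgroup.coe_one, one_smul]
  have hle : Nat.card K ≤ Nat.card G := Subgroup.card_le_card_group K
  have hnt2 : fixingSubgroup K (W : Set V) ≠ ⊤ := by
    rw [hKW]
    intro h
    have : Nontrivial K := (Subgroup.nontrivial_iff_ne_bot _).2 hK
    exact bot_ne_top h
  obtain ⟨w, hw, h2⟩ := fh_relIH q n IH (G := K) (hG.to_subgroup K) hV W
    (fun g w hw => hW g w hw) (by omega) hnt2
  rw [hKW, Subgroup.card_bot, mul_one] at h2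
  refine ⟨u + w, ?_⟩
  set S := MulAction.stabilizer G (u + w)
  have hSu : S ≤ MulAction.stabilizer G u := by
    intro g hg
    have hg' : g • (u + w) = u + w := hg
    rw [smul_add] at hg'
    have e : g • u - u = w - g • w := by
      rw [sub_eq_sub_iff_add_eq_add, hg', add_comm]
    have := hUW (g • u - u) (U.sub_mem (hU g u hu) hu) (e ▸ W.sub_mem hw (hW g w hw))
    exact sub_eq_zero.1 this
  have hKu : K ≤ MulAction.stabilizer G u := fun g hg => (mem_fixingSubgroup_iff G).1 hg u hu
  have h3 := fh_card_mul_le S K _ hSu hKu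
  have h4 : Nat.card (S ⊓ K : Subgroup G) ≤ Nat.card (MulAction.stabilizer K w) := by
    refine Nat.card_le_card_of_injective (fun x => ⟨⟨x.1, x.2.2⟩, ?_⟩) ?_
    · have hx : x.1 • (u + w) = u + w := x.2.1
      have hx2 : x.1 • u = u := hKu x.2.2
      rw [smul_add, hx2] at hx
      exact add_left_cancel hx
    · intro x y hxy
      have h3 := congrArg (fun t : MulAction.stabilizer K w => ((t : K) : G)) hxy
      exact Subtype.ext h3
  have hKp : 0 < Nat.card K := Nat.card_pos
  have h5 : Nat.card S * Nat.card K ≤ Nat.card (MulAction.stabilizer K w) * Nat.card (MulAction.stabilizer G u) :=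
    h3.trans (by gcongr)
  have h6 := Nat.pow_le_pow_left h5 2
  refine Nat.le_of_mul_le_mul_right ?_ (Nat.mul_pos hKp hKp)
  calc q * (q * Nat.card S ^ 2) * (Nat.card K * Nat.card K)
      = q * q * (Nat.card S * Nat.card K) ^ 2 := by ring
    _ ≤ q * q * (Nat.card (MulAction.stabilizer K w) * Nat.card (MulAction.stabilizer G u)) ^ 2 := by gcongr
    _ = (q * Nat.card (MulAction.stabilizer K w) ^ 2) * (q * Nat.card (MulAction.stabilizer G u) ^ 2) := by ring
    _ ≤ Nat.card K * (Nat.card G * Nat.card K) := by gcongr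
    _ = _ := by ring

theorem fh_pow_lt {G : Type*} [Group G] [Finite G] (q : ℕ) [hq : Fact q.Prime] (hG : IsPGroup q G)
    (C : Subgroup G) (h : Nat.card C ^ 2 < Nat.card G) : q * Nat.card C ^ 2 ≤ Nat.card G := by
  obtain ⟨n, hn⟩ := IsPGroup.iff_card.1 hG
  obtain ⟨k, hk⟩ := IsPGroup.iff_card.1 (hG.to_subgroup C)
  rw [hn, hk, ← pow_mul] at h
  rw [hn, hk, ← pow_mul]
  have := (Nat.pow_lt_pow_iff_right hq.out.one_lt).1 h
  rw [← pow_succ']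
  exact Nat.pow_le_pow_right hq.out.pos this

theorem fh_cardM {G : Type*} [Group G] [Finite G] (q : ℕ) [hq : Fact q.Prime]
    (z : G) (hz : z ∈ Subgroup.center G) (hz1 : z ≠ 1) (hzq : z ^ q = 1) (a : G)
    (ha : ∀ g : G, g * a * g⁻¹ * a⁻¹ ∈ Subgroup.zpowers z) :
    Nat.card G ≤ q * Nat.card (Subgroup.centralizer ({a} : Set G)) := by
  have hzc : Subgroup.zpowers z ≤ Subgroup.center G := by rwa [Subgroup.zpowers_le]
  let θ : G →* Subgroup.zpowers z := MonoidHom.mk' (fun g => ⟨g * a * g⁻¹ * a⁻¹, ha g⟩) (by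
    intro g h
    apply Subtype.ext
    change g * h * a * (g * h)⁻¹ * a⁻¹ = (g * a * g⁻¹ * a⁻¹) * (h * a * h⁻¹ * a⁻¹)
    have h1 := Subgroup.mem_center_iff.1 (hzc (ha h)) (g * a * g⁻¹ * a⁻¹)
    have h2 := Subgroup.mem_center_iff.1 (hzc (ha h)) g
    rw [h1]
    calc g * h * a * (g * h)⁻¹ * a⁻¹ = (g * (h * a * h⁻¹ * a⁻¹)) * (a * g⁻¹ * a⁻¹) := by group
      _ = _ := by rw [h2]; group)
  have hker : θ.ker = Subgroup.centralizer ({a} : Set G) := by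
    ext g
    rw [MonoidHom.mem_ker, Subgroup.mem_centralizer_singleton_iff]
    constructor
    · intro h
      have h' : g * a * g⁻¹ * a⁻¹ = 1 := congrArg Subtype.val h
      rw [mul_inv_eq_one, mul_inv_eq_iff_eq_mul] at h'
      exact h'
    · intro h
      apply Subtype.ext
      change g * a * g⁻¹ * a⁻¹ = 1
      rw [mul_inv_eq_one, mul_inv_eq_iff_eq_mul]
      exact h
  rw [← hker, ← θ.ker.card_mul_index, Subgroup.index_ker, mul_comm]
  have : Nat.card θ.range ≤ q := by
    refine (Subgroup.card_le_card_group _).trans ?_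
    rw [Nat.card_zpowers, orderOf_eq_prime hzq hz1]
  gcongr

section act2
variable {G V : Type*} [Group G] [Finite G] [AddCommGroup V] [Finite V] [DistribMulAction G V]
  (q : ℕ) [hq : Fact q.Prime]

theorem fh_noncentral [Nontrivial V] (hV : (Nat.card V).Coprime q)
    (hcf : ∀ x ∈ Subgroup.center G, x ≠ 1 → x ^ q = 1 → ∀ v : V, x • v = v → v = 0)
    (z : G) (hz : z ∈ Subgroup.center G) (hz1 : z ≠ 1) (hzq : z ^ q = 1) (a : G)
    (haq : a ^ q = 1) (haz : a ∉ Subgroup.zpowers z) :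
    Subgroup.centralizer ({a} : Set G) ≠ ⊤ := by
  intro h
  have hac : a ∈ Subgroup.center G := by
    rw [Subgroup.mem_center_iff]
    intro g
    have : g ∈ Subgroup.centralizer ({a} : Set G) := h ▸ Subgroup.mem_top g
    have := Subgroup.mem_centralizer_singleton_iff.1 this
    exact this
  obtain ⟨v, hv⟩ := exists_ne (0 : V)
  apply hv
  apply fh_coprime q hV
  have hcom : Commute a z := (Subgroup.mem_center_iff.1 hz a)
  rw [← fhN_sum q a z hcom hzq hz1 (hcf z hz hz1 hzq)]
  refine Finset.sum_eq_zero fun i _ => ?_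
  have hq1 : (a * z ^ i) ^ q = 1 := by
    rw [(hcom.pow_right i).mul_pow, haq, ← pow_mul, mul_comm, pow_mul, hzq, one_pow, one_mul]
  apply fhN_fpf q _ hq1
  apply hcf _ (Subgroup.mul_mem _ hac (Subgroup.pow_mem _ hz i)) _ hq1
  intro h1
  apply haz
  rw [eq_inv_of_mul_eq_one_left h1]
  exact Subgroup.inv_mem _ (Subgroup.pow_mem _ (Subgroup.mem_zpowers z) i)

theorem fh_stab_le (hV : (Nat.card V).Coprime q)
    (z : G) (hz : z ∈ Subgroup.center G) (hzq : z ^ q = 1)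
    (hf : ∀ v : V, z • v = v → v = 0) (a : G)
    (ha : ∀ g : G, g * a * g⁻¹ * a⁻¹ ∈ Subgroup.zpowers z) (i : ℕ) (u : V) (hu0 : u ≠ 0)
    (hu : fhN q (a * z ^ i) u = 0) :
    MulAction.stabilizer G u ≤ Subgroup.centralizer ({a} : Set G) := by
  have hzc : Subgroup.zpowers z ≤ Subgroup.center G := by rwa [Subgroup.zpowers_le]
  intro g hg
  by_contra hgM
  apply hu0
  have hy1 : g * a * g⁻¹ * a⁻¹ ≠ 1 := by
    intro h'
    apply hgM
    rw [Subgroup.mem_centralizer_singleton_iff]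
    rw [mul_inv_eq_one, mul_inv_eq_iff_eq_mul] at h'
    exact h'
  have hyc := Subgroup.mem_center_iff.1 (hzc (ha g))
  have hyq : (g * a * g⁻¹ * a⁻¹) ^ q = 1 := by
    obtain ⟨k, hk⟩ := Subgroup.mem_zpowers_iff.1 (ha g)
    rw [← hk, ← zpow_natCast, ← zpow_mul, mul_comm, zpow_mul, zpow_natCast, hzq, one_zpow]
  refine fhN_ker_fix q hV (a * z ^ i) (g * a * g⁻¹ * a⁻¹) g (hyc _) (hyc _) hyq hy1
    (fh_fpf_zpow q z _ hzq hf (ha g) hy1) ?_ u hu hg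
  have hzi := Subgroup.mem_center_iff.1 (Subgroup.pow_mem _ hz i) g⁻¹
  calc g * (a * z ^ i) * g⁻¹ * (a * z ^ i)⁻¹ = g * a * (z ^ i * g⁻¹) * (z ^ i)⁻¹ * a⁻¹ := by group
    _ = _ := by rw [← hzi]; group

theorem fh_cross (z : G) (hz : z ∈ Subgroup.center G) (hz1 : z ≠ 1) (hzq : z ^ q = 1)
    (hf : ∀ v : V, z • v = v → v = 0) (a : G) (i j : ℕ) (hi : i < q) (hj : j < q) (hij : i ≠ j)
    (u : V) (hu : (a * z ^ i) • u = u) : fhN q (a * z ^ j) u = 0 := by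
  have e : a * z ^ j = (a * z ^ i) * z ^ (j + q - i) := by
    rw [mul_assoc, ← pow_add, show i + (j + q - i) = j + q by omega, pow_add, hzq, mul_one]
  rw [e]
  have hd : ¬ q ∣ (j + q - i) := by
    rintro ⟨c, hc⟩
    rcases Nat.lt_or_ge c 1 with h | h
    · have : c = 0 := by omega
      subst this; omega
    rcases Nat.lt_or_ge c 2 with h' | h'
    · have : c = 1 := by omega
      subst this; omega
    · have := Nat.mul_le_mul_left q h'
      omega
  apply fhN_cross q _ _ (Subgroup.mem_center_iff.1 (Subgroup.pow_mem _ hz _) _) _ _ u hu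
  · rw [← pow_mul, mul_comm, pow_mul, hzq, one_pow]
  · exact fh_fpf_zpow q z _ hzq hf (Subgroup.pow_mem _ (Subgroup.mem_zpowers z) _)
      (fh_pow_ne_one q z hzq hz1 _ hd)

theorem fh_stab_sub (M : Subgroup G) (v : V) :
    Nat.card (MulAction.stabilizer M v) = Nat.card (MulAction.stabilizer G v ⊓ M : Subgroup G) := by
  refine Nat.card_congr ⟨fun x => ⟨x.1.1, x.2, x.1.2⟩, fun x => ⟨⟨x.1, x.2.2⟩, x.2.1⟩, ?_, ?_⟩
  · intro x; rfl
  · intro x; rfl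

theorem fh_exists_central [Nontrivial G] (hG : IsPGroup q G) :
    ∃ z ∈ Subgroup.center G, z ≠ 1 ∧ z ^ q = 1 := by
  have := hG.center_nontrivial
  have hdvd : q ∣ Nat.card (Subgroup.center G) := by
    obtain ⟨n, hn, h⟩ := (hG.to_subgroup (Subgroup.center G)).nontrivial_iff_card.1 this
    rw [h]; exact dvd_pow_self q (by omega)
  obtain ⟨y, hy⟩ := exists_prime_orderOf_dvd_card' q hdvd
  refine ⟨y, y.2, ?_, ?_⟩
  · intro h
    have : y = 1 := Subtype.ext h
    rw [this, orderOf_one] at hy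
    exact hq.out.one_lt.ne hy
  · have := pow_orderOf_eq_one y
    rw [hy] at this
    exact congrArg Subtype.val this

end act2

theorem fh_step.{u, v} (q n : ℕ) [hq : Fact q.Prime] (IH : FhIH.{u, v} q n) :
    FhIH.{u, v} q (n + 1) := by
  intro G V _ _ _ _ _ _ hG hV hGn hn
  have hVn : Nontrivial V := by
    by_contra h
    rw [not_nontrivial_iff_subsingleton] at h
    obtain ⟨g, hg⟩ := exists_ne (1 : G)
    exact hg (FaithfulSMul.eq_of_smul_eq_smul (α := V) fun v => Subsingleton.elim _ _)
  have htriv : ∀ x : G, (∀ v : V, x • v = v) → x = 1 := fun x h =>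
    FaithfulSMul.eq_of_smul_eq_smul (α := V) fun v => by rw [h, one_smul]
  have hUW : ∀ (x : G) (v : V), v ∈ fhU q x → v ∈ fhW x → v = 0 := by
    intro x v hu hw
    apply fh_coprime q hV
    rw [← fhN_of_fix q x v hw]
    exact hu
  have hsp : ∀ (x : G), x ^ q = 1 → ∀ v : V, ∃ u ∈ fhU q x, ∃ w ∈ (fhW x : AddSubgroup V), v = u + w := by
    intro x hx v
    obtain ⟨u, w, hu, hw, e⟩ := fh_decomp q hV x hx v
    exact ⟨u, hu, w, hw, e⟩
  have hcardlt : ∀ S : AddSubgroup V, S ≠ ⊤ → Nat.card S < Nat.card V := by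
    intro S hS
    by_contra hc
    exact hS (AddSubgroup.eq_top_of_le_card S (by omega))
  by_cases hcf : ∀ x ∈ Subgroup.center G, x ≠ 1 → x ^ q = 1 → ∀ v : V, x • v = v → v = 0
  · obtain ⟨z, hz, hz1, hzq⟩ := fh_exists_central q hG
    have hf := hcf z hz hz1 hzq
    rcases fh_dich q hG z hz hz1 hzq with ⟨a, haq, haz, ha⟩ | hii
    · have hM := fh_noncentral q hV hcf z hz hz1 hzq a haq haz
      have hMc := fh_cardM q z hz hz1 hzq a ha
      set M := Subgroup.centralizer ({a} : Set G) with hMdef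
      have hMlt : Nat.card M < Nat.card G := by
        by_contra hc
        exact hM (Subgroup.eq_top_of_le_card M (by omega))
      have hma : ∀ m ∈ M, m * a = a * m := by
        intro m hm
        have := Subgroup.mem_centralizer_singleton_iff.1 hm
        exact this
      have hUle : ∀ S : AddSubgroup V, Nat.card S + Nat.card M < n := by
        intro S
        have : Nat.card S ≤ Nat.card V := Nat.card_le_card_of_injective _ S.subtype_injective
        omega
      have hzM : z ∈ M := by
        rw [hMdef, Subgroup.mem_centralizer_singleton_iff]
        have := Subgroup.mem_center_iff.1 hz a
        exact this.symm
      have two := fh_two q n IH (G := M) (hG.to_subgroup M) hV (fhU q a) (fhW a)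
        (by
          intro m u hu
          change fhN q a ((m : G) • u) = 0
          have hu' : fhN q a u = 0 := hu
          have := fhN_conj q (m : G) a u
          rw [hma m m.2, mul_inv_cancel_right, hu', smul_zero] at this
          exact this.symm)
        (by
          intro m w hw
          change a • (m : G) • w = (m : G) • w
          have hw' : a • w = w := hw
          rw [smul_smul, ← hma m m.2, mul_smul, hw'])
        (hUW a) (hsp a haq)
        (by
          intro htop
          apply haz
          have : a = 1 := by
            apply htriv
            intro v
            obtain ⟨u, hu, w, hw, rfl⟩ := hsp a haq v
            have hu0 : u = 0 := by
              apply hf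
              have : (⟨z, hzM⟩ : M) ∈ fixingSubgroup M ((fhU q a : AddSubgroup V) : Set V) :=
                htop ▸ Subgroup.mem_top _
              exact (mem_fixingSubgroup_iff M).1 this u hu
            rw [hu0, zero_add]
            exact hw
          rw [this]
          exact Subgroup.one_mem _)
        (hUle _) (hUle _)
      rcases two with ⟨u, hu, h1⟩ | ⟨v, h1⟩
      · refine ⟨u, ?_⟩
        have hMp : 0 < Nat.card M := Nat.card_pos
        have hu0 : u ≠ 0 := by
          rintro rfl
          have : MulAction.stabilizer M (0 : V) = ⊤ := by
            ext g; simp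
          rw [this, Subgroup.card_top] at h1
          have := hq.out.two_le
          nlinarith
        have hle := fh_stab_le q hV z hz hzq hf a ha 0 u hu0 (by rw [pow_zero, mul_one]; exact hu)
        rw [fh_stab_sub, inf_eq_left.2 hle] at h1
        omega
      · refine ⟨v, fh_pow_lt q hG _ ?_⟩
        rw [fh_stab_sub] at h1
        have h2 := fh_card_mul_le (MulAction.stabilizer G v) M ⊤ le_top le_top
        rw [Subgroup.card_top] at h2
        set c := Nat.card (MulAction.stabilizer G v)
        set d := Nat.card (MulAction.stabilizer G v ⊓ M : Subgroup G)
        have hMp : 0 < Nat.card M := Nat.card_pos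
        have h3 : c ≤ d * q := by
          refine Nat.le_of_mul_le_mul_right ?_ hMp
          calc c * Nat.card M ≤ d * Nat.card G := h2
            _ ≤ d * (q * Nat.card M) := by gcongr
            _ = _ := by ring
        calc c ^ 2 ≤ (d * q) ^ 2 := by gcongr
          _ = q * (q * d ^ 2) := by ring
          _ ≤ Nat.card M := h1
          _ < _ := hMlt
    · obtain ⟨v, hv⟩ := exists_ne (0 : V)
      exact ⟨v, fh_pow_lt q hG _ (hii _ fun h => hv (hf v h))⟩
  · push Not at hcf
    obtain ⟨x, hx, hx1, hxq, v, hv, hv0⟩ := hcf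
    have hxc := Subgroup.mem_center_iff.1 hx
    have hWtop : (fhW x : AddSubgroup V) ≠ ⊤ := by
      intro h
      apply hx1
      apply htriv
      intro w
      have : w ∈ (fhW x : AddSubgroup V) := h ▸ AddSubgroup.mem_top w
      exact this
    have hUtop : (fhU q x : AddSubgroup V) ≠ ⊤ := by
      intro h
      apply hv0
      exact hUW x v (h ▸ AddSubgroup.mem_top v) hv
    have hU := hcardlt _ hUtop
    have hW := hcardlt _ hWtop
    have two := fh_two q n IH hG hV (fhU q x) (fhW x)
        (by
          intro m u hu
          change fhN q x (m • u) = 0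
          have hu' : fhN q x u = 0 := hu
          have := fhN_conj q m x u
          rw [hxc m, mul_inv_cancel_right, hu', smul_zero] at this
          exact this.symm)
        (by
          intro m w hw
          change x • m • w = m • w
          have hw' : x • w = w := hw
          rw [smul_smul, ← hxc m, mul_smul, hw'])
        (hUW x) (hsp x hxq)
        (by
          intro htop
          apply hx1
          apply htriv
          intro v
          obtain ⟨u, hu, w, hw, rfl⟩ := hsp x hxq v
          have hu0 : x • u = u := by
            have : x ∈ fixingSubgroup G ((fhU q x : AddSubgroup V) : Set V) :=
              htop ▸ Subgroup.mem_top _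
            exact (mem_fixingSubgroup_iff G).1 this u hu
          rw [smul_add, hu0]
          congr 1)
        (by omega) (by omega)
    rcases two with ⟨u, hu, h1⟩ | ⟨v, h1⟩
    · exact ⟨u, h1⟩
    · exact ⟨v, le_trans (Nat.le_mul_of_pos_left _ hq.out.pos) h1⟩

theorem fh_all.{u, v} (q : ℕ) [hq : Fact q.Prime] (n : ℕ) : FhIH.{u, v} q n := by
  induction n with
  | zero =>
    intro G V _ _ _ _ _ _ hG hV hGn hn
    omega
  | succ n ih => exact fh_step q n ih

theorem fh_final {G V : Type*} [Group G] [Finite G] [AddCommGroup V] [Finite V]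
    [DistribMulAction G V] [FaithfulSMul G V] (q : ℕ) [hq : Fact q.Prime] (hG : IsPGroup q G)
    (hV : (Nat.card V).Coprime q)
    (hcf : ∀ x ∈ Subgroup.center G, x ≠ 1 → x ^ q = 1 → ∀ v : V, x • v = v → v = 0)
    (hb : ∀ v : V, (∃ g : G, g ≠ 1 ∧ g • v = v) → Nat.card G ≤ Nat.card (MulAction.stabilizer G v) ^ 2)
    (v₀ : V) (hv₀ : v₀ ≠ 0) (g₀ : G) (hg₀ : g₀ ≠ 1) (hgv : g₀ • v₀ = v₀) : False := by
  have hVn : Nontrivial V := ⟨v₀, 0, hv₀⟩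
  have hGn : Nontrivial G := ⟨g₀, 1, hg₀⟩
  obtain ⟨z, hz, hz1, hzq⟩ := fh_exists_central q hG
  have hf : ∀ v : V, z • v = v → v = 0 := hcf z hz hz1 hzq
  rcases fh_dich q hG z hz hz1 hzq with ⟨a, haq, haz, ha⟩ | hii
  swap
  · have h1 := hii (MulAction.stabilizer G v₀) (fun h => hv₀ (hf v₀ h))
    have h2 := hb v₀ ⟨g₀, hg₀, hgv⟩
    omega
  have hM := fh_noncentral q hV hcf z hz hz1 hzq a haq haz
  set M := Subgroup.centralizer ({a} : Set G) with hMdef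
  have hMlt : Nat.card M < Nat.card G := by
    by_contra hc
    exact hM (Subgroup.eq_top_of_le_card M (by omega))
  have hcom : Commute a z := Subgroup.mem_center_iff.1 hz a
  have hq1 : ∀ i : ℕ, (a * z ^ i) ^ q = 1 := fun i => by
    rw [(hcom.pow_right i).mul_pow, haq, ← pow_mul, mul_comm, pow_mul, hzq, one_pow, one_mul]
  have hne1 : ∀ i : ℕ, a * z ^ i ≠ 1 := by
    intro i h1
    apply haz
    rw [eq_inv_of_mul_eq_one_left h1]
    exact Subgroup.inv_mem _ (Subgroup.pow_mem _ (Subgroup.mem_zpowers z) i)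
  have key : ∀ v : V, ∀ k ≤ q, ∃ g : G, g ≠ 1 ∧
      g • (∑ i ∈ Finset.range k, fhN q (a * z ^ i) v) = ∑ i ∈ Finset.range k, fhN q (a * z ^ i) v := by
    intro v k
    induction k with
    | zero => exact fun _ => ⟨g₀, hg₀, by simp⟩
    | succ k ih =>
      intro hk
      have hs := ih (by omega)
      rw [Finset.sum_range_succ]
      have ht : (a * z ^ k) • fhN q (a * z ^ k) v = fhN q (a * z ^ k) v := fhN_fix q _ (hq1 k) v
      have hsk : fhN q (a * z ^ k) (∑ i ∈ Finset.range k, fhN q (a * z ^ i) v) = 0 := by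
        have hmem : (∑ i ∈ Finset.range k, fhN q (a * z ^ i) v) ∈ (fhU q (a * z ^ k) : AddSubgroup V) := by
          refine AddSubgroup.sum_mem _ fun i hi => ?_
          rw [Finset.mem_range] at hi
          exact fh_cross q z hz hz1 hzq hf a i k (by omega) (by omega) (by omega) _
            (fhN_fix q _ (hq1 i) v)
        exact hmem
      generalize (∑ i ∈ Finset.range k, fhN q (a * z ^ i) v) = s at hs hsk
      generalize fhN q (a * z ^ k) v = t at ht
      by_cases hs0 : s = 0
      · exact ⟨_, hne1 k, by rw [hs0, zero_add, ht]⟩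
      by_cases ht0 : t = 0
      · rw [ht0, add_zero]; exact hs
      have hsM := fh_stab_le q hV z hz hzq hf a ha k s hs0 hsk
      have htM : MulAction.stabilizer G t ≤ M := by
        have h2 := hq.out.two_le
        refine fh_stab_le q hV z hz hzq hf a ha (if k = 0 then 1 else 0) t ht0
          (fh_cross q z hz hz1 hzq hf a k _ (by omega) ?_ ?_ t ht)
        · split_ifs <;> omega
        · split_ifs <;> omega
      have c1 := hb s hs
      have c2 := hb t ⟨_, hne1 k, ht⟩
      have c3 := fh_card_mul_le _ _ _ hsM htM
      have hnb : MulAction.stabilizer G s ⊓ MulAction.stabilizer G t ≠ ⊥ := by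
        intro h
        rw [h, Subgroup.card_bot, one_mul] at c3
        have c4 := Nat.mul_le_mul c1 c2
        rw [← mul_pow, ← sq] at c4
        have c5 := lt_of_le_of_lt c3 hMlt
        have c6 := Nat.pow_lt_pow_left c5 (two_ne_zero)
        exact absurd c4 (not_le.2 c6)
      obtain ⟨g', hg'⟩ := Subgroup.ne_bot_iff_exists_ne_one.1 hnb
      obtain ⟨g, hg, hg1⟩ : ∃ g : G, g ∈ MulAction.stabilizer G s ⊓ MulAction.stabilizer G t ∧ g ≠ 1 :=
        ⟨g'.1, g'.2, fun h => hg' (Subtype.ext h)⟩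
      have e1 : g • s = s := hg.1
      have e2 : g • t = t := hg.2
      exact ⟨g, hg1, by rw [smul_add, e1, e2]⟩
  obtain ⟨v, hv⟩ := fh_all q _ G V hG hV hGn (Nat.lt_succ_self _)
  obtain ⟨g, hg1, hg⟩ := key v q le_rfl
  rw [fhN_sum q a z hcom hzq hz1 hf] at hg
  have hgv' : g • v = v := by
    apply sub_eq_zero.1
    apply fh_coprime q hV
    rw [nsmul_sub, ← hg, smul_comm, sub_self]
  have h1 := hb v ⟨g, hg1, hgv'⟩
  have h2 := hq.out.two_le
  have h3 : 0 < Nat.card (MulAction.stabilizer G v) := Nat.card_pos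
  nlinarith

theorem fh_main {H V : Type*} [Group H] [Finite H] [Group.IsNilpotent H] [AddCommGroup V] [Finite V]
    [DistribMulAction H V] [FaithfulSMul H V] (p k : ℕ) (hp : p.Prime) (hVc : Nat.card V = p ^ k)
    (hnorm : ∀ N : Subgroup H, N.Normal → N ≠ ⊥ → ∀ v : V, (∀ n ∈ N, n • v = v) → v = 0)
    (hcent : ∀ v : V, (∃ h : H, h ≠ 1 ∧ h • v = v) →
      Nat.card H ∣ Nat.card (MulAction.stabilizer H v) ^ 2)
    (v₀ : V) (hv₀ : v₀ ≠ 0) (h₀ : H) (hh₀ : h₀ ≠ 1) (hhv : h₀ • v₀ = v₀) : False := by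
  have hHn : Nontrivial H := ⟨h₀, 1, hh₀⟩
  have hsn : ∀ (r : ℕ) (_ : Fact r.Prime) (P : Sylow r H), (P : Subgroup H).Normal :=
    fun r hr P => Group.isNilpotent_of_finite_tfae.out 0 3 rfl rfl |>.mp ‹_› r hr P
  set q := (Nat.card H).minFac with hqdef
  have hqp : q.Prime := Nat.minFac_prime (Finite.one_lt_card).ne'
  have hq : Fact q.Prime := ⟨hqp⟩
  have hqH : q ∣ Nat.card H := Nat.minFac_dvd _
  clear_value q
  obtain ⟨Q⟩ : Nonempty (Sylow q H) := inferInstance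
  have hQn : (Q : Subgroup H).Normal := hsn q hq Q
  have hqQ : q ∣ Nat.card Q := Q.dvd_card_of_dvd_card hqH
  have hQb : (Q : Subgroup H) ≠ ⊥ := by
    intro h
    rw [h, Subgroup.card_bot] at hqQ
    exact hqp.one_lt.ne' (Nat.dvd_one.1 hqQ)
  have hVn : Nontrivial V := ⟨v₀, 0, hv₀⟩
  have hne : p ≠ q := by
    intro hpq
    have hk : k ≠ 0 := by
      rintro rfl
      have := Finite.one_lt_card (α := V)
      rw [hVc] at this
      simp at this
    have hdv : q ∣ Nat.card V := by
      rw [hVc, hpq]; exact dvd_pow_self q hk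
    obtain ⟨b, hb, hb0⟩ := Q.isPGroup'.exists_fixed_point_of_prime_dvd_card_of_fixed_point V hdv
      (a := (0 : V)) (fun g => smul_zero g)
    exact hb0 (hnorm Q hQn hQb b (fun n hn => hb ⟨n, hn⟩)).symm
  have hV : (Nat.card V).Coprime q := by
    rw [hVc]
    exact Nat.Coprime.pow_left k ((Nat.coprime_primes hp hqp).2 hne)
  have hdiv : ∀ v : V, (∃ h : H, h ≠ 1 ∧ h • v = v) →
      Nat.card Q ∣ Nat.card (MulAction.stabilizer H v ⊓ Q : Subgroup H) ^ 2 := by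
    intro v hv
    have h1 := hcent v hv
    set S := MulAction.stabilizer H v
    have h2 : Nat.card (S ⊓ Q : Subgroup H) * (S ⊓ Q : Subgroup H).relIndex S = Nat.card S :=
      fh_card_rel inf_le_left
    have h3 : (S ⊓ Q : Subgroup H).relIndex S ∣ (Q : Subgroup H).index := by
      rw [Subgroup.inf_relIndex_left]
      exact Subgroup.relIndex_dvd_index_of_normal _ _
    have h4 : (Nat.card Q).Coprime ((S ⊓ Q : Subgroup H).relIndex S ^ 2) := by
      apply Nat.Coprime.pow_right
      exact Nat.Coprime.coprime_dvd_right h3 Q.card_coprime_index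
    apply h4.dvd_of_dvd_mul_right
    rw [← mul_pow, h2]
    exact (Subgroup.card_subgroup_dvd_card (Q : Subgroup H)).trans h1
  have hnb : MulAction.stabilizer H v₀ ⊓ Q ≠ ⊥ := by
    intro h
    have := hdiv v₀ ⟨h₀, hh₀, hhv⟩
    rw [h, Subgroup.card_bot, one_pow] at this
    exact hqp.one_lt.ne' (Nat.dvd_one.1 (hqQ.trans this))
  obtain ⟨g', hg'⟩ := Subgroup.ne_bot_iff_exists_ne_one.1 hnb
  have hgn : (⟨g'.1, g'.2.2⟩ : (Q : Subgroup H)) ≠ 1 := by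
    intro h
    exact hg' (Subtype.ext (congrArg (fun t : (Q : Subgroup H) => (t : H)) h))
  refine fh_final (G := (Q : Subgroup H)) (V := V) q Q.isPGroup' hV ?_ ?_ v₀ hv₀
    ⟨g'.1, g'.2.2⟩ hgn g'.2.1
  · intro x hx hx1 _ v hv
    have hxc : (x : H) ∈ Subgroup.center H := by
      have hidx : (Subgroup.centralizer ({(x : H)} : Set H)).index = 1 := by
        by_contra hne1
        obtain ⟨r, hr, hrd⟩ := Nat.exists_prime_and_dvd hne1
        have hrf : Fact r.Prime := ⟨hr⟩
        obtain ⟨P⟩ : Nonempty (Sylow r H) := inferInstance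
        have hPC : (P : Subgroup H) ≤ Subgroup.centralizer ({(x : H)} : Set H) := by
          intro y hy
          rw [Subgroup.mem_centralizer_singleton_iff]
          by_cases hrq : r = q
          · subst hrq
            have hPQ : (P : Subgroup H) = Q := by
              have hs : Subsingleton (Sylow r H) := by
                exact @Unique.instSubsingleton _ (Sylow.unique_of_normal Q hQn)
              rw [Subsingleton.elim P Q]
            have hyQ : y ∈ (Q : Subgroup H) := hPQ ▸ hy
            exact congrArg (fun t : (Q : Subgroup H) => (t : H)) (Subgroup.mem_center_iff.1 hx ⟨y, hyQ⟩)
          · have hdis : Disjoint (P : Subgroup H) (Q : Subgroup H) :=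
              IsPGroup.disjoint_of_ne r q hrq _ _ P.isPGroup' Q.isPGroup'
            exact Subgroup.commute_of_normal_of_disjoint _ _ (hsn r hrf P) hQn hdis y x hy x.2
        exact P.not_dvd_index (hrd.trans (Subgroup.index_dvd_of_le hPC))
      rw [Subgroup.mem_center_iff]
      intro g
      have : g ∈ Subgroup.centralizer ({(x : H)} : Set H) := by
        rw [Subgroup.index_eq_one.1 hidx]; exact Subgroup.mem_top g
      exact Subgroup.mem_centralizer_singleton_iff.1 this
    refine hnorm (Subgroup.zpowers (x : H)) ?_ ?_ v ?_
    · constructor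
      intro n hn g
      have hnc : n ∈ Subgroup.center H := by
        have : Subgroup.zpowers (x : H) ≤ Subgroup.center H := by rwa [Subgroup.zpowers_le]
        exact this hn
      rw [Subgroup.mem_center_iff.1 hnc g, mul_inv_cancel_right]
      exact hn
    · rw [Ne, Subgroup.zpowers_eq_bot]
      exact fun h => hx1 (Subtype.ext h)
    · intro n hn
      have : Subgroup.zpowers (x : H) ≤ MulAction.stabilizer H v := by
        rw [Subgroup.zpowers_le]; exact hv
      exact this hn
  · rintro v ⟨g, hg1, hg⟩
    have h1 := hdiv v ⟨g, fun h => hg1 (Subtype.ext h), hg⟩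
    rw [fh_stab_sub]
    exact Nat.le_of_dvd (pow_pos Nat.card_pos 2) h1

end frobHelpers

/-- Let a nontrivial finite nilpotent group `H` act faithfully and irreducibly on an elementary
abelian `p`-group `V` (an `𝔽_p[H]`-module), via `ρ : H →* (V ≃ₗ[ZMod p] V)`.  If for every
`v ∈ V` either `C_H(v) = 1` or `|H|` divides `|C_H(v)|²`, then `G = V ⋊ H` is a Frobenius group
with complement `H` and kernel `V`, i.e. every nontrivial element of `H` fixes only `0 ∈ V`. -/
theorem frobenius_of_centralizer_condition
    {p : ℕ} [Fact p.Prime] {H V : Type*} [Group H] [Finite H] [Nontrivial H]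
    [Group.IsNilpotent H] [AddCommGroup V] [Module (ZMod p) V] [Finite V]
    (ρ : H →* (V ≃ₗ[ZMod p] V))
    (hfaithful : Function.Injective ρ)
    (hirr : ∀ W : Submodule (ZMod p) V, (∀ h : H, ∀ v ∈ W, ρ h v ∈ W) → W = ⊥ ∨ W = ⊤)
    (hcent : ∀ v : V, (∀ h : H, ρ h v = v → h = 1) ∨
      Nat.card H ∣ (Nat.card {h : H // ρ h v = v}) ^ 2) :
    ∀ h : H, h ≠ 1 → ∀ v : V, ρ h v = v → v = 0 := by
  intro h hh v hv
  by_contra hv0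
  let act : DistribMulAction H V :=
    { smul := fun g w => ρ g w
      one_smul := fun w => by change ρ 1 w = w; rw [map_one]; rfl
      mul_smul := fun x y w => by change ρ (x * y) w = ρ x (ρ y w); rw [map_mul]; rfl
      smul_zero := fun x => map_zero (ρ x)
      smul_add := fun x v w => map_add (ρ x) v w }
  have hsm : ∀ (g : H) (w : V), g • w = ρ g w := fun g w => rfl
  have hfa : FaithfulSMul H V := ⟨fun {x y} hxy => hfaithful (LinearEquiv.ext hxy)⟩
  refine fh_main (H := H) (V := V) p (Module.finrank (ZMod p) V) Fact.out ?_ ?_ ?_ v hv0 h hh hv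
  · rw [Module.natCard_eq_pow_finrank (K := ZMod p), Nat.card_zmod]
  · intro N hN hNb w hw
    let W : Submodule (ZMod p) V :=
      { carrier := {u | ∀ n ∈ N, ρ n u = u}
        zero_mem' := fun n _ => map_zero (ρ n)
        add_mem' := fun {a b} ha hb n hn => by rw [map_add, ha n hn, hb n hn]
        smul_mem' := fun c a ha n hn => by rw [map_smul, ha n hn] }
    have hmem : ∀ u, u ∈ W ↔ ∀ n ∈ N, n • u = u := fun u => Iff.rfl
    rcases hirr W (by
      intro g u hu
      rw [hmem] at hu ⊢
      intro n hn
      rw [← hsm]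
      have h1 := hu (g⁻¹ * n * g) (by simpa using hN.conj_mem n hn g⁻¹)
      calc n • g • u = g • ((g⁻¹ * n * g) • u) := by
            rw [smul_smul, smul_smul]; congr 1; group
        _ = g • u := by rw [h1]) with hW | hW
    · have : w ∈ W := hw
      rw [hW] at this
      exact (Submodule.mem_bot (ZMod p)).1 this
    · exfalso
      apply hNb
      rw [eq_bot_iff]
      intro n hn
      rw [Subgroup.mem_bot]
      apply hfaithful
      ext u
      have : u ∈ W := hW ▸ Submodule.mem_top
      rw [map_one]
      exact this n hn
  · rintro w ⟨g, hg1, hg⟩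
    rcases hcent w with h1 | h1
    · exact absurd (h1 g hg) hg1
    · exact h1
end

section
/- Let a nontrivial finite nilpotent group N act faithfully and coprimely on a finite group G (i.e., gcd(|N|,|G|) = 1). Then there exists g ∈ G such that |C_N(g)| ≤ (|N|/p)^{1/p}, where p is the smallest prime divisor of |N|. -/
theorem isc_arith_aux (r : ℕ) : ∀ k : ℕ, k ≤ r → (r + 1) ^ k ≤ (k + 1) * r ^ k := by
  intro k
  induction k with
  | zero => intro _; simp
  | succ k ih =>
    intro hk
    have h1 := ih (by omega)
    calc (r + 1) ^ (k + 1) = (r + 1) ^ k * (r + 1) := pow_succ _ _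
      _ ≤ (k + 1) * r ^ k * (r + 1) := Nat.mul_le_mul_right _ h1
      _ = ((k + 1) * (r + 1)) * r ^ k := by ring
      _ ≤ ((k + 1 + 1) * r) * r ^ k := by
        apply Nat.mul_le_mul_right
        nlinarith
      _ = (k + 1 + 1) * r ^ (k + 1) := by ring

theorem isc_arith {p r : ℕ} (hp : 1 ≤ p) (hpr : p ≤ r) : r ^ (p - 1) ≤ p ^ (r - 1) := by
  induction r, hpr using Nat.le_induction with
  | base => exact le_rfl
  | succ r hpr ih =>
    have h1 := isc_arith_aux r (p - 1) (by omega)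
    have e : p - 1 + 1 = p := by omega
    rw [e] at h1
    calc (r + 1) ^ (p - 1) ≤ p * r ^ (p - 1) := h1
      _ ≤ p * p ^ (r - 1) := Nat.mul_le_mul_left _ ih
      _ = p ^ (r + 1 - 1) := by
        rw [← pow_succ']; congr 1; omega

theorem isc_prime_index {N : Type*} [Group N] [Finite N] [Group.IsNilpotent N]
    (S : Subgroup N) (hS : S ≠ ⊤) : ∃ H : Subgroup N, S ≤ H ∧ H.Normal ∧ H.index.Prime := by
  obtain h | ⟨H, hH, hSH⟩ := eq_top_or_exists_le_coatom S
  · exact absurd h hS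
  have hn : H.Normal :=
    Subgroup.NormalizerCondition.normal_of_coatom H (Group.normalizerCondition_of_isNilpotent) hH
  refine ⟨H, hSH, hn, ?_⟩
  have hnt : Nontrivial (N ⧸ H) := QuotientGroup.nontrivial_iff.2 hH.1
  have : IsSimpleGroup (N ⧸ H) := by
    refine ⟨fun K hK => ?_⟩
    have h1 : H ≤ K.comap (QuotientGroup.mk' H) := QuotientGroup.le_comap_mk' H K
    rcases h1.eq_or_lt with h | h
    · left
      have h2 : (K.comap (QuotientGroup.mk' H)).map (QuotientGroup.mk' H) = K :=
        Subgroup.map_comap_eq_self_of_surjective (QuotientGroup.mk'_surjective H) K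
      rw [← h2, ← h, QuotientGroup.map_mk'_self]
    · right
      have h2 : (K.comap (QuotientGroup.mk' H)).map (QuotientGroup.mk' H) = K :=
        Subgroup.map_comap_eq_self_of_surjective (QuotientGroup.mk'_surjective H) K
      rw [← h2, hH.2 _ h, Subgroup.map_top_of_surjective _ (QuotientGroup.mk'_surjective H)]
  exact IsSimpleGroup.prime_card (α := N ⧸ H)

theorem isc_card_relIndex {N : Type*} [Group N] [Finite N] (K C : Subgroup N) :
    Nat.card (K ⊓ C : Subgroup N) * K.relIndex C = Nat.card C := by
  rw [← Subgroup.inf_relIndex_right, Subgroup.relIndex,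
    ← Subgroup.card_mul_index ((K ⊓ C).subgroupOf C)]
  congr 1
  exact (Nat.card_congr (Subgroup.subgroupOfEquivOfLe (inf_le_right : K ⊓ C ≤ C)).toEquiv).symm

theorem isc_card_inf {N : Type*} [Group N] [Finite N] {K C S : Subgroup N} (h : K ≤ C) :
    Nat.card (C ⊓ S : Subgroup N) * Nat.card K ≤ Nat.card C * Nat.card (K ⊓ S : Subgroup N) := by
  have h1 := isc_card_relIndex K C
  have h2 := isc_card_relIndex K (C ⊓ S)
  have h3 : K ⊓ (C ⊓ S) = K ⊓ S := by rw [← inf_assoc, inf_eq_left.2 h]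
  rw [inf_eq_left.2 h] at h1
  rw [h3] at h2
  have h4 : K.relIndex (C ⊓ S) ≤ K.relIndex C := by
    apply Subgroup.relIndex_le_of_le_right inf_le_left
    intro h0
    rw [h0] at h1
    have : 0 < Nat.card C := Nat.card_pos
    omega
  rw [← h1, ← h2]
  calc _ = (Nat.card (K ⊓ S : Subgroup N) * Nat.card K) * K.relIndex (C ⊓ S) := by ring
    _ ≤ (Nat.card (K ⊓ S : Subgroup N) * Nat.card K) * K.relIndex C := Nat.mul_le_mul_left _ h4
    _ = _ := by ring

/-- chain lemma -/
theorem isc_chain {N ι : Type*} [Group N] [Finite N] [DecidableEq ι] (p : ℕ) (hp : 1 ≤ p)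
    (𝒮 : ι → Set (Subgroup N)) (K : ι → Subgroup N)
    (h : ∀ i, ∀ L : Subgroup N, L ≤ K i ∨ ∃ S ∈ 𝒮 i, K i ≤ S ∧
      p * Nat.card (L ⊓ S : Subgroup N) ^ p ≤ Nat.card L * Nat.card (L ⊓ K i : Subgroup N) ^ (p - 1))
    (s : Finset ι) :
    ∃ (J : Finset ι) (S : ι → Subgroup N), J ⊆ s ∧ (∀ i ∈ J, S i ∈ 𝒮 i) ∧ (∀ i ∈ J, K i ≤ S i) ∧
      p ^ J.card * Nat.card (J.inf S : Subgroup N) ^ p ≤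
        Nat.card N * Nat.card (s.inf K : Subgroup N) ^ (p - 1) := by
  induction s using Finset.induction_on with
  | empty =>
    refine ⟨∅, fun _ => ⊤, le_rfl, by simp, by simp, ?_⟩
    simp only [Finset.card_empty, pow_zero, one_mul, Finset.inf_empty]
    rw [Subgroup.card_top, ← pow_succ', Nat.sub_add_cancel hp]
  | insert j s hj ih =>
    obtain ⟨J, S, hJ, hS, hKS, hc⟩ := ih
    rw [Finset.inf_insert]
    set M := s.inf K with hM
    rcases h j M with hl | ⟨S', hS', hKS', hc'⟩
    · refine ⟨J, S, hJ.trans (Finset.subset_insert _ _), hS, hKS, ?_⟩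
      rwa [inf_eq_right.2 hl]
    · have hjJ : j ∉ J := fun h => hj (hJ h)
      refine ⟨insert j J, Function.update S j S', Finset.insert_subset_insert _ hJ, ?_, ?_, ?_⟩
      · intro i hi
        rcases eq_or_ne i j with rfl | hne
        · simpa using hS'
        · rw [Function.update_of_ne hne]
          exact hS i (Finset.mem_of_mem_insert_of_ne hi hne)
      · intro i hi
        rcases eq_or_ne i j with rfl | hne
        · simpa using hKS'
        · rw [Function.update_of_ne hne]
          exact hKS i (Finset.mem_of_mem_insert_of_ne hi hne)
      · rw [Finset.inf_insert, Finset.card_insert_of_notMem hjJ, Function.update_self]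
        have e1 : J.inf (Function.update S j S') = J.inf S := by
          apply Finset.inf_congr rfl
          intro i hi
          rw [Function.update_of_ne]
          rintro rfl; exact hjJ hi
        rw [e1]
        have hMC : M ≤ J.inf S := by
          apply Finset.le_inf
          intro i hi
          exact (Finset.inf_le (hJ hi)).trans (hKS i hi)
        have hi := isc_card_inf (S := S') hMC
        rw [inf_comm S', inf_comm (K j)]
        set C := J.inf S
        have hM0 : 0 < Nat.card M := Nat.card_pos
        have hMp : 0 < Nat.card M ^ p := pow_pos hM0 _
        apply Nat.le_of_mul_le_mul_right _ hMp
        have e2 : Nat.card M ^ p = Nat.card M ^ (p - 1) * Nat.card M := by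
          rw [← pow_succ, Nat.sub_add_cancel hp]
        calc p ^ (J.card + 1) * Nat.card (C ⊓ S' : Subgroup N) ^ p * Nat.card M ^ p
            = p ^ (J.card + 1) * (Nat.card (C ⊓ S' : Subgroup N) * Nat.card M) ^ p := by
              rw [mul_pow]; ring
          _ ≤ p ^ (J.card + 1) * (Nat.card C * Nat.card (M ⊓ S' : Subgroup N)) ^ p := by
              gcongr
          _ = (p ^ J.card * Nat.card C ^ p) * (p * Nat.card (M ⊓ S' : Subgroup N) ^ p) := by
              rw [mul_pow]; ring
          _ ≤ (Nat.card N * Nat.card M ^ (p - 1)) *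
                (Nat.card M * Nat.card (M ⊓ K j : Subgroup N) ^ (p - 1)) :=
              Nat.mul_le_mul hc hc'
          _ = _ := by rw [e2]; ring

theorem isc_marks_aux {N Z : Type*} [Group N] [Finite N] [Finite Z] [MulAction N Z]
    [Fintype (Subgroup N)] [DecidableEq (Subgroup N)] [DecidableLT (Subgroup N)]
    (B : Subgroup N) :
    Nat.card {x : Z // ∀ b ∈ B, b • x = x} =
      Nat.card {x : Z // MulAction.stabilizer N x = B} +
        ∑ B' ∈ Finset.univ.filter (fun B' : Subgroup N => B < B'),
          Nat.card {x : Z // MulAction.stabilizer N x = B'} := by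
  classical
  have := Fintype.ofFinite Z
  simp only [Nat.card_eq_fintype_card, Fintype.card_subtype]
  rw [← Finset.sum_insert (s := Finset.univ.filter (fun B' : Subgroup N => B < B')) (a := B)
    (f := fun B' => (Finset.univ.filter (fun x : Z => MulAction.stabilizer N x = B')).card)
    (by simp)]
  rw [Finset.card_eq_sum_card_fiberwise (f := fun x : Z => MulAction.stabilizer N x)
    (t := insert B (Finset.univ.filter (fun B' : Subgroup N => B < B')))]
  · apply Finset.sum_congr rfl
    intro B' hB'
    congr 1
    ext x
    simp only [Finset.mem_filter, Finset.mem_univ, true_and, and_iff_right_iff_imp]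
    rintro rfl b hb
    have : B ≤ MulAction.stabilizer N x := by
      simp only [Finset.mem_insert, Finset.mem_filter, Finset.mem_univ, true_and] at hB'
      rcases hB' with h | h
      · exact h.ge
      · exact h.le
    exact this hb
  · intro x hx
    simp only [Finset.coe_filter, Finset.mem_univ, true_and, Set.mem_setOf_eq] at hx
    have : B ≤ MulAction.stabilizer N x := fun b hb => hx b hb
    simp only [Finset.coe_insert, Finset.coe_filter, Finset.mem_univ, true_and,
      Set.mem_insert_iff, Set.mem_setOf_eq]
    rcases this.eq_or_lt with h | h
    · exact Or.inl h.symm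
    · exact Or.inr h

/-- equal marks give equal stabilizers -/
theorem isc_marks {N X Y : Type*} [Group N] [Finite N] [Finite X] [Finite Y]
    [MulAction N X] [MulAction N Y]
    (h : ∀ B : Subgroup N, Nat.card {x : X // ∀ b ∈ B, b • x = x} =
      Nat.card {y : Y // ∀ b ∈ B, b • y = y}) (B : Subgroup N) :
    Nat.card {x : X // MulAction.stabilizer N x = B} =
      Nat.card {y : Y // MulAction.stabilizer N y = B} := by
  classical
  have : Fintype (Subgroup N) := Fintype.ofFinite _
  induction B using WellFoundedGT.induction with
  | _ B ih =>
    have h1 := isc_marks_aux (Z := X) B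
    have h2 := isc_marks_aux (Z := Y) B
    have h3 : ∑ B' ∈ Finset.univ.filter (fun B' : Subgroup N => B < B'),
        Nat.card {x : X // MulAction.stabilizer N x = B'} =
        ∑ B' ∈ Finset.univ.filter (fun B' : Subgroup N => B < B'),
        Nat.card {x : Y // MulAction.stabilizer N x = B'} :=
      Finset.sum_congr rfl fun B' hB' => ih B' (by simpa using hB')
    have h4 := h B
    omega

theorem isc_marks_exists {N X Y : Type*} [Group N] [Finite N] [Finite X] [Finite Y]
    [MulAction N X] [MulAction N Y]
    (h : ∀ B : Subgroup N, Nat.card {x : X // ∀ b ∈ B, b • x = x} =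
      Nat.card {y : Y // ∀ b ∈ B, b • y = y}) (x : X) :
    ∃ y : Y, MulAction.stabilizer N y = MulAction.stabilizer N x := by
  have h1 := isc_marks h (MulAction.stabilizer N x)
  have h2 : 0 < Nat.card {x' : X // MulAction.stabilizer N x' = MulAction.stabilizer N x} :=
    have : Nonempty {x' : X // MulAction.stabilizer N x' = MulAction.stabilizer N x} := ⟨⟨x, rfl⟩⟩
    Nat.card_pos
  rw [h1] at h2
  obtain ⟨⟨y, hy⟩⟩ := (Nat.card_pos_iff.1 h2).1
  exact ⟨y, hy⟩


theorem isc_fix {N X : Type*} [Group N] [MulAction N X] (Y : Set X) [Finite Y] (b : N) (r : ℕ)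
    (hr : r.Prime) (hY : ∀ y ∈ Y, b • y ∈ Y) (hb : ∀ y ∈ Y, b ^ r • y = y)
    (hc : ¬ r ∣ Nat.card Y) : ∃ y ∈ Y, b • y = y := by
  classical
  have : Fintype Y := Fintype.ofFinite _
  have : Fact r.Prime := ⟨hr⟩
  let f : Function.End Y := fun y => ⟨b • y.1, hY y.1 y.2⟩
  have hf : ∀ k (y : Y), ((f ^ k) y : X) = b ^ k • (y : X) := by
    intro k
    induction k with
    | zero => intro y; rw [pow_zero, pow_zero, one_smul]; rfl
    | succ k ih =>
      intro y
      rw [pow_succ, pow_succ, mul_smul]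
      exact ih (f y)
  have hf1 : f ^ r ^ 1 = 1 := by
    funext y
    apply Subtype.ext
    rw [hf, pow_one, hb y y.2]; rfl
  have h := Equiv.Perm.card_fixedPoints_modEq hf1
  by_contra hne
  push Not at hne
  have h0 : Fintype.card (Function.fixedPoints f) = 0 := by
    rw [Fintype.card_eq_zero_iff]
    refine ⟨fun y => hne y.1.1 y.1.2 (congrArg Subtype.val y.2)⟩
  rw [h0] at h
  rw [Nat.card_eq_fintype_card] at hc
  exact hc ((Nat.modEq_zero_iff_dvd).1 h)

theorem isc_step {N : Type*} [Group N] [Finite N] [Group.IsNilpotent N] (B : Subgroup N)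
    (hB : B ≠ ⊥) : ∃ B' < B, ∃ b ∈ B, ∃ r : ℕ, r.Prime ∧ r ∣ Nat.card N ∧ b ^ r ∈ B' ∧
      (∀ x ∈ B, ∀ y ∈ B', x⁻¹ * y * x ∈ B') ∧ (∀ C : Subgroup N, B' ≤ C → b ∈ C → B ≤ C) := by
  have hnt : Nontrivial B := (Subgroup.nontrivial_iff_ne_bot B).2 hB
  obtain ⟨H, -, hn, hp⟩ := isc_prime_index (⊥ : Subgroup B) bot_ne_top
  have hHt : H ≠ ⊤ := by
    rintro rfl
    rw [Subgroup.index_top] at hp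
    exact Nat.not_prime_one hp
  obtain ⟨b, hb⟩ : ∃ b : B, b ∉ H := by
    by_contra hcon
    push Not at hcon
    exact hHt (Subgroup.eq_top_iff' H |>.2 hcon)
  refine ⟨H.map B.subtype, ?_, b, b.2, H.index, hp, ?_, ?_, ?_, ?_⟩
  · refine lt_of_le_of_ne (Subgroup.map_subtype_le H) ?_
    intro h
    apply hb
    have : (b : N) ∈ H.map B.subtype := by rw [h]; exact b.2
    obtain ⟨c, hc, hcb⟩ := this
    rwa [← Subtype.ext hcb]
  · exact (H.index_dvd_card).trans (Subgroup.card_subgroup_dvd_card B)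
  · exact ⟨b ^ H.index, Subgroup.pow_index_mem H b, by simp⟩
  · rintro x hx _ ⟨y, hy, rfl⟩
    refine ⟨(⟨x, hx⟩ : B)⁻¹ * y * ⟨x, hx⟩, ?_, by simp⟩
    have := hn.conj_mem y hy (⟨x, hx⟩ : B)⁻¹
    simpa using this
  · intro C hC hbC x hx
    have h1 : H < C.subgroupOf B := by
      refine lt_of_le_of_ne ?_ ?_
      · intro y hy
        exact hC ⟨y, hy, rfl⟩
      · rintro h
        exact hb (by rw [h]; exact hbC)
    have h2 : C.subgroupOf B = ⊤ := by
      have h3 := Subgroup.relIndex_mul_index h1.le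
      have h4 : (C.subgroupOf B).index ∣ H.index := Dvd.intro_left _ h3
      rcases (Nat.dvd_prime hp).1 h4 with h5 | h5
      · exact Subgroup.index_eq_one.1 h5
      · exfalso
        rw [h5] at h3
        have h6 : H.relIndex (C.subgroupOf B) = 1 :=
          Nat.eq_of_mul_eq_mul_right hp.pos (by rw [h3, one_mul])
        exact absurd (Subgroup.relIndex_eq_one.1 h6) (not_le_of_gt h1)
    have : (⟨x, hx⟩ : B) ∈ C.subgroupOf B := by rw [h2]; trivial
    exact this

/-- fixed subgroup -/
def iscFix {N : Type*} (G : Type*) [Group N] [Group G] [MulDistribMulAction N G] (B : Subgroup N) :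
    Subgroup G where
  carrier := {g | ∀ b ∈ B, b • g = g}
  mul_mem' := by
    intro x y hx hy b hb
    rw [smul_mul', hx b hb, hy b hb]
  one_mem' := fun b _ => smul_one b
  inv_mem' := by
    intro x hx b hb
    rw [smul_inv', hx b hb]

theorem mem_iscFix {N G : Type*} [Group N] [Group G] [MulDistribMulAction N G] {B : Subgroup N}
    {g : G} : g ∈ iscFix G B ↔ ∀ b ∈ B, b • g = g := Iff.rfl

theorem isc_torsor {N G : Type*} [Group N] [Finite N] [Group.IsNilpotent N] [Group G] [Finite G]
    [MulDistribMulAction N G] (hco : Nat.Coprime (Nat.card N) (Nat.card G)) (B : Subgroup N) :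
    ∀ (D : Subgroup G), (∀ b ∈ B, ∀ d ∈ D, b • d ∈ D) → ∀ g : G, (∀ b ∈ B, (b • g) * g⁻¹ ∈ D) →
      ∃ d ∈ D, ∀ b ∈ B, b • (d * g) = d * g := by
  induction B using WellFoundedLT.induction with
  | _ B ih =>
    intro D hD g hg
    by_cases hB : B = ⊥
    · subst hB
      refine ⟨1, D.one_mem, ?_⟩
      intro b hb
      rw [Subgroup.mem_bot.1 hb, one_smul]
    obtain ⟨B', hB', b, hb, r, hr, hrN, hbr, hnorm, hgen⟩ := isc_step B hB
    obtain ⟨d', hd', hfix⟩ := ih B' hB' D (fun b hb => hD b (hB'.le hb)) g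
      (fun b hb => hg b (hB'.le hb))
    set g' := d' * g with hg'
    have hbg' : ∀ x ∈ B, (x • g') * g'⁻¹ ∈ D := by
      intro x hx
      have : (x • g') * g'⁻¹ = (x • d') * ((x • g) * g⁻¹) * d'⁻¹ := by
        rw [hg', smul_mul']; group
      rw [this]
      exact D.mul_mem (D.mul_mem (hD x hx d' hd') (hg x hx)) (D.inv_mem hd')
    let Y : Set G := {y | y * g'⁻¹ ∈ D ∧ ∀ x ∈ B', x • y = y}
    have hcard : Nat.card Y = Nat.card (D ⊓ iscFix G B' : Subgroup G) := by
      refine Nat.card_congr ⟨fun y => ⟨y.1 * g'⁻¹, y.2.1, ?_⟩, fun d => ⟨d.1 * g', ?_, ?_⟩, ?_, ?_⟩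
      · intro x hx
        rw [smul_mul', smul_inv', y.2.2 x hx, hfix x hx]
      · have := d.2.1
        simpa using this
      · intro x hx
        rw [smul_mul', hfix x hx, d.2.2 x hx]
      · intro y; simp
      · intro d; simp
    obtain ⟨y, hy, hby⟩ := isc_fix Y b r hr (by
      rintro y ⟨hy1, hy2⟩
      refine ⟨?_, ?_⟩
      · have : (b • y) * g'⁻¹ = (b • (y * g'⁻¹)) * ((b • g') * g'⁻¹) := by
          rw [smul_mul', smul_inv']; group
        rw [this]
        exact D.mul_mem (hD b hb _ hy1) (hbg' b hb)
      · intro x hx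
        have h1 := hy2 _ (hnorm b hb x hx)
        calc x • b • y = b • (b⁻¹ * x * b) • y := by
              simp only [← mul_smul]; congr 1; group
          _ = b • y := by rw [h1]) (fun y hy => hy.2 _ hbr) (by
      rw [hcard]
      intro hdvd
      have h2 : r ∣ Nat.card G := hdvd.trans (Subgroup.card_subgroup_dvd_card _)
      have h3 := Nat.dvd_gcd hrN h2
      rw [hco] at h3
      exact hr.one_lt.ne' (Nat.dvd_one.1 h3))
    refine ⟨y * g⁻¹, ?_, ?_⟩
    · have : y * g⁻¹ = (y * g'⁻¹) * d' := by rw [hg']; group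
      rw [this]
      exact D.mul_mem hy.1 hd'
    · rw [inv_mul_cancel_right]
      exact hgen (MulAction.stabilizer N y) (fun x hx => hy.2 x hx) hby

theorem isc_glauberman {N G X : Type*} [Group N] [Finite N] [Group.IsNilpotent N] [Group G]
    [Finite G] [MulDistribMulAction N G] [MulAction N X] [MulAction G X] [Finite X] [Nonempty X]
    (hco : Nat.Coprime (Nat.card N) (Nat.card G))
    (hcompat : ∀ (n : N) (g : G) (x : X), n • g • x = (n • g) • n • x)
    (htrans : ∀ x y : X, ∃ g : G, g • x = y) (B : Subgroup N) :
    (∃ x : X, ∀ b ∈ B, b • x = x) ∧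
    (∀ x y : X, (∀ b ∈ B, b • x = x) → (∀ b ∈ B, b • y = y) → ∃ g ∈ iscFix G B, g • x = y) := by
  have tr : ∀ B : Subgroup N, 
      (∀ x y : X, (∀ b ∈ B, b • x = x) → (∀ b ∈ B, b • y = y) →
        ∃ g ∈ iscFix G B, g • x = y) := by
    intro B x y hx hy
    obtain ⟨g, hg⟩ := htrans x y
    obtain ⟨d, hd, hdf⟩ := isc_torsor hco B (MulAction.stabilizer G y) (by
      intro b hb d hd
      rw [MulAction.mem_stabilizer_iff] at hd ⊢
      conv_lhs => rw [← hy b hb]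
      rw [← hcompat, hd, hy b hb]) g (by
      intro b hb
      rw [MulAction.mem_stabilizer_iff, mul_smul, ← hg, inv_smul_smul]
      conv_lhs => rw [← hx b hb]
      rw [← hcompat, hg, hy b hb])
    refine ⟨d * g, hdf, ?_⟩
    rw [mul_smul, hg]; exact hd
  refine ⟨?_, tr B⟩
  induction B using WellFoundedLT.induction with
  | _ B ih =>
    by_cases hB : B = ⊥
    · subst hB
      refine ⟨Classical.arbitrary X, ?_⟩
      intro b hb
      rw [Subgroup.mem_bot.1 hb, one_smul]
    obtain ⟨B', hB', b, hb, r, hr, hrN, hbr, hnorm, hgen⟩ := isc_step B hB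
    obtain ⟨x, hx⟩ := ih B' hB'
    let Y : Set X := {y | ∀ c ∈ B', c • y = y}
    have hYorb : Y = MulAction.orbit (iscFix G B') x := by
      ext y
      constructor
      · intro hy
        obtain ⟨g, hg, hgx⟩ := tr B' x y hx hy
        exact ⟨⟨g, hg⟩, hgx⟩
      · rintro ⟨⟨g, hg⟩, rfl⟩ c hc
        change c • g • x = g • x
        rw [hcompat, hg c hc, hx c hc]
    obtain ⟨y, hy, hby⟩ := isc_fix Y b r hr (by
      intro y hy2 x hx
      have h1 := hy2 _ (hnorm b hb x hx)
      calc x • b • y = b • (b⁻¹ * x * b) • y := by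
            simp only [← mul_smul]; congr 1; group
        _ = b • y := by rw [h1]) (fun y hy => hy _ hbr) (by
      intro hdvd
      rw [hYorb, Nat.card_congr (MulAction.orbitEquivQuotientStabilizer _ x)] at hdvd
      have h2 : r ∣ Nat.card G := (hdvd.trans (Subgroup.index_dvd_card _)).trans
        (Subgroup.card_subgroup_dvd_card _)
      have h3 := Nat.dvd_gcd hrN h2
      rw [hco] at h3
      exact hr.one_lt.ne' (Nat.dvd_one.1 h3))
    exact ⟨y, hgen (MulAction.stabilizer N y) (fun x hx => hy x hx) hby⟩


open scoped Pointwise in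
theorem isc_sylow_glauberman {N G : Type*} [Group N] [Finite N] [Group.IsNilpotent N] [Group G]
    [Finite G] [MulDistribMulAction N G] (hco : Nat.Coprime (Nat.card N) (Nat.card G))
    (q : ℕ) [Fact q.Prime] (B : Subgroup N) :
    (∃ x : Sylow q G, ∀ b ∈ B, b • x = x) ∧
    (∀ x y : Sylow q G, (∀ b ∈ B, b • x = x) → (∀ b ∈ B, b • y = y) →
      ∃ g ∈ iscFix G B, g • x = y) := by
  apply isc_glauberman hco
  · intro n g P
    apply Sylow.ext
    rw [Sylow.coe_subgroup_smul, Sylow.pointwise_smul_def, Sylow.pointwise_smul_def,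
      Sylow.coe_subgroup_smul]
    ext x
    simp only [Subgroup.mem_pointwise_smul_iff_inv_smul_mem, ← map_inv, MulAut.smul_def,
      MulAut.conj_apply, smul_mul', smul_inv', inv_inv, inv_smul_smul]
  · intro x y
    exact MulAction.exists_smul_eq G x y

/-- the restricted action -/
@[reducible] def iscSub {N G : Type*} [Group N] [Group G] [MulDistribMulAction N G] (D : Subgroup G)
    (h : ∀ n : N, ∀ d ∈ D, n • d ∈ D) : MulDistribMulAction N D where
  smul n d := ⟨n • d.1, h n d.1 d.2⟩
  one_smul d := Subtype.ext (one_smul N d.1)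
  mul_smul a b d := Subtype.ext (mul_smul a b d.1)
  smul_mul a x y := Subtype.ext (smul_mul' a x.1 y.1)
  smul_one a := Subtype.ext (smul_one a)

open scoped Pointwise in
theorem isc_extend {N G : Type*} [Group N] [Finite N] [Group.IsNilpotent N] [Group G]
    [Finite G] [MulDistribMulAction N G] (hco : Nat.Coprime (Nat.card N) (Nat.card G))
    (q : ℕ) [hq : Fact q.Prime] (T : Subgroup G) (hT : IsPGroup q T)
    (hinv : ∀ n : N, ∀ t ∈ T, n • t ∈ T) :
    ∃ P : Sylow q G, T ≤ P ∧ ∀ n : N, n • P = P := by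
  induction hm : Nat.card G - Nat.card T using Nat.strong_induction_on generalizing T with
  | _ m ih =>
    obtain ⟨k, hk⟩ := IsPGroup.iff_card.1 hT
    by_cases hdvd : q ^ (k + 1) ∣ Nat.card G
    · -- extend
      let D : Subgroup G := Subgroup.normalizer (T : Set G)
      have hTD : T ≤ D := Subgroup.le_normalizer
      have hDinv : ∀ n : N, ∀ d ∈ D, n • d ∈ D := by
        intro n d hd
        rw [Subgroup.mem_normalizer_iff] at hd ⊢
        intro h
        have e1 : n⁻¹ • (n • d * h * (n • d)⁻¹) = d * (n⁻¹ • h) * d⁻¹ := by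
          simp [smul_mul', smul_inv']
        have e2 : ∀ x : G, x ∈ T ↔ n⁻¹ • x ∈ T := fun x =>
          ⟨fun hx => hinv _ _ hx, fun hx => by simpa using hinv n _ hx⟩
        rw [e2 h, e2 (n • d * h * (n • d)⁻¹), e1]
        exact hd _
      let _ : MulDistribMulAction N D := iscSub D hDinv
      have hcoD : Nat.Coprime (Nat.card N) (Nat.card D) :=
        hco.coprime_dvd_right (Subgroup.card_subgroup_dvd_card D)
      obtain ⟨S, hS⟩ := (isc_sylow_glauberman hcoD q (⊤ : Subgroup N)).1
      have hTn : (T.subgroupOf D).Normal := Subgroup.normal_in_normalizer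
      have hTp : IsPGroup q (T.subgroupOf D) :=
        hT.of_equiv (Subgroup.subgroupOfEquivOfLe hTD).symm
      have hTS : T.subgroupOf D ≤ S := by
        obtain ⟨Q, hQ⟩ := hTp.exists_le_sylow
        obtain ⟨g, hg⟩ := MulAction.exists_smul_eq D Q S
        rw [← hg, Sylow.coe_subgroup_smul]
        intro x hx
        rw [Subgroup.mem_pointwise_smul_iff_inv_smul_mem]
        apply hQ
        have := hTn.conj_mem x hx g⁻¹
        simpa using this
      let S' : Subgroup G := S.1.map D.subtype
      have hS'p : IsPGroup q S' := S.2.map _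
      have hTS' : T ≤ S' := by
        intro x hx
        exact ⟨⟨x, hTD hx⟩, hTS hx, rfl⟩
      have hS'inv : ∀ n : N, ∀ t ∈ S', n • t ∈ S' := by
        rintro n _ ⟨t, ht, rfl⟩
        refine ⟨n • t, ?_, rfl⟩
        have h1 := hS n trivial
        have h2 : n • t ∈ (n • S : Sylow q D).1 := Subgroup.smul_mem_pointwise_smul t n S.1 ht
        rw [h1] at h2
        exact h2
      have hcard : Nat.card T < Nat.card S' := by
        have h1 : q ^ (k + 1) ∣ Nat.card D := Sylow.prime_pow_dvd_card_normalizer hdvd hk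
        have h2 : q ^ (k + 1) ∣ Nat.card S := S.pow_dvd_card_of_pow_dvd_card h1
        have h3 : Nat.card S' = Nat.card S :=
          Nat.card_congr (S.1.equivMapOfInjective D.subtype D.subtype_injective).toEquiv.symm
        rw [h3, hk]
        exact lt_of_lt_of_le (Nat.pow_lt_pow_right hq.out.one_lt (Nat.lt_succ_self k))
          (Nat.le_of_dvd Nat.card_pos h2)
      have hle : Nat.card S' ≤ Nat.card G := Nat.le_of_dvd Nat.card_pos
        (Subgroup.card_subgroup_dvd_card S')
      obtain ⟨P, hP, hPi⟩ := ih (Nat.card G - Nat.card S') (by omega) S' hS'p hS'inv rfl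
      exact ⟨P, hTS'.trans hP, hPi⟩
    · have hkf : k = (Nat.card G).factorization q := by
        have h1 : q ^ k ∣ Nat.card G := hk ▸ Subgroup.card_subgroup_dvd_card T
        have h2 := (hq.out.pow_dvd_iff_le_factorization Nat.card_pos.ne').1 h1
        have h3 := mt (hq.out.pow_dvd_iff_le_factorization Nat.card_pos.ne').2 hdvd
        omega
      refine ⟨Sylow.ofCard T (by rw [hk, ← hkf]), by rw [Sylow.coe_ofCard], ?_⟩
      intro n
      apply Sylow.ext
      rw [Sylow.pointwise_smul_def, Sylow.coe_ofCard]
      ext x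
      rw [Subgroup.mem_pointwise_smul_iff_inv_smul_mem]
      exact ⟨fun hx => by simpa using hinv n _ hx, fun hx => hinv _ _ hx⟩

open scoped Pointwise in
theorem isc_sylow_marks {N G : Type*} [Group N] [Finite N] [Group.IsNilpotent N] [Group G]
    [Finite G] [MulDistribMulAction N G] (hco : Nat.Coprime (Nat.card N) (Nat.card G))
    (q : ℕ) [hq : Fact q.Prime] (Q : Sylow q G) (hQ : ∀ n : N, n • Q = Q) (B : Subgroup N) :
    Nat.card (Q.1 ⊓ iscFix G B : Subgroup G) =
      q ^ (Nat.card (iscFix G B)).factorization q := by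
  set C := iscFix G B with hC
  obtain ⟨R0⟩ : Nonempty (Sylow q C) := inferInstance
  let R : Subgroup G := R0.1.map C.subtype
  have hRC : R ≤ C := Subgroup.map_subtype_le _
  have hRcard : Nat.card R = q ^ (Nat.card C).factorization q := by
    rw [← R0.card_eq_multiplicity]
    exact Nat.card_congr (R0.1.equivMapOfInjective C.subtype C.subtype_injective).toEquiv.symm
  have hcoB : Nat.Coprime (Nat.card B) (Nat.card G) :=
    hco.coprime_dvd_left (Subgroup.card_subgroup_dvd_card B)
  obtain ⟨P, hRP, hP⟩ := isc_extend (N := B) hcoB q R (R0.2.map _) (by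
    intro n t ht
    have : n • t = t := hRC ht n.1 n.2
    rwa [this])
  obtain ⟨g, hg, hgP⟩ := (isc_sylow_glauberman hco q B).2 P Q (fun b hb => hP ⟨b, hb⟩)
    (fun b _ => hQ b)
  apply le_antisymm
  · have hpg : IsPGroup q (Q.1 ⊓ C : Subgroup G) := Q.2.to_le inf_le_left
    obtain ⟨k, hk⟩ := IsPGroup.iff_card.1 hpg
    rw [hk]
    apply Nat.pow_le_pow_right hq.out.pos
    rw [← hq.out.pow_dvd_iff_le_factorization Nat.card_pos.ne', ← hk]
    exact Subgroup.card_dvd_of_le inf_le_right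
  · rw [← hRcard]
    have : Nat.card R = Nat.card (MulAut.conj g • R : Subgroup G) :=
      Nat.card_congr (Subgroup.equivSMul (MulAut.conj g) R).toEquiv
    rw [this]
    apply Nat.le_of_dvd Nat.card_pos
    apply Subgroup.card_dvd_of_le
    apply le_inf
    · rw [← hgP, Sylow.coe_subgroup_smul]
      exact Subgroup.pointwise_smul_le_pointwise_smul_iff.2 hRP
    · intro x hx
      rw [Subgroup.mem_pointwise_smul_iff_inv_smul_mem, ← map_inv, MulAut.smul_def,
        MulAut.conj_apply] at hx
      have h1 := C.mul_mem (C.mul_mem hg (hRC hx)) (C.inv_mem hg)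
      convert h1 using 1
      group

theorem isc_quot_marks {N G : Type*} [Group N] [Finite N] [Group.IsNilpotent N] [Group G]
    [Finite G] [MulDistribMulAction N G] (hco : Nat.Coprime (Nat.card N) (Nat.card G))
    (M : Subgroup G) [M.Normal] [MulDistribMulAction N M] [MulDistribMulAction N (G ⧸ M)]
    (hM : ∀ (n : N) (m : M), ((n • m : M) : G) = n • (m : G))
    (hQ : ∀ (n : N) (g : G), n • (g : G ⧸ M) = ((n • g : G) : G ⧸ M)) (B : Subgroup N) :
    Nat.card (iscFix G B) = Nat.card (iscFix M B) * Nat.card (iscFix (G ⧸ M) B) := by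
  let φ : iscFix G B →* G ⧸ M := (QuotientGroup.mk' M).comp (iscFix G B).subtype
  have hr : φ.range = iscFix (G ⧸ M) B := by
    ext x
    constructor
    · rintro ⟨g, rfl⟩ b hb
      change b • ((g : G) : G ⧸ M) = ((g : G) : G ⧸ M)
      rw [hQ, g.2 b hb]
    · intro hx
      obtain ⟨g, rfl⟩ := QuotientGroup.mk_surjective x
      obtain ⟨d, hd, hdf⟩ := isc_torsor hco B M (by
        intro b _ d hd
        have := (b • (⟨d, hd⟩ : M)).2
        rwa [hM] at this) g (by
        intro b hb
        have h1 := hx b hb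
        rw [hQ, eq_comm, QuotientGroup.eq] at h1
        exact (Subgroup.Normal.mem_comm_iff inferInstance).1 h1)
      refine ⟨⟨d * g, hdf⟩, ?_⟩
      change ((d * g : G) : G ⧸ M) = _
      rw [eq_comm, QuotientGroup.eq]
      apply (Subgroup.Normal.mem_comm_iff inferInstance).2
      simpa using hd
  have hk : Nat.card φ.ker = Nat.card (iscFix M B) := by
    refine Nat.card_congr ⟨fun g => ⟨⟨g.1.1, ?_⟩, ?_⟩, fun m => ⟨⟨m.1.1, ?_⟩, ?_⟩, ?_, ?_⟩
    · have := g.2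
      rw [MonoidHom.mem_ker] at this
      exact (QuotientGroup.eq_one_iff _).1 this
    · intro b hb
      apply Subtype.ext
      rw [hM]
      exact g.1.2 b hb
    · intro b hb
      rw [← hM, m.2 b hb]
    · rw [MonoidHom.mem_ker]
      exact (QuotientGroup.eq_one_iff _).2 m.1.2
    · intro g; rfl
    · intro m; rfl
  rw [← Subgroup.card_mul_index φ.ker, Subgroup.index_ker, hk, hr]


open scoped commutatorElement in
theorem isc_maxabel {N : Type*} [Group N] [Finite N] [Group.IsNilpotent N] :
    ∃ A : Subgroup N, A.Normal ∧ (∀ x ∈ A, ∀ y ∈ A, x * y = y * x) ∧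
      ∀ x : N, (∀ a ∈ A, a * x = x * a) → x ∈ A := by
  classical
  obtain ⟨A, hA⟩ := (Set.toFinite {A : Subgroup N | A.Normal ∧
    (∀ x ∈ A, ∀ y ∈ A, x * y = y * x)}).exists_maximal
    ⟨⊥, inferInstance, by
      intro x hx y hy
      rw [Subgroup.mem_bot] at hx hy
      rw [hx, hy]⟩
  obtain ⟨⟨hn, hc⟩, hmax⟩ := hA
  refine ⟨A, hn, hc, ?_⟩
  by_contra! hcon
  obtain ⟨x0, hx0, hx0A⟩ := hcon
  obtain ⟨k, hk⟩ := Group.IsNilpotent.nilpotent N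
  have hex : ∃ n, ∃ x : N, x ∈ Subgroup.upperCentralSeries N n ∧ (∀ a ∈ A, a * x = x * a) ∧ x ∉ A :=
    ⟨k, x0, by rw [hk]; trivial, hx0, hx0A⟩
  obtain ⟨x, hxZ, hxC, hxA⟩ := Nat.find_spec hex
  have hmin := fun m (hm : m < Nat.find hex) => Nat.find_min hex hm
  generalize Nat.find hex = n at hxZ hmin
  rcases n with _ | m
  · rw [Subgroup.upperCentralSeries_zero, Subgroup.mem_bot] at hxZ
    exact hxA (hxZ ▸ A.one_mem)
  have hm := hmin m (Nat.lt_succ_self m)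
  push Not at hm
  rw [Subgroup.mem_upperCentralSeries_succ_iff] at hxZ
  have hcomm : ∀ y : N, ⁅x, y⁆ ∈ A := by
    intro y
    apply hm _ (hxZ y)
    intro a ha
    have h1 := hxC a ha
    have h2 := hxC (y⁻¹ * a * y) (by simpa using hn.conj_mem a ha y⁻¹)
    have h3 : a * (y * x * y⁻¹) = (y * x * y⁻¹) * a := by
      have : a * (y * x * y⁻¹) = y * ((y⁻¹ * a * y) * x) * y⁻¹ := by group
      rw [this, h2]; group
    have e : ⁅x, y⁆ = x * (y * x * y⁻¹)⁻¹ := by rw [commutatorElement_def]; group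
    rw [e]
    have h4 : Commute a x := h1
    have h5 : Commute a (y * x * y⁻¹) := h3
    exact h4.mul_right h5.inv_right
  set A' := Subgroup.closure ((A : Set N) ∪ {x}) with hA'
  have hle : A ≤ A' := fun a ha => Subgroup.subset_closure (Or.inl ha)
  have hxA' : x ∈ A' := Subgroup.subset_closure (Or.inr rfl)
  have hn' : A'.Normal := by
    refine ⟨fun z hz y => ?_⟩
    have : A' ≤ A'.comap (MulAut.conj y).toMonoidHom := by
      rw [hA', Subgroup.closure_le, ← hA']
      rintro w (hw | rfl)
      · exact hle (hn.conj_mem w hw y)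
      · change y * w * y⁻¹ ∈ A'
        have e : y * w * y⁻¹ = ⁅w, y⁆⁻¹ * w := by rw [commutatorElement_def]; group
        rw [e]
        exact A'.mul_mem (A'.inv_mem (hle (hcomm y))) hxA'
    exact this hz
  have hc' : ∀ u ∈ A', ∀ v ∈ A', u * v = v * u := by
    have h1 : A' ≤ Subgroup.centralizer ((A : Set N) ∪ {x}) := by
      rw [hA', Subgroup.closure_le]
      rintro w (hw | rfl)
      · rw [SetLike.mem_coe, Subgroup.mem_centralizer_iff]
        rintro z (hz | rfl)
        · exact hc z hz w hw
        · exact (hxC w hw).symm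
      · rw [SetLike.mem_coe, Subgroup.mem_centralizer_iff]
        rintro z (hz | rfl)
        · exact hxC z hz
        · rfl
    have h2 : A' ≤ Subgroup.centralizer (A' : Set N) := by
      conv_lhs => rw [hA']
      rw [Subgroup.closure_le]
      intro w hw
      rw [SetLike.mem_coe, Subgroup.mem_centralizer_iff]
      intro z hz
      exact (Subgroup.mem_centralizer_iff.1 (h1 hz) w hw).symm
    intro u hu v hv
    exact Subgroup.mem_centralizer_iff.1 (h2 hv) u hu
  exact hxA (hmax ⟨hn', hc'⟩ hle hxA')

theorem isc_cyclic {A V : Type*} [CommGroup A] [Finite A] [CommGroup V] [Finite V] [Nontrivial V]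
    [MulDistribMulAction A V] (hco : Nat.Coprime (Nat.card A) (Nat.card V))
    (hs : ∀ a : A, a ≠ 1 → ∀ v : V, a • v = v → v = 1) : IsCyclic A := by
  classical
  let ρ : A →* AddMonoid.End (Additive V) :=
    { toFun := fun a => (MulDistribMulAction.toMonoidHom V a).toAdditive
      map_one' := by
        ext v
        exact one_smul A v.toMul
      map_mul' := by
        intro a b
        ext v
        exact mul_smul a b v.toMul }
  have hρ : ∀ a (v : Additive V), ρ a v = Additive.ofMul (a • v.toMul) := fun a v => rfl
  let φ : MonoidAlgebra ℤ A →ₐ[ℤ] AddMonoid.End (Additive V) := MonoidAlgebra.lift ℤ _ A ρ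
  have hφ : ∀ a, φ (MonoidAlgebra.of ℤ A a) = ρ a := fun a => MonoidAlgebra.lift_of ρ a
  have hI : RingHom.ker φ.toRingHom ≠ ⊤ := by
    intro h
    have h1 : (1 : MonoidAlgebra ℤ A) ∈ RingHom.ker φ.toRingHom := by rw [h]; trivial
    rw [RingHom.mem_ker, map_one] at h1
    obtain ⟨v, hv⟩ := exists_ne (1 : V)
    apply hv
    have := DFunLike.congr_fun h1 (Additive.ofMul v)
    exact this
  obtain ⟨m, hm, hle⟩ := Ideal.exists_le_maximal _ hI
  have hmem : ∀ x, φ x = 0 → Ideal.Quotient.mk m x = 0 := by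
    intro x hx
    rw [Ideal.Quotient.eq_zero_iff_mem]
    exact hle hx
  let f : A →* MonoidAlgebra ℤ A ⧸ m :=
    ((Ideal.Quotient.mk m) : _ →* _).comp (MonoidAlgebra.of ℤ A)
  have : Field (MonoidAlgebra ℤ A ⧸ m) := Ideal.Quotient.field m
  refine @isCyclic_of_injective_ringHom _ _ _ (Ideal.Quotient.isDomain m) _ _ f ?_
  rw [injective_iff_map_eq_one]
  intro a ha
  by_contra hne
  have ho : orderOf a ≠ 1 := fun h => hne (orderOf_eq_one_iff.1 h)
  obtain ⟨r, hr, hra⟩ := Nat.exists_prime_and_dvd ho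
  obtain ⟨k, hk⟩ := hra
  set b := a ^ k with hb
  have hbf : f b = 1 := by rw [hb, map_pow, ha, one_pow]
  have hapos := orderOf_pos a
  have hkpos : 0 < k := by
    rcases Nat.eq_zero_or_pos k with h | h
    · rw [h] at hk; omega
    · exact h
  have hbr : b ^ r = 1 := by rw [hb, ← pow_mul, mul_comm, ← hk, pow_orderOf_eq_one]
  have hb1 : b ≠ 1 := by
    intro h
    have := Nat.le_of_dvd hkpos (orderOf_dvd_of_pow_eq_one h)
    have := hr.two_le
    nlinarith
  have h1 : φ (∑ i ∈ Finset.range r, MonoidAlgebra.of ℤ A b ^ i) = 0 := by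
    rw [map_sum]
    simp_rw [map_pow, hφ]
    ext v
    have key : ρ b ((∑ i ∈ Finset.range r, ρ b ^ i) v) = (∑ i ∈ Finset.range r, ρ b ^ i) v := by
      have : ρ b * (∑ i ∈ Finset.range r, ρ b ^ i) = ∑ i ∈ Finset.range r, ρ b ^ i := by
        have h2 := mul_geom_sum (ρ b) r
        rw [← map_pow, hbr, map_one, sub_self, sub_mul, one_mul, sub_eq_zero] at h2
        exact h2
      exact DFunLike.congr_fun this v
    exact hs b hb1 _ key
  have h2 := hmem _ h1
  rw [map_sum] at h2
  have h3 : ∀ i, Ideal.Quotient.mk m (MonoidAlgebra.of ℤ A b ^ i) = 1 := by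
    intro i
    rw [map_pow]
    have : Ideal.Quotient.mk m (MonoidAlgebra.of ℤ A b) = 1 := hbf
    rw [this, one_pow]
  simp_rw [h3] at h2
  simp only [Finset.sum_const, Finset.card_range, nsmul_eq_mul, mul_one] at h2
  have h4 : φ ((Nat.card V : ℕ) : MonoidAlgebra ℤ A) = 0 := by
    rw [map_natCast]
    ext v
    have : (((Nat.card V : ℕ) : AddMonoid.End (Additive V)) v) = (Nat.card V) • v := by
      simp
    rw [this]
    exact pow_card_eq_one' (G := V) (x := v.toMul)
  have h5 := hmem _ h4
  rw [map_natCast] at h5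
  have hcop : Nat.Coprime r (Nat.card V) := by
    refine Nat.Coprime.coprime_dvd_left ?_ hco
    exact (Dvd.intro _ hk.symm).trans (orderOf_dvd_natCard a)
  have h6 : (1 : MonoidAlgebra ℤ A ⧸ m) = 0 := by
    have := (Nat.isCoprime_iff_coprime.2 hcop)
    obtain ⟨u, w, huw⟩ := this
    have h7 := congrArg (Int.cast : ℤ → MonoidAlgebra ℤ A ⧸ m) huw
    push_cast at h7
    rw [h2, h5, mul_zero, mul_zero, add_zero] at h7
    exact h7.symm
  have : Nontrivial (MonoidAlgebra ℤ A ⧸ m) := Ideal.Quotient.nontrivial_iff.2 hm.ne_top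
  exact one_ne_zero h6

theorem isc_odd {N : Type*} [Group N] [Finite N] [Group.IsNilpotent N] (A : Subgroup N) [A.Normal]
    [IsCyclic A] (hA : ∀ x : N, (∀ a ∈ A, a * x = x * a) → x ∈ A) (c : N) (r : ℕ)
    (hr : r.Prime) (hr2 : Odd r) (hc : c ^ r = 1) (n : N) :
    c * (n * c * n⁻¹) = (n * c * n⁻¹) * c := by
  have : Fact r.Prime := ⟨hr⟩
  set d := n * c * n⁻¹ * c⁻¹ with hd
  have hdc : d * c = n * c * n⁻¹ := by rw [hd]; group
  have hconj : (MulAut.conjNormal d : MulAut A) = 1 := by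
    apply (IsCyclic.mulAutMulEquiv A).injective
    rw [hd]
    simp only [map_mul, map_inv, map_one]
    rw [mul_right_comm ((IsCyclic.mulAutMulEquiv A) _)]
    simp
  have hdA : d ∈ A := by
    apply hA
    intro a ha
    have h1 := MulAut.conjNormal_apply d (⟨a, ha⟩ : A)
    rw [hconj] at h1
    have h2 : a = d * a * d⁻¹ := h1
    conv_lhs => rw [h2]
    group
  obtain ⟨m, hm⟩ := MonoidHom.map_cyclic (MulAut.conjNormal c : MulAut A).toMonoidHom
  have hm' : ∀ a ∈ A, c * a * c⁻¹ = a ^ m := by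
    intro a ha
    have h1 := congrArg (Subtype.val) (hm ⟨a, ha⟩)
    have h2 := MulAut.conjNormal_apply c (⟨a, ha⟩ : A)
    rw [← h2]
    exact h1
  have hcd : ∀ j : ℕ, c ^ j * d * (c ^ j)⁻¹ = d ^ (m ^ j) := by
    intro j
    induction j with
    | zero => simp
    | succ j ih =>
      have : c ^ (j+1) * d * (c ^ (j+1))⁻¹ = c * (c ^ j * d * (c ^ j)⁻¹) * c⁻¹ := by
        rw [pow_succ']; group
      rw [this, ih, hm' _ (A.zpow_mem hdA _), ← zpow_mul, pow_succ]
  have hpow : ∀ j : ℕ, (d * c) ^ j = d ^ (∑ i ∈ Finset.range j, m ^ i) * c ^ j := by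
    intro j
    induction j with
    | zero => simp
    | succ j ih =>
      rw [pow_succ, ih, Finset.sum_range_succ, zpow_add, ← hcd j, pow_succ]
      group
  have h1 : d ^ (∑ i ∈ Finset.range r, m ^ i) = 1 := by
    have h2 := hpow r
    rw [hc, mul_one, hdc] at h2
    rw [← h2, conj_pow, hc]
    group
  by_cases hd1 : d = 1
  · rw [hd1, one_mul] at hdc
    rw [← hdc]
  -- order of d is a power of r
  have hdr : ∃ e, orderOf d = r ^ e := by
    have hzp : IsPGroup r (Subgroup.zpowers c) := by
      intro g
      refine ⟨1, ?_⟩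
      obtain ⟨g, k, rfl⟩ := g
      ext
      simp only [pow_one]
      change (c ^ k) ^ r = 1
      rw [← zpow_natCast, ← zpow_mul, mul_comm, zpow_mul, zpow_natCast, hc, one_zpow]
    obtain ⟨P, hP⟩ := hzp.exists_le_sylow
    have hcP : c ∈ (P : Subgroup N) := hP (Subgroup.mem_zpowers c)
    have hPn : (P : Subgroup N).Normal := inferInstance
    have hdP : d ∈ (P : Subgroup N) :=
      (P : Subgroup N).mul_mem (hPn.conj_mem c hcP n) ((P : Subgroup N).inv_mem hcP)
    obtain ⟨k, hk⟩ := P.2 ⟨d, hdP⟩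
    have hk' : d ^ (r ^ k) = 1 := congrArg Subtype.val hk
    obtain ⟨e, -, he⟩ := (Nat.dvd_prime_pow hr).1 (orderOf_dvd_of_pow_eq_one hk')
    exact ⟨e, he⟩
  obtain ⟨e, he⟩ := hdr
  have he0 : e ≠ 0 := by
    rintro rfl
    exact hd1 (orderOf_eq_one_iff.1 (by simpa using he))
  have hm1 : (r : ℤ) ∣ m - 1 := by
    have h2 := hcd r
    rw [hc] at h2
    have h3 : d ^ (m ^ r - 1) = 1 := by
      rw [zpow_sub, ← h2]; simp
    rw [← orderOf_dvd_iff_zpow_eq_one, he] at h3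
    have h4 : (r : ℤ) ∣ m ^ r - 1 := by
      refine dvd_trans ?_ h3
      push_cast
      exact dvd_pow_self _ he0
    rw [← ZMod.intCast_zmod_eq_zero_iff_dvd] at h4 ⊢
    push_cast at h4 ⊢
    rwa [ZMod.pow_card] at h4
  obtain ⟨b, hb⟩ := hm1
  have hmb : m = 1 + r * b := by linarith
  have hdr : d ^ r = 1 := by
    by_contra hne
    have he2 : 2 ≤ e := by
      by_contra hlt
      have : e = 1 := by omega
      rw [this, pow_one] at he
      exact hne (he ▸ pow_orderOf_eq_one d)
    have h2 := odd_sq_dvd_geom_sum₂_sub (1 : ℤ) b hr2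
    simp only [one_pow, mul_one] at h2
    rw [← hmb] at h2
    rw [← orderOf_dvd_iff_zpow_eq_one, he] at h1
    have h3 : (r : ℤ) ^ 2 ∣ ∑ i ∈ Finset.range r, m ^ i := by
      refine dvd_trans ?_ h1
      push_cast
      exact pow_dvd_pow _ he2
    have h4 : (r : ℤ) ^ 2 ∣ r := by
      have := dvd_sub h3 h2
      simpa using this
    have h5 : r ^ 2 ∣ r := by exact_mod_cast h4
    have := Nat.le_of_dvd hr.pos h5
    have := hr.two_le
    nlinarith
  have hcd1 : c * d * c⁻¹ = d := by
    rw [hm' d hdA, hmb, zpow_add, zpow_mul, zpow_natCast, hdr]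
    simp
  rw [← hdc]
  have : c * d = d * c := by
    conv_rhs => rw [← hcd1]
    group
  rw [← mul_assoc, this]


theorem isc_totient (k : ℕ) : 0 < k → (2 * k).totient ≤ k := by
  induction k using Nat.strong_induction_on with
  | _ k ih =>
    intro hk
    rcases Nat.even_or_odd k with h | h
    · rw [Nat.totient_two_mul_of_even h]
      obtain ⟨j, hj⟩ := h
      have := ih j (by omega) (by omega)
      rw [show k = 2 * j by omega]
      omega
    · rw [Nat.totient_two_mul_of_odd h]
      exact Nat.totient_le k

theorem isc_core {N V : Type*} [Group N] [Finite N] [Nontrivial N] [Group.IsNilpotent N]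
    [CommGroup V] [Finite V] [Nontrivial V] [MulDistribMulAction N V]
    (hco : Nat.Coprime (Nat.card N) (Nat.card V))
    (hsr : ∀ A : Subgroup N, A.Normal → (∀ x ∈ A, ∀ y ∈ A, x * y = y * x) →
      ∀ a ∈ A, a ≠ 1 → ∀ v : V, a • v = v → v = 1) (p : ℕ) (hp : 2 ≤ p)
    (hpm : ∀ r : ℕ, r.Prime → r ∣ Nat.card N → p ≤ r) :
    ∃ v : V, p * Nat.card (MulAction.stabilizer N v) ^ p ≤ Nat.card N := by
  obtain ⟨A, hAn, hAc, hAC⟩ := isc_maxabel (N := N)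
  obtain ⟨v, hv⟩ := exists_ne (1 : V)
  refine ⟨v, ?_⟩
  set C := MulAction.stabilizer N v with hC
  have hCA : ∀ a ∈ A, a • v = v → a = 1 := by
    intro a ha hav
    by_contra hne
    exact hv (hsr A hAn hAc a ha hne v hav)
  have hcyc : IsCyclic A := by
    let _ : CommGroup A := { (inferInstance : Group A) with
      mul_comm := fun x y => Subtype.ext (hAc x x.2 y y.2) }
    refine isc_cyclic (A := A) (V := V) ?_ ?_
    · exact Nat.Coprime.coprime_dvd_left (Subgroup.card_subgroup_dvd_card A) hco
    · intro a ha w hw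
      exact hsr A hAn hAc a a.2 (fun h => ha (Subtype.ext h)) w hw
  by_cases hCb : C = ⊥
  · rw [hCb, Subgroup.card_bot, one_pow, mul_one]
    obtain ⟨r, hr, hrd⟩ := Nat.exists_prime_and_dvd (Finite.one_lt_card (α := N)).ne'
    exact (hpm r hr hrd).trans (Nat.le_of_dvd Nat.card_pos hrd)
  have hC1 : Nat.card C ≠ 1 := fun h => hCb (Subgroup.card_eq_one.1 h)
  obtain ⟨r, hr, hrd⟩ := Nat.exists_prime_and_dvd hC1
  have : Fact r.Prime := ⟨hr⟩
  obtain ⟨c', hc'⟩ := exists_prime_orderOf_dvd_card' r hrd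
  obtain ⟨c, hcC⟩ := c'
  rw [Subgroup.orderOf_mk] at hc'
  have hcr : c ^ r = 1 := hc' ▸ pow_orderOf_eq_one c
  have hc1 : c ≠ 1 := by
    intro h
    rw [h, orderOf_one] at hc'
    exact hr.one_lt.ne hc'
  have hcv : c • v = v := hcC
  rcases hr.eq_two_or_odd' with hr2 | hr2
  swap
  · exfalso
    have hodd := isc_odd A hAC c r hr hr2 hcr
    have hcomm : ∀ x ∈ Group.conjugatesOfSet {c}, ∀ y ∈ Group.conjugatesOfSet {c}, x * y = y * x := by
      intro x hx y hy
      rw [Group.mem_conjugatesOfSet_iff] at hx hy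
      obtain ⟨_, rfl, hx⟩ := hx
      obtain ⟨_, rfl, hy⟩ := hy
      rw [isConj_iff] at hx hy
      obtain ⟨g, rfl⟩ := hx
      obtain ⟨h, rfl⟩ := hy
      have := hodd (g⁻¹ * h)
      have e1 : ∀ c : N, g * c * g⁻¹ * (h * c * h⁻¹) = g * (c * (g⁻¹ * h * c * (g⁻¹ * h)⁻¹)) * g⁻¹ := by
        intro c; group
      rw [e1, this]
      group
    have hU : ∀ x ∈ Subgroup.normalClosure {c}, ∀ y ∈ Subgroup.normalClosure {c}, x * y = y * x := by
      have h1 := Subgroup.isMulCommutative_closure (k := Group.conjugatesOfSet {c}) hcomm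
      intro x hx y hy
      have := h1.is_comm.comm (⟨x, hx⟩ : Subgroup.closure (Group.conjugatesOfSet {c})) ⟨y, hy⟩
      exact congrArg Subtype.val this
    exact hv (hsr _ inferInstance hU c (Subgroup.subset_normalClosure rfl) hc1 v hcv)
  · have hp2 : p = 2 := by
      have := hpm r hr (hrd.trans (Subgroup.card_subgroup_dvd_card C))
      omega
    subst hr2
    have heven : 2 ∣ Nat.card A := by
      by_contra hodd
      apply hc1
      refine hCA c (hAC c ?_) hcv
      intro a ha
      have hzp : IsPGroup 2 (Subgroup.zpowers c) := by
        intro g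
        refine ⟨1, ?_⟩
        obtain ⟨g, k, rfl⟩ := g
        ext
        simp only [pow_one]
        change (c ^ k) ^ 2 = 1
        rw [← zpow_natCast, ← zpow_mul, mul_comm, zpow_mul, zpow_natCast, hcr, one_zpow]
      obtain ⟨P, hP⟩ := hzp.exists_le_sylow
      have hcP : c ∈ (P : Subgroup N) := hP (Subgroup.mem_zpowers c)
      have hPn : (P : Subgroup N).Normal := inferInstance
      have hdP : a * c * a⁻¹ * c⁻¹ ∈ (P : Subgroup N) :=
        (P : Subgroup N).mul_mem (hPn.conj_mem c hcP a) ((P : Subgroup N).inv_mem hcP)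
      have hdA : a * c * a⁻¹ * c⁻¹ ∈ A := by
        have := A.mul_mem ha (hAn.conj_mem _ (A.inv_mem ha) c)
        simpa [mul_assoc] using this
      set d := a * c * a⁻¹ * c⁻¹ with hd
      obtain ⟨k, hk⟩ := P.2 ⟨d, hdP⟩
      have hk' : d ^ (2 ^ k) = 1 := congrArg Subtype.val hk
      have h1 : orderOf d ∣ 2 ^ k := orderOf_dvd_of_pow_eq_one hk'
      have h2 : orderOf d ∣ Nat.card A := by
        have := orderOf_dvd_natCard (⟨d, hdA⟩ : A)
        rwa [Subgroup.orderOf_mk] at this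
      have h3 : Nat.Coprime (2 ^ k) (Nat.card A) :=
        Nat.Coprime.pow_left _ ((Nat.Prime.coprime_iff_not_dvd Nat.prime_two).2 hodd)
      have h4 : orderOf d = 1 := Nat.eq_one_of_dvd_coprimes h3 h1 h2
      have h5 : d = 1 := orderOf_eq_one_iff.1 h4
      have : a * c = d * (c * a) := by rw [hd]; group
      rw [this, h5, one_mul]
    have hcard : Nat.card C ≤ Nat.card (MulAut A) := by
      have : Finite (MulAut A) := DFunLike.finite _
      refine Nat.card_le_card_of_injective
        (fun x : C => (MulAut.conjNormal (x : N) : MulAut A)) ?_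
      intro x y hxy
      have h1 : (MulAut.conjNormal ((x : N) * (y : N)⁻¹) : MulAut A) = 1 := by
        rw [map_mul, map_inv, mul_inv_eq_one]
        exact hxy
      have h2 : (x : N) * (y : N)⁻¹ ∈ A := by
        apply hAC
        intro a ha
        have h3 := MulAut.conjNormal_apply ((x : N) * (y : N)⁻¹) (⟨a, ha⟩ : A)
        rw [h1] at h3
        have h4 : a = ((x : N) * (y : N)⁻¹) * a * ((x : N) * (y : N)⁻¹)⁻¹ := h3
        conv_lhs => rw [h4]
        group
      have h5 : (x : N) * (y : N)⁻¹ ∈ C := C.mul_mem x.2 (C.inv_mem y.2)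
      exact Subtype.ext (mul_inv_eq_one.1 (hCA _ h2 h5))
    rw [IsCyclic.card_mulAut] at hcard
    obtain ⟨k, hk⟩ := heven
    have hApos : 0 < Nat.card A := Nat.card_pos
    have h6 := isc_totient k (by omega)
    rw [← hk] at h6
    have h7 : Nat.card C * Nat.card A ≤ Nat.card N := by
      rw [← Nat.card_prod]
      refine Nat.card_le_card_of_injective (fun x : C × A => (x.1 : N) * (x.2 : N)) ?_
      apply Subgroup.mul_injective_of_disjoint
      rw [Subgroup.disjoint_def]
      intro x hx hxA
      exact hCA x hxA hx
    rw [hp2]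
    have h8 : Nat.card C ≤ k := hcard.trans h6
    calc 2 * Nat.card C ^ 2 = Nat.card C * (2 * Nat.card C) := by ring
      _ ≤ Nat.card C * Nat.card A := by rw [hk]; gcongr
      _ ≤ _ := h7


/-- pointwise stabilizer of a set -/
def iscKer (N : Type*) {X : Type*} [Group N] [MulAction N X] (D : Set X) : Subgroup N :=
  ⨅ x ∈ D, MulAction.stabilizer N x

theorem mem_iscKer {N X : Type*} [Group N] [MulAction N X] {D : Set X} {n : N} :
    n ∈ iscKer N D ↔ ∀ x ∈ D, n • x = x := by
  simp only [iscKer, Subgroup.mem_iInf, MulAction.mem_stabilizer_iff]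

theorem iscKer_le {N X : Type*} [Group N] [MulAction N X] {D : Set X} {x : X} (hx : x ∈ D) :
    iscKer N D ≤ MulAction.stabilizer N x := fun _ hn => mem_iscKer.1 hn x hx

/-- relative version of the small-stabilizer property -/
def iscRel {N X : Type*} [Group N] [MulAction N X] (p : ℕ) (D : Set X) (L : Subgroup N) : Prop :=
  L ≤ iscKer N D ∨ ∃ x ∈ D, p * Nat.card (L ⊓ MulAction.stabilizer N x : Subgroup N) ^ p ≤
    Nat.card L * Nat.card (L ⊓ iscKer N D : Subgroup N) ^ (p - 1)

/-- combination over a finite family of pointed subsets -/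
theorem isc_comb {N X ι : Type*} [Group N] [Finite N] [MulAction N X] [Fintype ι] [DecidableEq ι]
    (p : ℕ) (hp : 1 ≤ p) (D : ι → Set X) (o : X) (ho : ∀ i, o ∈ D i)
    (h : ∀ i, ∀ L : Subgroup N, iscRel p (D i) L) :
    ∃ (J : Finset ι) (x : ι → X), (∀ i, x i ∈ D i) ∧ (∀ i, i ∉ J → x i = o) ∧
      ∀ T : Subgroup N, (∀ i, T ≤ MulAction.stabilizer N (x i)) →
      p ^ J.card * Nat.card T ^ p ≤
        Nat.card N * Nat.card (⨅ i, iscKer N (D i) : Subgroup N) ^ (p - 1) := by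
  obtain ⟨J, S, -, hS, -, hb⟩ := isc_chain p hp
    (fun i => {S | ∃ x ∈ D i, S = MulAction.stabilizer N x}) (fun i => iscKer N (D i)) (by
      intro i L
      rcases h i L with h | ⟨x, hx, hle⟩
      · exact Or.inl h
      · exact Or.inr ⟨_, ⟨x, hx, rfl⟩, iscKer_le hx, hle⟩) Finset.univ
  have hex : ∀ i, ∃ x ∈ D i, (i ∈ J → S i = MulAction.stabilizer N x) ∧ (i ∉ J → x = o) := by
    intro i
    by_cases hi : i ∈ J
    · obtain ⟨x, hx, hSx⟩ := hS i hi
      exact ⟨x, hx, fun _ => hSx, fun h => absurd hi h⟩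
    · exact ⟨o, ho i, fun h => absurd h hi, fun _ => rfl⟩
  choose x hxD hxS hxo using hex
  refine ⟨J, x, hxD, hxo, ?_⟩
  intro T hT
  have h1 : T ≤ J.inf S := by
    apply Finset.le_inf
    intro i hi
    rw [hxS i hi]
    exact hT i
  have h2 : (Finset.univ.inf fun i => iscKer N (D i)) = ⨅ i, iscKer N (D i) := by
    rw [Finset.inf_univ_eq_iInf]
  rw [h2] at hb
  refine le_trans ?_ hb
  gcongr
  exact Subgroup.card_le_of_le h1

theorem isc_imprim {N V : Type*} [Group N] [Finite N] [CommGroup V] [Finite V]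
    [MulDistribMulAction N V] (p : ℕ) (hp : 2 ≤ p)
    (hpm : ∀ r : ℕ, r.Prime → r ∣ Nat.card N → p ≤ r)
    (hf : ∀ n : N, (∀ v : V, n • v = v) → n = 1)
    (H : Subgroup N) [H.Normal] (hH : H.index.Prime) (f : N ⧸ H → V →* V)
    (h1 : ∀ (n : N) i v, n • f i v = f ((n : N ⧸ H) * i) (n • v))
    (h2 : ∀ i j, i ≠ j → ∀ v, f i (f j v) = 1)
    (h3 : ∀ v, (∏ᶠ i, f i v) = v)
    (hgood : ∀ i, ∀ L : Subgroup H, iscRel p ((f i).range : Set V) L) :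
    ∃ v : V, p * Nat.card (MulAction.stabilizer N v) ^ p ≤ Nat.card N := by
  classical
  have : Fintype (N ⧸ H) := Fintype.ofFinite _
  simp only [finprod_eq_prod_of_fintype] at h3
  have hcardN : Nat.card N = H.index * Nat.card H := by
    rw [mul_comm, Subgroup.card_mul_index]
  set r := H.index with hr
  have hpr : p ≤ r := hpm r hH (Dvd.intro _ hcardN.symm)
  obtain ⟨J, x, hxD, hxo, hb⟩ := isc_comb (N := H) p (by omega)
    (fun i => ((f i).range : Set V)) 1 (fun i => (f i).range.one_mem) hgood
  have hKbot : (⨅ i, iscKer H ((f i).range : Set V)) = ⊥ := by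
    rw [eq_bot_iff]
    intro h hh
    rw [Subgroup.mem_iInf] at hh
    rw [Subgroup.mem_bot]
    apply Subtype.ext
    apply hf
    intro v
    conv_rhs => rw [← h3 v]
    conv_lhs => rw [← h3 v]
    rw [Finset.smul_prod']
    refine Finset.prod_congr rfl fun i _ => ?_
    exact mem_iscKer.1 (hh i) (f i v) ⟨v, rfl⟩
  rw [hKbot, Subgroup.card_bot, one_pow, mul_one] at hb
  set v := ∏ i, x i with hv
  have hfx : ∀ j, f j v = x j := by
    intro j
    rw [hv, map_prod, Finset.prod_eq_single j]
    · obtain ⟨w, hw⟩ := hxD j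
      rw [← hw]
      conv_rhs => rw [← h3 (f j w)]
      rw [Finset.prod_eq_single j]
      · intro i _ hij
        exact h2 i j hij w
      · simp
    · intro i _ hij
      obtain ⟨w, hw⟩ := hxD i
      rw [← hw]
      exact h2 j i hij.symm w
    · simp
  have hnx : ∀ n : N, n • v = v → ∀ j, n • x j = x ((n : N ⧸ H) * j) := by
    intro n hn j
    rw [← hfx j, h1, hn, hfx]
  have hstab := hb (MulAction.stabilizer H v) (by
    intro i h hh
    rw [MulAction.mem_stabilizer_iff] at hh ⊢
    have h4 : (((h : N) : N ⧸ H)) = 1 := (QuotientGroup.eq_one_iff _).2 h.2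
    have := hnx h hh i
    rw [h4, one_mul] at this
    exact this)
  set c := Nat.card (MulAction.stabilizer H v) with hc
  have hc' : Nat.card (H ⊓ MulAction.stabilizer N v : Subgroup N) = c := by
    rw [hc]
    refine (Nat.card_congr ?_).symm
    exact
      { toFun := fun h => ⟨h.1.1, h.1.2, h.2⟩
        invFun := fun n => ⟨⟨n.1, n.2.1⟩, n.2.2⟩
        left_inv := fun _ => rfl
        right_inv := fun _ => rfl }
  have hHpos : 0 < Nat.card H := Nat.card_pos
  by_cases hle : MulAction.stabilizer N v ≤ H
  · refine ⟨v, ?_⟩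
    rw [inf_eq_right.2 hle] at hc'
    rw [hc']
    have hJ : J.Nonempty := by
      by_contra hJ
      rw [Finset.not_nonempty_iff_eq_empty] at hJ
      have hv1 : v = 1 := by
        rw [hv]
        exact Finset.prod_eq_one fun i _ => hxo i (by simp [hJ])
      rw [hv1] at hle
      have : H = ⊤ := by
        rw [eq_top_iff]
        intro n _
        exact hle (smul_one n)
      rw [hr, this, Subgroup.index_top] at hH
      exact Nat.not_prime_one hH
    have hJ1 : p ≤ p ^ J.card := Nat.le_self_pow (Finset.card_pos.2 hJ).ne' p
    calc p * c ^ p ≤ p ^ J.card * c ^ p := Nat.mul_le_mul_right _ hJ1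
      _ ≤ Nat.card H := hstab
      _ ≤ Nat.card N := Subgroup.card_le_card_group H
  · obtain ⟨n, hnv, hnH⟩ := Set.not_subset.1 hle
    have hnv : n • v = v := hnv
    have hn1 : ((n : N) : N ⧸ H) ≠ 1 := fun h => hnH ((QuotientGroup.eq_one_iff _).1 h)
    have : Fact r.Prime := ⟨hH⟩
    have hcq : Nat.card (N ⧸ H) = r := rfl
    have hiter : ∀ k : ℕ, ∀ j, x j = 1 → x ((n : N ⧸ H) ^ k * j) = 1 := by
      intro k
      induction k with
      | zero => intro j hj; simpa using hj
      | succ k ih =>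
        intro j hj
        rw [pow_succ', mul_assoc, ← hnx n hnv, ih j hj, smul_one]
    have hall : ∀ j, x j = 1 → ∀ i, x i = 1 := by
      intro j hj i
      have h5 : i * j⁻¹ ∈ Submonoid.powers ((n : N) : N ⧸ H) := by
        rw [mem_powers_iff_mem_zpowers]
        exact mem_zpowers_of_prime_card hcq hn1
      obtain ⟨k, hk⟩ := h5
      have := hiter k j hj
      simp only at hk
      rw [hk] at this
      simpa using this
    by_cases hex : ∃ j, x j = 1
    · obtain ⟨j, hj⟩ := hex
      have hv1 : v = 1 := by
        rw [hv]
        exact Finset.prod_eq_one fun i _ => hall j hj i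
      have hcH : c = Nat.card H := by
        rw [hc, hv1]
        have : MulAction.stabilizer H (1 : V) = ⊤ := by
          rw [eq_top_iff]
          intro h _
          exact smul_one h
        rw [this, Subgroup.card_top]
      have hc1 : Nat.card H = 1 := by
        rw [hcH] at hstab
        have h6 : Nat.card H ^ p ≤ Nat.card H := by
          refine le_trans ?_ hstab
          exact Nat.le_mul_of_pos_left _ (by positivity)
        by_contra hne
        have h7 : 1 < Nat.card H := by omega
        have h8 : Nat.card H ^ 1 < Nat.card H ^ p := Nat.pow_lt_pow_right h7 (by omega)
        rw [pow_one] at h8; omega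
      rw [hc1, mul_one] at hcardN
      have hne : ∃ w : V, n • w ≠ w := by
        by_contra! hcon
        exact hnH (hf n hcon ▸ H.one_mem)
      obtain ⟨w, hw⟩ := hne
      refine ⟨w, ?_⟩
      have h9 := Subgroup.card_subgroup_dvd_card (MulAction.stabilizer N w)
      rw [hcardN, Nat.dvd_prime hH] at h9
      rcases h9 with h9 | h9
      · rw [h9, one_pow, mul_one, hcardN]; exact hpr
      · exfalso
        have : MulAction.stabilizer N w = ⊤ := by
          apply Subgroup.eq_top_of_card_eq
          rw [h9, hcardN]
        exact hw (MulAction.mem_stabilizer_iff.1 (this ▸ Subgroup.mem_top n))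
    · have hJ : J = Finset.univ := by
        rw [Finset.eq_univ_iff_forall]
        intro i
        by_contra hi
        exact hex ⟨i, hxo i hi⟩
      have hJr : J.card = r := by
        rw [hJ, Finset.card_univ, ← Nat.card_eq_fintype_card]; rfl
      refine ⟨v, ?_⟩
      have h5 := isc_card_relIndex H (MulAction.stabilizer N v)
      rw [hc'] at h5
      have h6 : H.relIndex (MulAction.stabilizer N v) ≤ r := by
        rw [hr]
        exact Nat.le_of_dvd (Nat.pos_of_ne_zero hH.ne_zero) (Subgroup.relIndex_dvd_index_of_normal H _)
      rw [← h5, hcardN]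
      rw [hJr] at hstab
      have h7 := isc_arith (by omega : 1 ≤ p) hpr
      have ep : p - 1 + 1 = p := by omega
      have er : r - 1 + 1 = r := by omega
      calc p * (c * H.relIndex (MulAction.stabilizer N v)) ^ p ≤ p * (c * r) ^ p := by gcongr
        _ = r * ((p * r ^ (p - 1)) * c ^ p) := by
          rw [mul_pow]
          conv_lhs => rw [← ep]
          rw [pow_succ r, ep]; ring
        _ ≤ r * ((p * p ^ (r - 1)) * c ^ p) := by gcongr
        _ = r * (p ^ r * c ^ p) := by rw [← pow_succ', er]
        _ ≤ r * Nat.card H := by gcongr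


theorem isc_decomp {N V : Type*} [Group N] [Finite N] [Group.IsNilpotent N] [CommGroup V] [Finite V]
    [MulDistribMulAction N V] (hco : Nat.Coprime (Nat.card N) (Nat.card V))
    (hf : ∀ n : N, (∀ v : V, n • v = v) → n = 1)
    (hirr : ∀ W : Subgroup V, (∀ n : N, ∀ w ∈ W, n • w ∈ W) → W = ⊥ ∨ W = ⊤)
    (A : Subgroup N) (hAn : A.Normal) (hAc : ∀ x ∈ A, ∀ y ∈ A, x * y = y * x)
    (a : N) (ha : a ∈ A) (ha1 : a ≠ 1) (v0 : V) (hv0 : v0 ≠ 1) (hav : a • v0 = v0) :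
    ∃ (H : Subgroup N) (_ : H.Normal), H.index.Prime ∧ ∃ f : N ⧸ H → V →* V,
      (∀ (n : N) i v, n • f i v = f ((n : N ⧸ H) * i) (n • v)) ∧
      (∀ i j, i ≠ j → ∀ v, f i (f j v) = 1) ∧
      (∀ v, (∏ᶠ i, f i v) = v) := by
  classical
  have : Fintype N := Fintype.ofFinite _
  obtain ⟨B, hBge, ⟨hBA, w, hwB, hw1⟩, hBmax⟩ := (Set.toFinite {B : Subgroup N | B ≤ A ∧
    ∃ w : V, B ≤ MulAction.stabilizer N w ∧ w ≠ 1}).exists_le_maximal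
    (a := Subgroup.zpowers a)
    ⟨Subgroup.zpowers_le.2 ha, v0, Subgroup.zpowers_le.2 hav, hv0⟩
  set T := Subgroup.normalizer (B : Set N) with hT
  have hTtop : T ≠ ⊤ := by
    intro h
    have hBn : B.Normal := Subgroup.normalizer_eq_top_iff.1 h
    rcases hirr (iscFix V B) (by
      intro n x hx b hb
      have := hx (n⁻¹ * b * n) (by simpa using hBn.conj_mem b hb n⁻¹)
      rw [mul_smul, mul_smul, inv_smul_eq_iff] at this
      exact this) with h1 | h1
    · apply hw1
      have : w ∈ iscFix V B := fun b hb => hwB hb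
      rw [h1, Subgroup.mem_bot] at this
      exact this
    · apply ha1
      apply hf
      intro v
      have : v ∈ iscFix V B := by rw [h1]; trivial
      exact this a (hBge (Subgroup.mem_zpowers a))
  obtain ⟨H, hTH, hHn, hHp⟩ := isc_prime_index T hTtop
  refine ⟨H, hHn, hHp, ?_⟩
  let P : N → V →* V := fun n =>
    ∏ b : B, MulDistribMulAction.toMonoidHom V (n * (b : N) * n⁻¹)
  have hP : ∀ n v, P n v = ∏ b : B, (n * (b : N) * n⁻¹) • v := by
    intro n v
    simp only [P, MonoidHom.finsetProd_apply]
    rfl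
  have hPa : ∀ n v, ∀ b0 ∈ B, (n * b0 * n⁻¹) • P n v = P n v := by
    intro n v b0 hb0
    rw [hP, Finset.smul_prod']
    refine Fintype.prod_equiv (Equiv.mulLeft (⟨b0, hb0⟩ : B)) _ _ ?_
    intro b
    rw [← mul_smul]
    congr 1
    simp only [Equiv.coe_mulLeft, Subgroup.coe_mul]
    group
  have hPb : ∀ n v, ∀ x ∈ A, x • P n v = P n (x • v) := by
    intro n v x hx
    rw [hP, hP, Finset.smul_prod']
    refine Finset.prod_congr rfl fun b _ => ?_
    rw [← mul_smul, ← mul_smul, hAc x hx _ (hAn.conj_mem _ (hBA b.2) n)]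
  have hPc : ∀ n m v, m⁻¹ * n ∉ T → P n (P m v) = 1 := by
    intro n m v hnm
    by_contra hne
    apply hnm
    set y := P n (P m v) with hy
    have hy1 : ∀ b ∈ B, (n * b * n⁻¹) • y = y := fun b hb => hPa n _ b hb
    have hy2 : ∀ b ∈ B, (m * b * m⁻¹) • y = y := by
      intro b hb
      rw [hy, hPb n _ _ (hAn.conj_mem b (hBA hb) m), hPa m v b hb]
    have hz : B ⊔ B.map (MulAut.conj (m⁻¹ * n)).toMonoidHom ≤ B := by
      refine hBmax ⟨?_, m⁻¹ • y, ?_, ?_⟩ le_sup_left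
      · refine sup_le hBA ?_
        rw [Subgroup.map_le_iff_le_comap]
        intro b hb
        exact hAn.conj_mem b (hBA hb) _
      · refine sup_le ?_ ?_
        · intro b hb
          rw [MulAction.mem_stabilizer_iff]
          conv_rhs => rw [← hy2 b hb]
          rw [← mul_smul, ← mul_smul]
          congr 1
          group
        · rw [Subgroup.map_le_iff_le_comap]
          intro b hb
          change ((m⁻¹ * n) * b * (m⁻¹ * n)⁻¹) • m⁻¹ • y = m⁻¹ • y
          conv_rhs => rw [← hy1 b hb]
          rw [← mul_smul, ← mul_smul]
          congr 1
          group
      · intro h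
        exact hne (by rwa [smul_eq_iff_eq_inv_smul, smul_one] at h)
    apply Subgroup.mem_normalizer_fintype
    intro b hb
    exact hz (Subgroup.mem_sup_right ⟨b, hb, rfl⟩)
  have hPd : ∀ m n v, m • P n v = P (m * n) (m • v) := by
    intro m n v
    rw [hP, hP, Finset.smul_prod']
    refine Finset.prod_congr rfl fun b _ => ?_
    rw [← mul_smul, ← mul_smul]
    congr 1
    group
  -- the exponent
  have hcop : Nat.Coprime (Nat.card B * Nat.card T) (Nat.card V) :=
    Nat.Coprime.mul_left (Nat.Coprime.coprime_dvd_left (Subgroup.card_subgroup_dvd_card B) hco)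
      (Nat.Coprime.coprime_dvd_left (Subgroup.card_subgroup_dvd_card T) hco)
  obtain ⟨u, hu⟩ : ∃ u : ℕ, ∀ v : V, v ^ (Nat.card B * Nat.card T * u) = v := by
    have hV : 1 < Nat.card V := by
      have : Nontrivial V := ⟨⟨w, 1, hw1⟩⟩
      exact Finite.one_lt_card
    obtain ⟨u, -, hu⟩ := Nat.exists_mul_mod_eq_one_of_coprime hcop hV
    refine ⟨u, fun v => ?_⟩
    rw [← pow_mod_natCard, hu, pow_one]
  let f : N ⧸ H → V →* V := fun i => ∏ n ∈ Finset.univ.filter (fun n : N => (QuotientGroup.mk n : N ⧸ H) = i), (P n) ^ u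
  have hfa : ∀ i v, f i v = ∏ n ∈ Finset.univ.filter (fun n : N => (QuotientGroup.mk n : N ⧸ H) = i), (P n v) ^ u := by
    intro i v
    simp only [f, MonoidHom.finsetProd_apply, MonoidHom.pow_apply]
  have hfsum : ∀ v, (∏ᶠ i, f i v) = ∏ n : N, (P n v) ^ u := by
    intro v
    have : Fintype (N ⧸ H) := Fintype.ofFinite _
    rw [finprod_eq_prod_of_fintype]
    simp only [hfa]
    exact Finset.prod_fiberwise _ _ _
  refine ⟨f, ?_, ?_, ?_⟩
  · intro m i v
    rw [hfa, hfa, Finset.smul_prod']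
    refine Finset.prod_bij (fun n _ => m * n) ?_ ?_ ?_ ?_
    · intro n hn
      simp only [Finset.mem_filter, Finset.mem_univ, true_and] at hn ⊢
      rw [← hn]; rfl
    · intro x _ y _ h
      exact mul_left_cancel h
    · intro n hn
      simp only [Finset.mem_filter, Finset.mem_univ, true_and] at hn
      refine ⟨m⁻¹ * n, ?_, by group⟩
      simp only [Finset.mem_filter, Finset.mem_univ, true_and]
      rw [QuotientGroup.mk_mul, hn, QuotientGroup.mk_inv]; group
    · intro n _
      rw [smul_pow', hPd]
  · intro i j hij v
    rw [hfa]
    refine Finset.prod_eq_one fun n hn => ?_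
    rw [hfa, map_prod, Finset.prod_eq_one, one_pow]
    intro m hm
    rw [map_pow, hPc, one_pow]
    intro hmT
    simp only [Finset.mem_filter, Finset.mem_univ, true_and] at hn hm
    apply hij
    rw [← hn, ← hm]
    exact (QuotientGroup.eq.2 (hTH hmT)).symm
  · have hinv : ∀ (m : N) v, m • (∏ n : N, (P n v) ^ u) = ∏ n : N, (P n (m • v)) ^ u := by
      intro m v
      rw [Finset.smul_prod']
      refine Fintype.prod_equiv (Equiv.mulLeft m) _ _ ?_
      intro n
      rw [smul_pow', hPd]; rfl
    let g : V →* V := ∏ n : N, (P n) ^ u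
    have hg : ∀ v, g v = ∏ n : N, (P n v) ^ u := by
      intro v
      simp only [g, MonoidHom.finsetProd_apply, MonoidHom.pow_apply]
    have hgw : g w = w := by
      rw [hg]
      have h5 : ∀ n : N, (P n w) ^ u = if n ∈ T then w ^ (Nat.card B * u) else 1 := by
        intro n
        split_ifs with hn
        · have : P n w = w ^ (Nat.card B) := by
            rw [hP, Finset.prod_eq_pow_card (b := w), Finset.card_univ, Nat.card_eq_fintype_card]
            intro b _
            exact hwB ((Subgroup.mem_normalizer_iff.1 hn b).1 b.2)
          rw [this, ← pow_mul]
        · have h6 : P 1 w = w ^ (Nat.card B) := by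
            rw [hP, Finset.prod_eq_pow_card (b := w), Finset.card_univ, Nat.card_eq_fintype_card]
            intro b _
            have := hwB b.2
            rw [MulAction.mem_stabilizer_iff] at this
            simpa using this
          have h7 := hPc n 1 (w ^ (Nat.card T * u)) (by simpa using hn)
          rw [map_pow, h6, ← pow_mul, ← mul_assoc, hu] at h7
          rw [h7, one_pow]
      simp only [h5]
      rw [Finset.prod_ite, Finset.prod_const, Finset.prod_const_one, mul_one, ← pow_mul]
      have h8 : (Finset.univ.filter (fun n : N => n ∈ T)).card = Nat.card T := by
        rw [Nat.card_eq_fintype_card, Fintype.card_subtype]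
      rw [h8, mul_right_comm, hu]
    have hW := hirr ((g.eqLocus (MonoidHom.id V))) (by
      intro n x hx
      change g (n • x) = n • x
      have hx' : g x = x := hx
      rw [hg, ← hinv, ← hg, hx'])
    intro v
    rw [hfsum, ← hg]
    rcases hW with hW | hW
    · exfalso
      apply hw1
      have : w ∈ g.eqLocus (MonoidHom.id V) := hgw
      rw [hW, Subgroup.mem_bot] at this
      exact this
    · have : v ∈ g.eqLocus (MonoidHom.id V) := by rw [hW]; trivial
      exact this


theorem isc_card_sub {N : Type*} [Group N] (L S : Subgroup N) (A : Subgroup L)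
    (h : ∀ l : L, l ∈ A ↔ (l : N) ∈ S) : Nat.card (L ⊓ S : Subgroup N) = Nat.card A :=
  Nat.card_congr
    { toFun := fun n => ⟨⟨n.1, n.2.1⟩, (h _).2 n.2.2⟩
      invFun := fun l => ⟨l.1.1, l.1.2, (h _).1 l.2⟩
      left_inv := fun _ => rfl
      right_inv := fun _ => rfl }

theorem isc_rel_of {N X Y : Type*} [Group N] [MulAction N X] (p : ℕ) (L : Subgroup N)
    [MulAction L Y] (j : Y → X) (hj : Function.Injective j)
    (heq : ∀ (l : L) y, j (l • y) = (l : N) • j y)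
    (h : iscRel p (Set.univ : Set Y) (⊤ : Subgroup L)) : iscRel p (Set.range j) L := by
  have hK : ∀ l : L, l ∈ iscKer L (Set.univ : Set Y) ↔ (l : N) ∈ iscKer N (Set.range j) := by
    intro l
    rw [mem_iscKer, mem_iscKer]
    constructor
    · rintro h _ ⟨y, rfl⟩
      rw [← heq, h y trivial]
    · intro h y _
      apply hj
      rw [heq]
      exact h _ ⟨y, rfl⟩
  rcases h with h | ⟨y, -, h⟩
  · left
    intro n hn
    exact (hK ⟨n, hn⟩).1 (h trivial)
  · right
    refine ⟨j y, ⟨y, rfl⟩, ?_⟩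
    rw [top_inf_eq, top_inf_eq, Subgroup.card_top] at h
    rw [isc_card_sub L _ _ hK, isc_card_sub L _ (MulAction.stabilizer L y)]
    · exact h
    · intro l
      rw [MulAction.mem_stabilizer_iff, MulAction.mem_stabilizer_iff, ← heq, hj.eq_iff]

theorem isc_rel_marks {N X Y : Type*} [Group N] [Finite N] [Finite X] [Finite Y]
    [MulAction N X] [MulAction N Y] (p : ℕ)
    (h : ∀ B : Subgroup N, Nat.card {x : X // ∀ b ∈ B, b • x = x} =
      Nat.card {y : Y // ∀ b ∈ B, b • y = y})
    (hX : iscRel p (Set.univ : Set X) (⊤ : Subgroup N)) :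
    iscRel p (Set.univ : Set Y) (⊤ : Subgroup N) := by
  have h1 := isc_marks_exists h
  have h2 := isc_marks_exists (fun B => (h B).symm)
  have hK : iscKer N (Set.univ : Set X) = iscKer N (Set.univ : Set Y) := by
    ext n
    rw [mem_iscKer, mem_iscKer]
    constructor
    · intro hn y _
      obtain ⟨x, hx⟩ := h2 y
      have : n ∈ MulAction.stabilizer N x := hn x trivial
      rw [hx] at this
      exact this
    · intro hn y _
      obtain ⟨x, hx⟩ := h1 y
      have : n ∈ MulAction.stabilizer N x := hn x trivial
      rw [hx] at this
      exact this
  rcases hX with hX | ⟨x, -, hX⟩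
  · left; rwa [← hK]
  · right
    obtain ⟨y, hy⟩ := h1 x
    refine ⟨y, trivial, ?_⟩
    rwa [hy, ← hK]

theorem isc_card_comap {N M : Type*} [Group N] [Finite N] [Group M] (φ : N →* M)
    (hφ : Function.Surjective φ) (S : Subgroup M) :
    Nat.card (S.comap φ) = Nat.card φ.ker * Nat.card S := by
  have : Finite M := Finite.of_surjective φ hφ
  have h1 : Nat.card (S.comap φ) * S.index = Nat.card N := by
    rw [← Subgroup.index_comap_of_surjective S hφ, Subgroup.card_mul_index]
  have h2 : Nat.card φ.ker * Nat.card M = Nat.card N := by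
    rw [← Subgroup.card_mul_index φ.ker, Subgroup.index_ker, MonoidHom.range_eq_top.2 hφ,
      Subgroup.card_top]
  have h3 := Subgroup.card_mul_index S
  have h4 : S.index ≠ 0 := Subgroup.index_ne_zero_of_finite
  apply Nat.eq_of_mul_eq_mul_right (Nat.pos_of_ne_zero h4)
  rw [h1, ← h2, ← h3, mul_assoc]

theorem isc_rel_quot {N M X : Type*} [Group N] [Finite N] [Group M] [MulAction N X] [MulAction M X]
    (p : ℕ) (hp : 1 ≤ p) (φ : N →* M) (hφ : Function.Surjective φ)
    (heq : ∀ n (x : X), φ n • x = n • x)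
    (h : iscRel p (Set.univ : Set X) (⊤ : Subgroup M)) :
    iscRel p (Set.univ : Set X) (⊤ : Subgroup N) := by
  have hK : iscKer N (Set.univ : Set X) = (iscKer M (Set.univ : Set X)).comap φ := by
    ext n
    rw [Subgroup.mem_comap, mem_iscKer, mem_iscKer]
    simp only [heq]
  have hS : ∀ x : X, MulAction.stabilizer N x = (MulAction.stabilizer M x).comap φ := by
    intro x
    ext n
    rw [Subgroup.mem_comap, MulAction.mem_stabilizer_iff, MulAction.mem_stabilizer_iff, heq]
  rcases h with h | ⟨x, -, h⟩
  · left
    intro n _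
    rw [hK]
    exact h trivial
  · right
    refine ⟨x, trivial, ?_⟩
    rw [top_inf_eq, top_inf_eq, Subgroup.card_top] at h ⊢
    rw [hK, hS, isc_card_comap φ hφ, isc_card_comap φ hφ]
    have h2 := isc_card_comap φ hφ ⊤
    rw [Subgroup.comap_top, Subgroup.card_top, Subgroup.card_top] at h2
    rw [h2]
    have ep : p = (p - 1) + 1 := by omega
    set s := Nat.card (MulAction.stabilizer M x)
    set k := Nat.card (iscKer M (Set.univ : Set X))
    calc p * (Nat.card φ.ker * s) ^ p = Nat.card φ.ker ^ p * (p * s ^ p) := by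
          rw [mul_pow]; ring
      _ ≤ Nat.card φ.ker ^ p * (Nat.card M * k ^ (p - 1)) := by gcongr
      _ = Nat.card φ.ker * Nat.card M * (Nat.card φ.ker * k) ^ (p - 1) := by
          rw [mul_pow]
          conv_lhs => rw [ep, pow_succ, ← ep]
          ring

theorem isc_abs {N Z ι : Type*} [Group N] [Finite N] [MulAction N Z] [Fintype ι] [DecidableEq ι]
    (p : ℕ) (hp : 2 ≤ p) (𝒮 : ι → Set (Subgroup N)) (K : ι → Subgroup N)
    (h : ∀ i, ∀ L : Subgroup N, L ≤ K i ∨ ∃ S ∈ 𝒮 i, K i ≤ S ∧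
      p * Nat.card (L ⊓ S : Subgroup N) ^ p ≤ Nat.card L * Nat.card (L ⊓ K i : Subgroup N) ^ (p - 1))
    (hZ : ∀ (J : Finset ι) (S : ι → Subgroup N), (∀ i ∈ J, S i ∈ 𝒮 i) →
      ∃ z : Z, MulAction.stabilizer N z ≤ J.inf S)
    (hK : ∀ n, (∀ i, n ∈ K i) → n ∈ iscKer N (Set.univ : Set Z)) :
    iscRel p (Set.univ : Set Z) (⊤ : Subgroup N) := by
  obtain ⟨J, S, -, hS, -, hb⟩ := isc_chain p (by omega) 𝒮 K h Finset.univ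
  obtain ⟨z, hz⟩ := hZ J S hS
  have hKle : Finset.univ.inf K ≤ iscKer N (Set.univ : Set Z) := by
    intro n hn
    apply hK
    intro i
    exact (Finset.inf_le (Finset.mem_univ i) : Finset.univ.inf K ≤ K i) hn
  have hKc := Subgroup.card_le_of_le hKle
  rcases J.eq_empty_or_nonempty with hJ | hJ
  · left
    rw [hJ, Finset.inf_empty, Finset.card_empty, pow_zero, one_mul, Subgroup.card_top] at hb
    have h1 : Nat.card N ≤ Nat.card (iscKer N (Set.univ : Set Z)) := by
      refine le_trans ?_ hKc
      by_contra! hlt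
      have hN : 0 < Nat.card N := Nat.card_pos
      have ep : p = (p - 1) + 1 := by omega
      have h2 := Nat.pow_lt_pow_left hlt (by omega : p - 1 ≠ 0)
      have h3 := Nat.mul_lt_mul_of_pos_left h2 hN
      rw [← pow_succ', ← ep] at h3
      omega
    rw [Subgroup.eq_top_of_le_card _ h1]
  · right
    refine ⟨z, trivial, ?_⟩
    rw [top_inf_eq, top_inf_eq, Subgroup.card_top]
    have hJ1 : p ≤ p ^ J.card := Nat.le_self_pow (Finset.card_pos.2 hJ).ne' p
    calc _ ≤ p ^ J.card * Nat.card (J.inf S : Subgroup N) ^ p := by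
          gcongr
          exact Subgroup.card_le_of_le hz
      _ ≤ _ := hb
      _ ≤ _ := by gcongr

theorem isc_pi {N ι : Type*} {X : ι → Type*} [Group N] [Finite N] [∀ i, MulAction N (X i)]
    [Fintype ι] [DecidableEq ι] (p : ℕ) (hp : 2 ≤ p) (o : ∀ i, X i)
    (h : ∀ i, ∀ L : Subgroup N, iscRel p (Set.univ : Set (X i)) L) :
    iscRel p (Set.univ : Set (∀ i, X i)) (⊤ : Subgroup N) := by
  classical
  refine isc_abs p hp (fun i => {S | ∃ x : X i, S = MulAction.stabilizer N x})
    (fun i => iscKer N (Set.univ : Set (X i))) ?_ ?_ ?_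
  · intro i L
    rcases h i L with h | ⟨x, hx, hle⟩
    · exact Or.inl h
    · exact Or.inr ⟨_, ⟨x, rfl⟩, iscKer_le hx, hle⟩
  · intro J S hS
    have hex : ∀ i, ∃ x : X i, i ∈ J → S i = MulAction.stabilizer N x := by
      intro i
      by_cases hi : i ∈ J
      · obtain ⟨x, hx⟩ := hS i hi
        exact ⟨x, fun _ => hx⟩
      · exact ⟨o i, fun h => absurd h hi⟩
    choose x hx using hex
    refine ⟨x, Finset.le_inf fun i hi => ?_⟩
    rw [hx i hi]
    intro n hn
    exact congrFun hn i
  · intro n hn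
    rw [mem_iscKer]
    intro z _
    funext i
    exact mem_iscKer.1 (hn i) (z i) trivial

theorem isc_two {N X Y : Type*} [Group N] [Finite N] [MulAction N X] [MulAction N Y]
    (p : ℕ) (hp : 2 ≤ p) (o : X) (o' : Y)
    (hX : ∀ L : Subgroup N, iscRel p (Set.univ : Set X) L)
    (hY : ∀ L : Subgroup N, iscRel p (Set.univ : Set Y) L) :
    iscRel p (Set.univ : Set (X × Y)) (⊤ : Subgroup N) := by
  classical
  refine isc_abs (ι := Bool) p hp
    (fun i => if i then {S | ∃ x : X, S = MulAction.stabilizer N x} else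
      {S | ∃ x : Y, S = MulAction.stabilizer N x})
    (fun i => if i then iscKer N (Set.univ : Set X) else iscKer N (Set.univ : Set Y)) ?_ ?_ ?_
  · intro i L
    cases i
    · rcases hY L with h | ⟨x, hx, hle⟩
      · exact Or.inl h
      · exact Or.inr ⟨_, ⟨x, rfl⟩, iscKer_le hx, hle⟩
    · rcases hX L with h | ⟨x, hx, hle⟩
      · exact Or.inl h
      · exact Or.inr ⟨_, ⟨x, rfl⟩, iscKer_le hx, hle⟩
  · intro J S hS
    have hex : ∃ x : X, true ∈ J → S true = MulAction.stabilizer N x := by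
      by_cases hi : true ∈ J
      · obtain ⟨x, hx⟩ := hS _ hi
        exact ⟨x, fun _ => hx⟩
      · exact ⟨o, fun h => absurd h hi⟩
    have hey : ∃ y : Y, false ∈ J → S false = MulAction.stabilizer N y := by
      by_cases hi : false ∈ J
      · obtain ⟨x, hx⟩ := hS _ hi
        exact ⟨x, fun _ => hx⟩
      · exact ⟨o', fun h => absurd h hi⟩
    obtain ⟨x, hx⟩ := hex
    obtain ⟨y, hy⟩ := hey
    refine ⟨(x, y), Finset.le_inf fun i hi => ?_⟩
    cases i
    · rw [hy hi]
      intro n hn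
      exact congrArg Prod.snd hn
    · rw [hx hi]
      intro n hn
      exact congrArg Prod.fst hn
  · intro n hn
    rw [mem_iscKer]
    rintro ⟨x, y⟩ _
    have h1 := hn true
    have h2 := hn false
    exact Prod.ext (mem_iscKer.1 h1 x trivial) (mem_iscKer.1 h2 y trivial)

theorem isc_irred {N V : Type*} [Group N] [Finite N] [Nontrivial N] [Group.IsNilpotent N]
    [CommGroup V] [Finite V] [Nontrivial V] [MulDistribMulAction N V]
    (hco : Nat.Coprime (Nat.card N) (Nat.card V)) (p : ℕ) (hp : 2 ≤ p)
    (hpm : ∀ r : ℕ, r.Prime → r ∣ Nat.card N → p ≤ r)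
    (hf : ∀ n : N, (∀ v : V, n • v = v) → n = 1)
    (hirr : ∀ W : Subgroup V, (∀ n : N, ∀ w ∈ W, n • w ∈ W) → W = ⊥ ∨ W = ⊤)
    (hIH : ∀ (H : Subgroup N) (D : Subgroup V), D ≠ ⊤ → (∀ h ∈ H, ∀ d ∈ D, h • d ∈ D) →
      ∀ L : Subgroup H, iscRel p (D : Set V) L) :
    ∃ v : V, p * Nat.card (MulAction.stabilizer N v) ^ p ≤ Nat.card N := by
  classical
  by_cases hsr : ∀ A : Subgroup N, A.Normal → (∀ x ∈ A, ∀ y ∈ A, x * y = y * x) →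
      ∀ a ∈ A, a ≠ 1 → ∀ v : V, a • v = v → v = 1
  · exact isc_core hco hsr p hp hpm
  push Not at hsr
  obtain ⟨A, hAn, hAc, a, ha, ha1, v0, hav, hv0⟩ := hsr
  obtain ⟨H, hHn, hHp, f, h1, h2, h3⟩ := isc_decomp hco hf hirr A hAn hAc a ha ha1 v0 hv0 hav
  refine isc_imprim p hp hpm hf H hHp f h1 h2 h3 ?_
  intro i L
  refine hIH H (f i).range ?_ ?_ L
  · intro htop
    have hnt : Nontrivial (N ⧸ H) := by
      rw [← Finite.one_lt_card_iff_nontrivial]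
      exact hHp.one_lt
    obtain ⟨j, hj⟩ := exists_ne i
    have hj0 : ∀ v, f j v = 1 := by
      intro v
      have : v ∈ (f i).range := by rw [htop]; trivial
      obtain ⟨w, rfl⟩ := this
      exact h2 j i hj w
    have hall : ∀ k v, f k v = 1 := by
      intro k v
      obtain ⟨n, hn⟩ := QuotientGroup.mk_surjective (k * j⁻¹)
      have := h1 n j (n⁻¹ • v)
      rw [hj0, smul_one, hn, smul_inv_smul, inv_mul_cancel_right] at this
      exact this.symm
    apply hv0
    rw [← h3 v0]
    simp only [hall]
    exact finprod_one
  · rintro h hh _ ⟨w, rfl⟩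
    rw [h1, (QuotientGroup.eq_one_iff h).2 hh, one_mul]
    exact ⟨_, rfl⟩


/-- the action on a quotient -/
@[reducible] def iscQuot {N G : Type*} [Group N] [Group G] [MulDistribMulAction N G]
    (M : Subgroup G) [M.Normal] (h : ∀ n : N, ∀ m ∈ M, n • m ∈ M) :
    MulDistribMulAction N (G ⧸ M) where
  smul n := QuotientGroup.map M M (MulDistribMulAction.toMonoidHom G n) (fun m hm => h n m hm)
  one_smul x := by
    obtain ⟨g, rfl⟩ := QuotientGroup.mk_surjective x
    exact congrArg QuotientGroup.mk (one_smul N g)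
  mul_smul a b x := by
    obtain ⟨g, rfl⟩ := QuotientGroup.mk_surjective x
    exact congrArg QuotientGroup.mk (mul_smul a b g)
  smul_mul a x y := map_mul _ x y
  smul_one a := map_one _

universe u v

/-- the inductive property -/
def iscAll (p : ℕ) (k : ℕ) : Prop :=
  ∀ (N : Type u) (G : Type v) [Group N] [Finite N] [Group.IsNilpotent N] [Group G] [Finite G]
    [MulDistribMulAction N G], Nat.Coprime (Nat.card N) (Nat.card G) →
    (∀ r : ℕ, r.Prime → r ∣ Nat.card N → p ≤ r) → Nat.card G < k →
    iscRel p (Set.univ : Set G) (⊤ : Subgroup N)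

theorem isc_all_sub {p k : ℕ} (IH : iscAll.{u, v} p k) {N : Type u} {G : Type v} [Group N] [Finite N]
    [Group.IsNilpotent N] [Group G] [Finite G] [MulDistribMulAction N G]
    (hco : Nat.Coprime (Nat.card N) (Nat.card G))
    (hpm : ∀ r : ℕ, r.Prime → r ∣ Nat.card N → p ≤ r) (hk : Nat.card G < k) (L : Subgroup N) :
    iscRel p (Set.univ : Set G) L := by
  have h1 := IH L G (hco.coprime_dvd_left (Subgroup.card_subgroup_dvd_card L))
    (fun r hr hrd => hpm r hr (hrd.trans (Subgroup.card_subgroup_dvd_card L))) hk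
  have h2 := isc_rel_of p L (id : G → G) Function.injective_id (fun _ _ => rfl) h1
  rwa [Set.range_id] at h2

theorem isc_card_lt {G : Type*} [Group G] [Finite G] (D : Subgroup G) (hD : D ≠ ⊤) :
    Nat.card D < Nat.card G := by
  refine lt_of_le_of_ne (Subgroup.card_le_card_group D) ?_
  intro h
  exact hD (Subgroup.eq_top_of_card_eq D h)

theorem isc_case_normal {p : ℕ} (hp : 2 ≤ p) {N : Type u} {G : Type v} [Group N] [Finite N]
    [Group.IsNilpotent N] [Group G] [Finite G] [MulDistribMulAction N G]
    (IH : iscAll.{u, v} p (Nat.card G))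
    (hco : Nat.Coprime (Nat.card N) (Nat.card G))
    (hpm : ∀ r : ℕ, r.Prime → r ∣ Nat.card N → p ≤ r)
    (M : Subgroup G) (hMn : M.Normal) (hM : ∀ n : N, ∀ m ∈ M, n • m ∈ M)
    (hbot : M ≠ ⊥) (htop : M ≠ ⊤) : iscRel p (Set.univ : Set G) (⊤ : Subgroup N) := by
  let _ : MulDistribMulAction N M := iscSub M hM
  let _ : MulDistribMulAction N (G ⧸ M) := iscQuot M hM
  have hcard : Nat.card (G ⧸ M) < Nat.card G := by
    have h1 := Subgroup.card_eq_card_quotient_mul_card_subgroup M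
    have h2 : Nat.card M ≠ 1 := fun h => hbot (Subgroup.card_eq_one.1 h)
    have h3 : 0 < Nat.card M := Nat.card_pos
    have h4 : 0 < Nat.card (G ⧸ M) := Nat.card_pos
    rw [h1]
    nlinarith [show 2 ≤ Nat.card M by omega]
  have hX := isc_all_sub IH (N := N) (G := M)
    (hco.coprime_dvd_right (Subgroup.card_subgroup_dvd_card M)) hpm (isc_card_lt M htop)
  have hY := isc_all_sub IH (N := N) (G := G ⧸ M)
    (hco.coprime_dvd_right (Subgroup.card_quotient_dvd_card M)) hpm hcard
  have h2 := isc_two p hp 1 1 hX hY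
  refine isc_rel_marks p ?_ h2
  intro B
  have h3 := isc_quot_marks hco M (fun _ _ => rfl) (fun _ _ => rfl) B
  have h4 : Nat.card {y : G // ∀ b ∈ B, b • y = y} = Nat.card (iscFix G B) := rfl
  rw [h4, h3, ← Nat.card_prod]
  exact Nat.card_congr
    { toFun := fun z => (⟨z.1.1, fun b hb => congrArg Prod.fst (z.2 b hb)⟩,
        ⟨z.1.2, fun b hb => congrArg Prod.snd (z.2 b hb)⟩)
      invFun := fun z => ⟨(z.1.1, z.2.1), fun b hb => Prod.ext (z.1.2 b hb) (z.2.2 b hb)⟩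
      left_inv := fun _ => rfl
      right_inv := fun _ => rfl }

open scoped Pointwise in
theorem isc_case_sylow {p : ℕ} (hp : 2 ≤ p) {N : Type u} {G : Type v} [Group N] [Finite N]
    [Group.IsNilpotent N] [Group G] [Finite G] [MulDistribMulAction N G]
    (IH : iscAll.{u, v} p (Nat.card G))
    (hco : Nat.Coprime (Nat.card N) (Nat.card G))
    (hpm : ∀ r : ℕ, r.Prime → r ∣ Nat.card N → p ≤ r)
    (hG : ∀ q : ℕ, q.Prime → ¬ IsPGroup q G) : iscRel p (Set.univ : Set G) (⊤ : Subgroup N) := by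
  classical
  let ι := {q : ℕ // q ∈ (Nat.card G).primeFactors}
  have hfact : ∀ q : ι, Fact q.1.Prime := fun q => ⟨Nat.prime_of_mem_primeFactors q.2⟩
  have hex : ∀ q : ι, ∃ Q : Sylow q.1 G, ∀ n : N, n • Q = Q := by
    intro q
    obtain ⟨Q, hQ⟩ := (isc_sylow_glauberman hco q.1 (⊤ : Subgroup N)).1
    exact ⟨Q, fun n => hQ n trivial⟩
  choose Q hQ using hex
  have hQi : ∀ q : ι, ∀ n : N, ∀ g ∈ (Q q).1, n • g ∈ (Q q).1 := by
    intro q n g hg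
    have h1 : ((n • Q q : Sylow q.1 G) : Subgroup G) = (Q q).1 := by rw [hQ]
    rw [← h1]
    exact Subgroup.smul_mem_pointwise_smul g n (Q q).1 hg
  let _ : ∀ q : ι, MulDistribMulAction N (Q q).1 := fun q => iscSub (Q q).1 (hQi q)
  have hlt : ∀ q : ι, Nat.card (Q q).1 < Nat.card G := by
    intro q
    apply isc_card_lt
    intro htop
    apply hG q.1 (hfact q).out
    have h1 := (Q q).2
    rw [htop] at h1
    exact h1.of_equiv Subgroup.topEquiv
  have hX : ∀ q : ι, ∀ L : Subgroup N, iscRel p (Set.univ : Set (Q q).1) L := fun q =>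
    isc_all_sub IH (N := N) (G := (Q q).1)
      (hco.coprime_dvd_right (Subgroup.card_subgroup_dvd_card _)) hpm (hlt q)
  have h2 := isc_pi (N := N) (X := fun q : ι => (Q q).1) p hp (fun _ => 1) hX
  refine isc_rel_marks p ?_ h2
  intro B
  have h4 : Nat.card {y : G // ∀ b ∈ B, b • y = y} = Nat.card (iscFix G B) := rfl
  rw [h4]
  have h5 : Nat.card {z : (∀ q : ι, (Q q).1) // ∀ b ∈ B, b • z = z} =
      Nat.card (∀ q : ι, ((Q q).1 ⊓ iscFix G B : Subgroup G)) := Nat.card_congr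
    { toFun := fun z q => ⟨(z.1 q).1, (z.1 q).2, fun b hb =>
        congrArg Subtype.val (congrFun (z.2 b hb) q)⟩
      invFun := fun z => ⟨fun q => ⟨(z q).1, (z q).2.1⟩, fun b hb =>
        funext fun q => Subtype.ext ((z q).2.2 b hb)⟩
      left_inv := fun _ => rfl
      right_inv := fun _ => rfl }
  rw [h5, Nat.card_pi]
  have h6 : ∀ q : ι, Nat.card ((Q q).1 ⊓ iscFix G B : Subgroup G) =
      q.1 ^ (Nat.card (iscFix G B)).factorization q.1 :=
    fun q => isc_sylow_marks hco q.1 (Q q) (hQ q) B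
  simp only [h6]
  have h7 : ∏ q : ι, q.1 ^ (Nat.card (iscFix G B)).factorization q.1 =
      ∏ q ∈ (Nat.card G).primeFactors, q ^ (Nat.card (iscFix G B)).factorization q :=
    Finset.prod_coe_sort (Nat.card G).primeFactors
      (fun q => q ^ (Nat.card (iscFix G B)).factorization q)
  rw [h7]
  have h8 : Nat.card (iscFix G B) ≠ 0 := Nat.card_pos.ne'
  conv_rhs => rw [← Nat.prod_factorization_pow_eq_self h8]
  rw [Finsupp.prod, Nat.support_factorization]
  symm
  apply Finset.prod_subset
  · exact Nat.primeFactors_mono (Subgroup.card_subgroup_dvd_card _) Nat.card_pos.ne'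
  · intro q _ hq
    rw [← Nat.support_factorization, Finsupp.notMem_support_iff] at hq
    rw [hq, pow_zero]

theorem isc_case_pgroup {p : ℕ} (hp : 2 ≤ p) {N : Type u} {G : Type v} [Group N] [Finite N]
    [Group.IsNilpotent N] [Nontrivial N] [Group G] [Finite G] [MulDistribMulAction N G]
    (IH : iscAll.{u, v} p (Nat.card G))
    (hco : Nat.Coprime (Nat.card N) (Nat.card G))
    (hpm : ∀ r : ℕ, r.Prime → r ∣ Nat.card N → p ≤ r)
    (hf : ∀ n : N, (∀ v : G, n • v = v) → n = 1)
    (hM : ∀ M : Subgroup G, M.Normal → (∀ n : N, ∀ m ∈ M, n • m ∈ M) → M = ⊥ ∨ M = ⊤)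
    (q : ℕ) (hq : q.Prime) (hG : IsPGroup q G) :
    ∃ v : G, p * Nat.card (MulAction.stabilizer N v) ^ p ≤ Nat.card N := by
  have : Fact q.Prime := ⟨hq⟩
  have hnt : Nontrivial G := by
    by_contra hcon
    rw [not_nontrivial_iff_subsingleton] at hcon
    obtain ⟨n, hn⟩ := exists_ne (1 : N)
    exact hn (hf n fun v => Subsingleton.elim _ _)
  have hc : Subgroup.center G = ⊤ := by
    rcases hM (Subgroup.center G) inferInstance (by
      intro n z hz
      rw [Subgroup.mem_center_iff] at hz ⊢
      intro g
      have := congrArg (n • ·) (hz (n⁻¹ • g))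
      simpa only [smul_mul', smul_inv_smul] using this) with h | h
    · have := hG.center_nontrivial
      exact absurd h ((Subgroup.nontrivial_iff_ne_bot _).1 this)
    · exact h
  have hcomm : ∀ a b : G, a * b = b * a := by
    intro a b
    have : b ∈ Subgroup.center G := by rw [hc]; trivial
    exact Subgroup.mem_center_iff.1 this a
  let iG : CommGroup G := { (inferInstance : Group G) with mul_comm := hcomm }
  refine @isc_irred N G _ _ _ _ iG _ _ _ hco p hp hpm hf ?_ ?_
  · intro W hW
    refine hM W ⟨fun n hn g => ?_⟩ hW
    have : g * n * g⁻¹ = n := by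
      rw [hcomm g n, mul_inv_cancel_right]
    rw [this]; exact hn
  · intro H D hD hinv L
    have hcoL : Nat.Coprime (Nat.card L) (Nat.card D) :=
      (hco.coprime_dvd_left ((Subgroup.card_subgroup_dvd_card L).trans
        (Subgroup.card_subgroup_dvd_card H))).coprime_dvd_right (Subgroup.card_subgroup_dvd_card D)
    let _ : MulDistribMulAction L D := iscSub D (fun l d hd => hinv l.1.1 l.1.2 d hd)
    have h1 := IH L D hcoL (fun r hr hrd => hpm r hr (hrd.trans
      ((Subgroup.card_subgroup_dvd_card L).trans (Subgroup.card_subgroup_dvd_card H))))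
      (isc_card_lt D hD)
    have h2 := isc_rel_of p L (Subtype.val : D → G) Subtype.val_injective (fun _ _ => rfl) h1
    rwa [Subtype.range_coe] at h2

theorem isc_case_faithful {p : ℕ} (hp : 2 ≤ p) {N : Type u} {G : Type v} [Group N] [Finite N]
    [Group.IsNilpotent N] [Group G] [Finite G] [MulDistribMulAction N G]
    (IH : iscAll.{u, v} p (Nat.card G))
    (hco : Nat.Coprime (Nat.card N) (Nat.card G))
    (hpm : ∀ r : ℕ, r.Prime → r ∣ Nat.card N → p ≤ r)
    (hf : ∀ n : N, (∀ v : G, n • v = v) → n = 1) :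
    iscRel p (Set.univ : Set G) (⊤ : Subgroup N) := by
  rcases subsingleton_or_nontrivial N with hN | hN
  · left
    intro n _
    rw [Subsingleton.elim n 1]
    exact Subgroup.one_mem _
  by_cases hM : ∀ M : Subgroup G, M.Normal → (∀ n : N, ∀ m ∈ M, n • m ∈ M) → M = ⊥ ∨ M = ⊤
  · by_cases hG : ∀ q : ℕ, q.Prime → ¬ IsPGroup q G
    · exact isc_case_sylow hp IH hco hpm hG
    · push Not at hG
      obtain ⟨q, hq, hG⟩ := hG
      obtain ⟨v, hv⟩ := isc_case_pgroup hp IH hco hpm hf hM q hq hG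
      right
      refine ⟨v, trivial, ?_⟩
      rw [top_inf_eq, top_inf_eq, Subgroup.card_top]
      refine hv.trans (Nat.le_mul_of_pos_right _ ?_)
      have : 0 < Nat.card (iscKer N (Set.univ : Set G)) := Nat.card_pos
      positivity
  · push Not at hM
    obtain ⟨M, hMn, hMi, hbot, htop⟩ := hM
    exact isc_case_normal hp IH hco hpm M hMn hMi hbot htop

theorem isc_all {p : ℕ} (hp : 2 ≤ p) (k : ℕ) : iscAll.{u, v} p k := by
  induction k with
  | zero => intro N G _ _ _ _ _ _ _ _ h; omega
  | succ k ih =>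
    intro N G _ _ _ _ _ _ hco hpm hk
    have IH : iscAll.{u, v} p (Nat.card G) := by
      intro N' G' _ _ _ _ _ _ hco' hpm' hk'
      exact ih N' G' hco' hpm' (by omega)
    let φ : N →* MulAut G := MulDistribMulAction.toMulAut N G
    let K := φ.ker
    let ψ : N ⧸ K →* MulAut G := QuotientGroup.kerLift φ
    let _ : MulDistribMulAction (N ⧸ K) G := MulDistribMulAction.compHom G ψ
    have heq : ∀ (n : N) (x : G), (QuotientGroup.mk' K n) • x = n • x := fun _ _ => rfl
    have hdvd : Nat.card (N ⧸ K) ∣ Nat.card N := Subgroup.card_quotient_dvd_card K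
    refine isc_rel_quot p (by omega) (QuotientGroup.mk' K) (QuotientGroup.mk'_surjective K) heq ?_
    refine isc_case_faithful hp IH (hco.coprime_dvd_left hdvd)
      (fun r hr hrd => hpm r hr (hrd.trans hdvd)) ?_
    intro n hn
    have h1 : ψ n = 1 := by
      ext x
      exact hn x
    exact (injective_iff_map_eq_one ψ).1 (QuotientGroup.kerLift_injective φ) n h1

theorem isaacs_small_centralizer {N G : Type*} [Group N] [Finite N] [Nontrivial N]
    [Group.IsNilpotent N] [Group G] [Finite G] [MulDistribMulAction N G] [FaithfulSMul N G]
    (hcoprime : Nat.Coprime (Nat.card N) (Nat.card G)) :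
    ∃ g : G, (Nat.card {n : N // n • g = g} : ℝ) ≤
      ((Nat.card N : ℝ) / ((Nat.card N).minFac : ℝ)) ^ ((1 : ℝ) / ((Nat.card N).minFac : ℝ)) := by
  set p := (Nat.card N).minFac with hpdef
  have hN1 : Nat.card N ≠ 1 := (Finite.one_lt_card (α := N)).ne'
  have hpp : p.Prime := Nat.minFac_prime hN1
  have hf : ∀ n : N, (∀ v : G, n • v = v) → n = 1 := by
    intro n hn
    apply FaithfulSMul.eq_of_smul_eq_smul (α := G)
    intro v
    rw [hn, one_smul]
  have h := isc_all hpp.two_le (Nat.card G + 1) N G hcoprime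
    (fun r hr hrd => Nat.minFac_le_of_dvd hr.two_le hrd) (Nat.lt_succ_self _)
  have hK : iscKer N (Set.univ : Set G) = ⊥ := by
    rw [eq_bot_iff]
    intro n hn
    rw [Subgroup.mem_bot]
    exact hf n fun v => mem_iscKer.1 hn v trivial
  rcases h with h | ⟨g, -, h⟩
  · rw [hK, top_le_iff] at h
    exact absurd h bot_ne_top
  refine ⟨g, ?_⟩
  rw [hK, top_inf_eq, inf_bot_eq, Subgroup.card_top, Subgroup.card_bot, one_pow, mul_one] at h
  have e : Nat.card {n : N // n • g = g} = Nat.card (MulAction.stabilizer N g) := rfl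
  rw [e]
  set c := Nat.card (MulAction.stabilizer N g)
  have hp0 : (0 : ℝ) < p := by exact_mod_cast hpp.pos
  have h2 : (c : ℝ) ^ p ≤ (Nat.card N : ℝ) / p := by
    rw [le_div_iff₀ hp0, mul_comm]
    exact_mod_cast h
  have h3 : (c : ℝ) = ((c : ℝ) ^ p) ^ ((1 : ℝ) / p) := by
    rw [one_div, Real.pow_rpow_inv_natCast (Nat.cast_nonneg _) hpp.ne_zero]
  rw [h3]
  exact Real.rpow_le_rpow (by positivity) h2 (by positivity)
end
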